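/- arXiv:1908.00607 — 2 statements merged into one kernel-verified Lean document; each statement's English description precedes it below -/
import Mathlib

section
/- Let 2 < p < 5 and 1 < γ < γ₀ < min{2, p−1}. There exists a constant C > 0, depending only on p, γ₀ and γ (in particular independent of the point q), such that for every smooth solution φ of the defocusing semilinear wave equation with E_{0,γ₀}[φ] < ∞ and every point q = (t₀, x₀) with t₀ ≥ 0, one has ∫₀^{t₀} ∫_{S²} [ ((1+τ) v₊^γ + u₊^γ) |φ|^{p+1} ](t₀−r̃, x₀+r̃ω̃) · r̃² dσ(ω̃) dr̃ ≤ C · E_{0,γ₀}[φ], where at the point (t,x) = (t₀−r̃, x₀+r̃ω̃), τ = (x·ω̃)/|x| (interpreted arbitrarily when x = 0), u₊ = √(1+((t−|x|)/2)²) and v₊ = √(1+((t+|x|)/2)²). -/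
open MeasureTheory Real
open scoped ENNReal InnerProductSpace

noncomputable section

/-- Three-dimensional Euclidean space. -/
abbrev E3 : Type := EuclideanSpace ℝ (Fin 3)

/-- Second derivative of `f` at `x` in the direction `v`. -/
def der2 (f : E3 → ℝ) (x v : E3) : ℝ := fderiv ℝ (fun y => fderiv ℝ f y v) x v

/-- The (spatial) Laplacian on `ℝ³`. -/
def lap3 (f : E3 → ℝ) (x : E3) : ℝ :=
  ∑ i : Fin 3, der2 f x (EuclideanSpace.single i 1)

/-- First time derivative `∂_t φ`. -/
def dt1 (φ : ℝ → E3 → ℝ) (t : ℝ) (x : E3) : ℝ := deriv (fun s => φ s x) t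

/-- Second time derivative `∂_t² φ`. -/
def dtt (φ : ℝ → E3 → ℝ) (t : ℝ) (x : E3) : ℝ := deriv (fun s => dt1 φ s x) t

/-- `φ` is a smooth solution of the defocusing semilinear wave equation
`∂_t²φ − Δφ + |φ|^{p−1}φ = 0` on `[0,∞) × ℝ³`. -/
def IsNLWSolution (p : ℝ) (φ : ℝ → E3 → ℝ) : Prop :=
  ContDiff ℝ (⊤ : ℕ∞) (fun q : ℝ × E3 => φ q.1 q.2) ∧
    ∀ t : ℝ, 0 ≤ t → ∀ x : E3,
      dtt φ t x - lap3 (φ t) x + |φ t x| ^ (p - 1) * φ t x = 0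

/-- The weighted initial energy `E_{k,γ₀}[φ]`. -/
def wEnergy (p : ℝ) (k : ℕ) (γ₀ : ℝ) (φ : ℝ → E3 → ℝ) : ℝ≥0∞ :=
  (∑ l ∈ Finset.range (k + 1),
    ∫⁻ x : E3, ENNReal.ofReal ((1 + ‖x‖) ^ (γ₀ + 2 * (l : ℝ)) *
      (‖iteratedFDeriv ℝ (l + 1) (φ 0) x‖ ^ 2 + ‖iteratedFDeriv ℝ l (dt1 φ 0) x‖ ^ 2))) +
  ∫⁻ x : E3, ENNReal.ofReal ((1 + ‖x‖) ^ γ₀ * |φ 0 x| ^ (p + 1))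

/-- `u₊ = √(1+((t−r)/2)²)`. -/
def uplus (t r : ℝ) : ℝ := Real.sqrt (1 + ((t - r) / 2) ^ 2)

/-- `v₊ = √(1+((t+r)/2)²)`. -/
def vplus (t r : ℝ) : ℝ := Real.sqrt (1 + ((t + r) / 2) ^ 2)

/-- Surface measure on the unit sphere `S² ⊂ ℝ³` (total mass `4π`). -/
def sphereMeasure : Measure (Metric.sphere (0 : E3) 1) := (volume : Measure E3).toSphere

/-- The energy density, in terms of `a = g + f`, `b = g - f`, `w = 1/r`, the values `φ`, `P₀ = ∂ₜφ`,
`S = x·∇φ`, `q = |∇φ|²` and the potential `V`. -/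
def energyDensity (a b w φ P₀ S q V : ℝ) : ℝ :=
  a * (P₀ ^ 2 + w ^ 2 * (S + φ) ^ 2) / 2 + b * w * P₀ * (S + φ) + a * (q - w ^ 2 * S ^ 2) / 2
    + a * V

/-- The component of the energy current in the direction in which `x` has component `ξ` and
`∇φ` has component `P`. -/
def currentComponent (a b w φ P₀ S q V P ξ : ℝ) : ℝ :=
  -(a * P₀ + b * w * (S + φ)) * P
    + ξ * (w * b * (q / 2 - P₀ ^ 2 / 2 + V) - w ^ 2 * a * P₀ * φ - w ^ 3 * b * φ ^ 2 / 2)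

/-- Differential of `energyDensity`. -/
def energyDensityDiff (a b w φ P₀ S q V a' b' w' φ' P₀' S' q' V' : ℝ) : ℝ :=
  a' * (P₀ ^ 2 + w ^ 2 * (S + φ) ^ 2) / 2
    + a * (2 * P₀ * P₀' + 2 * w * w' * (S + φ) ^ 2 + w ^ 2 * (2 * (S + φ) * (S' + φ'))) / 2
    + (b' * w * P₀ + b * w' * P₀ + b * w * P₀') * (S + φ) + b * w * P₀ * (S' + φ')
    + a' * (q - w ^ 2 * S ^ 2) / 2 + a * (q' - 2 * w * w' * S ^ 2 - w ^ 2 * (2 * S * S')) / 2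
    + (a' * V + a * V')

/-- Differential of `currentComponent`. -/
def currentComponentDiff (a b w φ P₀ S q V P ξ a' b' w' φ' P₀' S' q' V' P' ξ' : ℝ) : ℝ :=
  -(a' * P₀ + a * P₀' + (b' * w + b * w') * (S + φ) + b * w * (S' + φ')) * P
    - (a * P₀ + b * w * (S + φ)) * P'
    + ξ' * (w * b * (q / 2 - P₀ ^ 2 / 2 + V) - w ^ 2 * a * P₀ * φ - w ^ 3 * b * φ ^ 2 / 2)
    + ξ * ((w' * b + w * b') * (q / 2 - P₀ ^ 2 / 2 + V) + w * b * (q' / 2 - P₀ * P₀' + V')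
      - (2 * w * w' * a * P₀ * φ + w ^ 2 * (a' * P₀ * φ + a * P₀' * φ + a * P₀ * φ'))
      - (3 * w ^ 2 * w' * b * φ ^ 2 + w ^ 3 * b' * φ ^ 2 + w ^ 3 * b * (2 * φ * φ')) / 2)

lemma hasDerivAt_energyDensity {a b w φ P₀ S q V : ℝ → ℝ} {a' b' w' φ' P₀' S' q' V' s : ℝ}
    (ha : HasDerivAt a a' s) (hb : HasDerivAt b b' s) (hw : HasDerivAt w w' s)
    (hφ : HasDerivAt φ φ' s) (hP : HasDerivAt P₀ P₀' s) (hS : HasDerivAt S S' s)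
    (hq : HasDerivAt q q' s) (hV : HasDerivAt V V' s) :
    HasDerivAt (fun s => energyDensity (a s) (b s) (w s) (φ s) (P₀ s) (S s) (q s) (V s))
      (energyDensityDiff (a s) (b s) (w s) (φ s) (P₀ s) (S s) (q s) (V s)
        a' b' w' φ' P₀' S' q' V') s := by
  have h := ((((ha.fun_mul ((hP.fun_pow 2).fun_add ((hw.fun_pow 2).fun_mul
    ((hS.fun_add hφ).fun_pow 2)))).div_const 2).fun_add
    (((hb.fun_mul hw).fun_mul hP).fun_mul (hS.fun_add hφ))).fun_add
    ((ha.fun_mul (hq.fun_sub ((hw.fun_pow 2).fun_mul (hS.fun_pow 2)))).div_const 2)).fun_add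
    (ha.fun_mul hV)
  refine h.congr_deriv ?_
  simp only [energyDensityDiff]
  push_cast
  ring

lemma hasDerivAt_currentComponent {a b w φ P₀ S q V P ξ : ℝ → ℝ}
    {a' b' w' φ' P₀' S' q' V' P' ξ' s : ℝ}
    (ha : HasDerivAt a a' s) (hb : HasDerivAt b b' s) (hw : HasDerivAt w w' s)
    (hφ : HasDerivAt φ φ' s) (hP₀ : HasDerivAt P₀ P₀' s) (hS : HasDerivAt S S' s)
    (hq : HasDerivAt q q' s) (hV : HasDerivAt V V' s) (hP : HasDerivAt P P' s)
    (hξ : HasDerivAt ξ ξ' s) :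
    HasDerivAt (fun s => currentComponent (a s) (b s) (w s) (φ s) (P₀ s) (S s) (q s) (V s)
        (P s) (ξ s))
      (currentComponentDiff (a s) (b s) (w s) (φ s) (P₀ s) (S s) (q s) (V s) (P s) (ξ s)
        a' b' w' φ' P₀' S' q' V' P' ξ') s := by
  have h := ((((ha.fun_mul hP₀).fun_add ((hb.fun_mul hw).fun_mul (hS.fun_add hφ))).fun_neg).fun_mul
    hP).fun_add (hξ.fun_mul ((((hw.fun_mul hb).fun_mul
      (((hq.div_const 2).fun_sub ((hP₀.fun_pow 2).div_const 2)).fun_add hV)).fun_sub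
      ((((hw.fun_pow 2).fun_mul ha).fun_mul hP₀).fun_mul hφ)).fun_sub
      ((((hw.fun_pow 3).fun_mul hb).fun_mul (hφ.fun_pow 2)).div_const 2)))
  refine h.congr_deriv ?_
  simp only [currentComponentDiff]
  push_cast
  ring

/-- The pointwise divergence identity for the energy current. -/
lemma divergence_identity (p a b k l w φ P₀ N V Q₀₀ : ℝ) (x P R : Fin 3 → ℝ)
    (Q : Fin 3 → Fin 3 → ℝ) (S q : ℝ) (hS : S = ∑ i, x i * P i) (hq : q = ∑ i, P i ^ 2)
    (hw : w ^ 2 * ∑ i, x i ^ 2 = 1) (hQ : ∀ i j, Q i j = Q j i)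
    (heq : Q₀₀ - ∑ i, Q i i + N = 0) (hV : N * φ = (p + 1) * V) :
    energyDensityDiff a b w φ P₀ S q V k l 0 P₀ Q₀₀ (∑ j, x j * R j) (∑ j, 2 * P j * R j) (N * P₀)
      + ∑ i, currentComponentDiff a b w φ P₀ S q V (P i) (x i)
        (l * w * x i) (k * w * x i) (-w ^ 3 * x i) (P i) (R i) (P i + ∑ j, x j * Q i j)
        (∑ j, 2 * P j * Q i j) (N * P i) (Q i i) 1
      = -((q - w ^ 2 * S ^ 2) / 2 * (2 * b * w - 2 * k) + V * ((p - 1) * b * w - 2 * k)) := by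
  have h01 := hQ 1 0
  have h02 := hQ 2 0
  have h12 := hQ 2 1
  simp only [Fin.sum_univ_three, energyDensityDiff, currentComponentDiff] at *
  rw [h01, h02, h12]
  subst hS hq
  linear_combination ((k - b * w) * ((P 0 ^ 2 + P 1 ^ 2 + P 2 ^ 2) / 2 - P₀ ^ 2 / 2 + V)
    - (-2 * w ^ 2 * a + l * w) * P₀ * φ - (-3 * w ^ 3 * b + k * w ^ 2) * φ ^ 2 / 2) * hw
    + (a * P₀ + b * w * (x 0 * P 0 + x 1 * P 1 + x 2 * P 2 + φ)) * heq - b * w * hV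

/-- A quadratic form estimate: `α X² + β D ≥ 2 X d` as soon as `d² ≤ α β D`. -/
lemma two_mul_mul_le_of_sq_le {α β X D d : ℝ} (hα : 0 ≤ α) (hβ : 0 ≤ β) (hD : 0 ≤ D)
    (h : d ^ 2 ≤ α * β * D) : 2 * X * d ≤ α * X ^ 2 + β * D := by
  have h0 : 0 ≤ α * X ^ 2 + β * D := by positivity
  have h1 : (2 * X * d) ^ 2 ≤ (α * X ^ 2 + β * D) ^ 2 := by
    have := mul_le_mul_of_nonneg_left h (sq_nonneg X)
    nlinarith [sq_nonneg (α * X ^ 2 - β * D)]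
  exact (le_abs_self _).trans (abs_le_of_sq_le_sq h1 h0)

/-- Cauchy–Schwarz for the parts of `y` and `P` orthogonal to the unit vector `w x`. -/
lemma sq_angular_le (w : ℝ) (x y P : Fin 3 → ℝ) (hw : w ^ 2 * ∑ i, x i ^ 2 = 1) :
    (∑ i, y i * P i - w ^ 2 * (∑ i, x i * P i) * ∑ i, x i * y i) ^ 2
      ≤ (∑ i, P i ^ 2 - w ^ 2 * (∑ i, x i * P i) ^ 2)
        * (∑ i, y i ^ 2 - w ^ 2 * (∑ i, x i * y i) ^ 2) := by
  have h := Finset.sum_mul_sq_le_sq_mul_sq Finset.univ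
    (fun i => y i - w ^ 2 * (∑ j, x j * y j) * x i) (fun i => P i - w ^ 2 * (∑ j, x j * P j) * x i)
  simp only [Fin.sum_univ_three] at *
  set S := x 0 * P 0 + x 1 * P 1 + x 2 * P 2 with hS
  set m := x 0 * y 0 + x 1 * y 1 + x 2 * y 2 with hm
  have e1 : (y 0 - w ^ 2 * m * x 0) * (P 0 - w ^ 2 * S * x 0)
      + (y 1 - w ^ 2 * m * x 1) * (P 1 - w ^ 2 * S * x 1)
      + (y 2 - w ^ 2 * m * x 2) * (P 2 - w ^ 2 * S * x 2)
      = (y 0 * P 0 + y 1 * P 1 + y 2 * P 2 - w ^ 2 * S * m) := by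
    linear_combination (w ^ 2 * m * S) * hw + w ^ 2 * m * hS + w ^ 2 * S * hm
  have e2 : (y 0 - w ^ 2 * m * x 0) ^ 2 + (y 1 - w ^ 2 * m * x 1) ^ 2
      + (y 2 - w ^ 2 * m * x 2) ^ 2 = y 0 ^ 2 + y 1 ^ 2 + y 2 ^ 2 - w ^ 2 * m ^ 2 := by
    linear_combination (w ^ 2 * m ^ 2) * hw + 2 * w ^ 2 * m * hm
  have e3 : (P 0 - w ^ 2 * S * x 0) ^ 2 + (P 1 - w ^ 2 * S * x 1) ^ 2
      + (P 2 - w ^ 2 * S * x 2) ^ 2 = P 0 ^ 2 + P 1 ^ 2 + P 2 ^ 2 - w ^ 2 * S ^ 2 := by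
    linear_combination (w ^ 2 * S ^ 2) * hw + 2 * w ^ 2 * S * hS
  rw [e1, e2, e3] at h
  linarith

lemma sq_radial_le (w : ℝ) (x P : Fin 3 → ℝ) (hw : w ^ 2 * ∑ i, x i ^ 2 = 1) :
    w ^ 2 * (∑ i, x i * P i) ^ 2 ≤ ∑ i, P i ^ 2 := by
  have h := Finset.sum_mul_sq_le_sq_mul_sq Finset.univ x P
  calc w ^ 2 * (∑ i, x i * P i) ^ 2 ≤ w ^ 2 * ((∑ i, x i ^ 2) * ∑ i, P i ^ 2) := by gcongr
    _ = _ := by rw [← mul_assoc, hw, one_mul]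

/-- Positivity of the energy flux through a surface with conormal `(T, y)`, `|y| ≤ T`, with the
contribution of the potential singled out. -/
lemma potential_le_flux (f g w φ P₀ V T : ℝ) (x y P : Fin 3 → ℝ) (hf : 0 ≤ f) (hg : 0 ≤ g)
    (hw : w ^ 2 * ∑ i, x i ^ 2 = 1) (hT : 0 ≤ T) (hy : ∑ i, y i ^ 2 ≤ T ^ 2) :
    V * (g * (T + w * ∑ i, x i * y i) + f * (T - w * ∑ i, x i * y i))
      ≤ T * energyDensity (g + f) (g - f) w φ P₀ (∑ i, x i * P i) (∑ i, P i ^ 2) V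
        + ∑ i, y i * currentComponent (g + f) (g - f) w φ P₀ (∑ i, x i * P i) (∑ i, P i ^ 2) V
            (P i) (x i) := by
  have hang := sq_angular_le w x y P hw
  have hD : 0 ≤ ∑ i, P i ^ 2 - w ^ 2 * (∑ i, x i * P i) ^ 2 := by
    linarith [sq_radial_le w x P hw]
  have hm : (w * ∑ i, x i * y i) ^ 2 ≤ T ^ 2 := by
    have := sq_radial_le w x y hw
    rw [mul_pow]; linarith
  obtain ⟨hm1, hm2⟩ := abs_le.1 (abs_le_of_sq_le_sq hm hT)
  set D := ∑ i, P i ^ 2 - w ^ 2 * (∑ i, x i * P i) ^ 2 with hDdef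
  set S := ∑ i, x i * P i with hS
  set m := w * ∑ i, x i * y i with hmdef
  set d := ∑ i, y i * P i - w ^ 2 * S * ∑ i, x i * y i with hd
  have hdd : d ^ 2 ≤ (T - m) * (T + m) * D := by
    refine hang.trans ?_
    have : ∑ i, y i ^ 2 - w ^ 2 * (∑ i, x i * y i) ^ 2 ≤ (T - m) * (T + m) := by
      rw [hmdef]; nlinarith
    rw [mul_comm]
    gcongr
  have k1 := two_mul_mul_le_of_sq_le (X := P₀ + w * (S + φ)) (by linarith : 0 ≤ T - m)
    (by linarith : 0 ≤ T + m) hD hdd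
  have k2 := two_mul_mul_le_of_sq_le (X := P₀ - w * (S + φ)) (d := d) (by linarith : 0 ≤ T + m)
    (by linarith : 0 ≤ T - m) hD (by linarith)
  have k3 := mul_le_mul_of_nonneg_left k1 hg
  have k4 := mul_le_mul_of_nonneg_left k2 hf
  have key : T * energyDensity (g + f) (g - f) w φ P₀ S (∑ i, P i ^ 2) V
        + ∑ i, y i * currentComponent (g + f) (g - f) w φ P₀ S (∑ i, P i ^ 2) V (P i) (x i)
      = V * (g * (T + m) + f * (T - m))
        + g * ((T - m) * (P₀ + w * (S + φ)) ^ 2 + (T + m) * D - 2 * (P₀ + w * (S + φ)) * d) / 2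
        + f * ((T + m) * (P₀ - w * (S + φ)) ^ 2 + (T - m) * D - 2 * (P₀ - w * (S + φ)) * d) / 2 := by
    simp only [energyDensity, currentComponent, hDdef, hd, hmdef, Fin.sum_univ_three]
    ring
  rw [key]
  linarith

lemma energyDensity_nonneg (f g w φ P₀ V : ℝ) (x P : Fin 3 → ℝ) (hf : 0 ≤ f) (hg : 0 ≤ g)
    (hw : w ^ 2 * ∑ i, x i ^ 2 = 1) (hV : 0 ≤ V) :
    0 ≤ energyDensity (g + f) (g - f) w φ P₀ (∑ i, x i * P i) (∑ i, P i ^ 2) V := by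
  have h := potential_le_flux f g w φ P₀ V 1 x 0 P hf hg hw zero_le_one (by simp)
  simp only [Pi.zero_apply, zero_mul, mul_zero, Finset.sum_const_zero, add_zero, sub_zero,
    mul_one, one_mul] at h
  exact le_trans (by positivity) h

/-- The radial flux is bounded from above near the axis when `f ≤ g`. -/
lemma radial_flux_le (f g w φ P₀ V : ℝ) (x P : Fin 3 → ℝ) (hf : 0 ≤ f) (hfg : f ≤ g)
    (hw : w ^ 2 * ∑ i, x i ^ 2 = 1) (hw0 : 0 ≤ w) (r : ℝ) (hr : w * r = 1) (hV : 0 ≤ V) :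
    ∑ i, x i * currentComponent (g + f) (g - f) w φ P₀ (∑ i, x i * P i) (∑ i, P i ^ 2) V
            (P i) (x i)
      ≤ 2 * f * |P₀| * |∑ i, x i * P i + φ| + r * g * (∑ i, P i ^ 2 / 2 + V) := by
  have hD := sq_radial_le w x P hw
  have hP : 0 ≤ ∑ i, P i ^ 2 := Finset.sum_nonneg fun i _ => sq_nonneg _
  have hwp : 0 < w := lt_of_le_of_ne hw0 (by rintro rfl; simp at hr)
  have hr0 : 0 < r := by
    by_contra h
    nlinarith
  have hrr : ∑ i, x i ^ 2 = r ^ 2 := by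
    have : w ^ 2 * ∑ i, x i ^ 2 = w ^ 2 * r ^ 2 := by rw [hw, ← mul_pow, hr, one_pow]
    exact mul_left_cancel₀ (by positivity) this
  set S := ∑ i, x i * P i with hS
  have key : ∑ i, x i * currentComponent (g + f) (g - f) w φ P₀ S (∑ i, P i ^ 2) V (P i) (x i)
      = -2 * f * P₀ * (S + φ) - (g - f) * r * (P₀ + w * (S + φ)) ^ 2 / 2
        + r * (g - f) * ((∑ i, P i ^ 2 - w ^ 2 * S ^ 2) / 2 + V) := by
    have e : ∑ i, x i * currentComponent (g + f) (g - f) w φ P₀ S (∑ i, P i ^ 2) V (P i) (x i)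
      = -((g + f) * P₀ + (g - f) * w * (S + φ)) * S + (∑ i, x i ^ 2) *
        (w * (g - f) * ((∑ i, P i ^ 2) / 2 - P₀ ^ 2 / 2 + V) - w ^ 2 * (g + f) * P₀ * φ
          - w ^ 3 * (g - f) * φ ^ 2 / 2) := by
      rw [hS]
      simp only [currentComponent, Fin.sum_univ_three]
      ring
    rw [e, hrr]
    have hr2 : w = r⁻¹ := eq_inv_of_mul_eq_one_left hr
    rw [hr2]
    field_simp
    ring
  rw [key]
  have h1 : -2 * f * P₀ * (S + φ) ≤ 2 * f * |P₀| * |S + φ| := by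
    have : -(P₀ * (S + φ)) ≤ |P₀| * |S + φ| := by rw [← abs_mul]; exact neg_le_abs _
    nlinarith
  have h2 : 0 ≤ (g - f) * r * (P₀ + w * (S + φ)) ^ 2 / 2 := by
    have : 0 ≤ g - f := by linarith
    positivity
  have h3 : r * (g - f) * ((∑ i, P i ^ 2 - w ^ 2 * S ^ 2) / 2 + V)
      ≤ r * g * (∑ i, P i ^ 2 / 2 + V) := by
    rw [← Finset.sum_div]
    have : 0 ≤ w ^ 2 * S ^ 2 := by positivity
    have h5 : 0 ≤ (∑ i, P i ^ 2 - w ^ 2 * S ^ 2) / 2 + V := by linarith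
    have h6 : 0 ≤ g := hf.trans hfg
    gcongr <;> linarith
  linarith

/-- The power `s₊ ^ γ` of the positive part. -/
def posPow (γ s : ℝ) : ℝ := (max s 0) ^ γ

lemma posPow_nonneg (γ s : ℝ) : 0 ≤ posPow γ s := Real.rpow_nonneg (le_max_right _ _) _

lemma posPow_of_nonneg {γ s : ℝ} (hs : 0 ≤ s) : posPow γ s = s ^ γ := by
  rw [posPow, max_eq_left hs]

lemma posPow_of_nonpos {γ s : ℝ} (hγ : γ ≠ 0) (hs : s ≤ 0) : posPow γ s = 0 := by
  rw [posPow, max_eq_right hs, Real.zero_rpow hγ]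

lemma continuous_posPow {γ : ℝ} (hγ : 0 ≤ γ) : Continuous (posPow γ) :=
  (continuous_id.max continuous_const).rpow_const fun _ => Or.inr hγ

lemma hasDerivAt_posPow {γ : ℝ} (hγ : 1 < γ) (s : ℝ) :
    HasDerivAt (posPow γ) (γ * posPow (γ - 1) s) s := by
  rcases lt_trichotomy s 0 with hs | rfl | hs
  · rw [posPow_of_nonpos (by linarith) hs.le, mul_zero]
    refine (hasDerivAt_const s (0 : ℝ)).congr_of_eventuallyEq ?_
    filter_upwards [gt_mem_nhds hs] with y hy
    exact posPow_of_nonpos (by linarith) hy.le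
  · rw [posPow_of_nonpos (by linarith) le_rfl, mul_zero, hasDerivAt_iff_isLittleO]
    have h0 : posPow γ 0 = 0 := posPow_of_nonpos (by linarith) le_rfl
    simp only [h0, sub_zero, smul_eq_mul, mul_zero]
    have h1 : (fun s => posPow γ s) =O[nhds 0] fun s : ℝ => posPow (γ - 1) s * s := by
      refine Asymptotics.IsBigO.of_bound 1 (Filter.Eventually.of_forall fun s => ?_)
      rcases le_or_gt s 0 with hs | hs
      · rw [posPow_of_nonpos (by linarith) hs, norm_zero]; positivity
      · rw [posPow_of_nonneg hs.le, posPow_of_nonneg hs.le, one_mul, Real.rpow_sub_one hs.ne',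
          div_mul_cancel₀ _ hs.ne']
    refine h1.trans_isLittleO ?_
    have h2 : (posPow (γ - 1)) =o[nhds 0] fun _ : ℝ => (1 : ℝ) := by
      rw [Asymptotics.isLittleO_one_iff]
      have := (continuous_posPow (by linarith : 0 ≤ γ - 1)).tendsto 0
      rwa [posPow_of_nonpos (by linarith) le_rfl] at this
    simpa using h2.mul_isBigO (Asymptotics.isBigO_refl (fun s : ℝ => s) (nhds 0))
  · have h := Real.hasDerivAt_rpow_const (x := s) (p := γ) (Or.inl hs.ne')
    rw [posPow_of_nonneg hs.le]
    refine h.congr_of_eventuallyEq ?_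
    filter_upwards [lt_mem_nhds hs] with y hy
    exact posPow_of_nonneg hy.le

/-- The weight of the outgoing null derivative. -/
def outWeight (γ v : ℝ) : ℝ := 1 + posPow γ v

/-- The weight of the incoming null derivative. -/
def inWeight (γ c u : ℝ) : ℝ := 1 + c * posPow γ u + posPow γ (-u)

/-- Derivative of `outWeight`. -/
def outWeightDeriv (γ v : ℝ) : ℝ := γ * posPow (γ - 1) v

/-- Derivative of `inWeight`. -/
def inWeightDeriv (γ c u : ℝ) : ℝ := c * (γ * posPow (γ - 1) u) - γ * posPow (γ - 1) (-u)

lemma hasDerivAt_outWeight {γ : ℝ} (hγ : 1 < γ) (v : ℝ) :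
    HasDerivAt (outWeight γ) (outWeightDeriv γ v) v :=
  (hasDerivAt_posPow hγ v).const_add 1

lemma hasDerivAt_inWeight {γ : ℝ} (c : ℝ) (hγ : 1 < γ) (u : ℝ) :
    HasDerivAt (inWeight γ c) (inWeightDeriv γ c u) u := by
  have h1 := ((hasDerivAt_posPow hγ u).const_mul c).const_add 1
  have h2 := (hasDerivAt_posPow hγ (-u)).comp u (hasDerivAt_neg u)
  refine (h1.fun_add h2).congr_deriv ?_
  simp only [inWeightDeriv]
  ring

lemma contDiff_outWeight {γ : ℝ} (hγ : 1 < γ) : ContDiff ℝ 1 (outWeight γ) := by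
  rw [contDiff_one_iff_deriv]
  refine ⟨fun v => (hasDerivAt_outWeight hγ v).differentiableAt, ?_⟩
  rw [show deriv (outWeight γ) = outWeightDeriv γ from
    funext fun v => (hasDerivAt_outWeight hγ v).deriv]
  exact continuous_const.mul (continuous_posPow (by linarith))

lemma contDiff_inWeight {γ : ℝ} (c : ℝ) (hγ : 1 < γ) : ContDiff ℝ 1 (inWeight γ c) := by
  rw [contDiff_one_iff_deriv]
  refine ⟨fun v => (hasDerivAt_inWeight c hγ v).differentiableAt, ?_⟩
  rw [show deriv (inWeight γ c) = inWeightDeriv γ c from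
    funext fun v => (hasDerivAt_inWeight c hγ v).deriv]
  have h := continuous_posPow (by linarith : 0 ≤ γ - 1)
  exact (continuous_const.mul (continuous_const.mul h)).sub
    (continuous_const.mul (h.comp continuous_neg))

lemma inWeight_nonneg {γ c : ℝ} (hc : 0 ≤ c) (u : ℝ) : 0 ≤ inWeight γ c u := by
  have := posPow_nonneg γ u
  have := posPow_nonneg γ (-u)
  unfold inWeight
  positivity

lemma inWeight_le_outWeight {γ c u v : ℝ} (hγ : 1 < γ) (hc1 : c ≤ 1)
    (huv : |u| ≤ v) : inWeight γ c u ≤ outWeight γ v := by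
  obtain ⟨h1, h2⟩ := abs_le.1 huv
  have hv : 0 ≤ v := (abs_nonneg u).trans huv
  unfold inWeight outWeight
  rw [posPow_of_nonneg hv]
  rcases le_total 0 u with hu | hu
  · rw [posPow_of_nonneg hu, posPow_of_nonpos (by linarith) (by linarith : -u ≤ 0)]
    have : u ^ γ ≤ v ^ γ := Real.rpow_le_rpow hu h2 (by linarith)
    have := Real.rpow_nonneg hu γ
    nlinarith
  · rw [posPow_of_nonneg (by linarith : 0 ≤ -u), posPow_of_nonpos (by linarith) hu]
    have : (-u) ^ γ ≤ v ^ γ := Real.rpow_le_rpow (by linarith) (by linarith) (by linarith)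
    linarith

/-- The key convexity estimate making the bulk terms nonnegative. -/
lemma mul_weightDeriv_le {γ γ₀ c m u v : ℝ} (hγ : 1 < γ) (hγγ₀ : γ < γ₀) (hγ₀ : γ ≤ 2)
    (hm : γ₀ ≤ m) (hc : c = (γ₀ - γ) / (γ₀ + γ)) (huv : |u| ≤ v) :
    (v - u) * (outWeightDeriv γ v + inWeightDeriv γ c u)
      ≤ m * (outWeight γ v - inWeight γ c u) := by
  obtain ⟨h1, h2⟩ := abs_le.1 huv
  have hv : 0 ≤ v := (abs_nonneg u).trans huv
  have hc0 : 0 ≤ c := by rw [hc]; exact div_nonneg (by linarith) (by linarith)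
  have hc1 : γ₀ * (1 - c) = γ * (1 + c) := by
    have : γ₀ + γ ≠ 0 := by linarith
    rw [hc]; field_simp; ring
  have hc2 : 0 ≤ 1 - c := by
    rw [hc, sub_nonneg, div_le_one (by linarith)]; linarith
  have hmul : ∀ s : ℝ, 0 ≤ s → s * s ^ (γ - 1) = s ^ γ := fun s hs => by
    conv_rhs => rw [show γ = 1 + (γ - 1) by ring]
    rw [Real.rpow_add_of_nonneg hs (by norm_num) (by linarith), Real.rpow_one]
  unfold inWeight outWeight inWeightDeriv outWeightDeriv
  rw [posPow_of_nonneg hv, posPow_of_nonneg hv]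
  have hv0 := Real.rpow_nonneg hv γ
  have hv1 := Real.rpow_nonneg hv (γ - 1)
  rcases le_or_gt 0 u with hu | hu
  · rw [posPow_of_nonneg hu, posPow_of_nonneg hu,
      posPow_of_nonpos (by linarith) (by linarith : -u ≤ 0),
      posPow_of_nonpos (by linarith) (by linarith : -u ≤ 0)]
    have a1 : u ^ γ ≤ v ^ γ := Real.rpow_le_rpow hu h2 (by linarith)
    have a2 : u ^ (γ - 1) ≤ v ^ (γ - 1) := Real.rpow_le_rpow hu h2 (by linarith)
    have hu1 := Real.rpow_nonneg hu (γ - 1)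
    calc (v - u) * (γ * v ^ (γ - 1) + (c * (γ * u ^ (γ - 1)) - γ * 0))
        ≤ v * (γ * v ^ (γ - 1) + (c * (γ * v ^ (γ - 1)) - γ * 0)) := by
          have : 0 ≤ γ * v ^ (γ - 1) + (c * (γ * u ^ (γ - 1)) - γ * 0) := by
            rw [mul_zero, sub_zero]
            positivity
          gcongr
          linarith
      _ = γ * (1 + c) * v ^ γ := by rw [← hmul v hv]; ring
      _ = γ₀ * (1 - c) * v ^ γ := by rw [hc1]
      _ ≤ m * (1 - c) * v ^ γ := by gcongr
      _ = m * (1 + v ^ γ - (1 + c * v ^ γ + 0)) := by ring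
      _ ≤ m * (1 + v ^ γ - (1 + c * u ^ γ + 0)) := by
          have : 0 ≤ m := by linarith
          gcongr
  · have hw : 0 < -u := by linarith
    have hv' : 0 < v := by linarith
    rw [posPow_of_nonneg hw.le, posPow_of_nonneg hw.le,
      posPow_of_nonpos (by linarith) hu.le, posPow_of_nonpos (by linarith) hu.le]
    set w := -u with hwdef
    have hu' : u = -w := by rw [hwdef]; ring
    have a1 : w ^ γ ≤ v ^ γ := Real.rpow_le_rpow hw.le (by linarith) (by linarith)
    have a3 : w * v ^ (γ - 1) ≤ v * w ^ (γ - 1) := by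
      have : v ^ (γ - 2) ≤ w ^ (γ - 2) :=
        Real.rpow_le_rpow_of_nonpos hw (by linarith) (by linarith)
      have e : ∀ s : ℝ, 0 < s → s ^ (γ - 1) = s * s ^ (γ - 2) := fun s hs => by
        rw [show γ - 1 = 1 + (γ - 2) by ring, Real.rpow_add hs, Real.rpow_one]
      rw [e v hv', e w hw]
      have := mul_le_mul_of_nonneg_left this (mul_pos hw hv').le
      linarith
    have b1 := hmul v hv
    have b2 := hmul w hw.le
    have : (v - u) * (γ * v ^ (γ - 1) + (c * (γ * 0) - γ * w ^ (γ - 1)))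
        = γ * (v ^ γ - w ^ γ + (w * v ^ (γ - 1) - v * w ^ (γ - 1))) := by
      rw [hu', ← b1, ← b2]; ring
    rw [this]
    have : γ * (v ^ γ - w ^ γ + (w * v ^ (γ - 1) - v * w ^ (γ - 1))) ≤ γ * (v ^ γ - w ^ γ) := by
      gcongr; linarith
    have : γ * (v ^ γ - w ^ γ) ≤ m * (v ^ γ - w ^ γ) := by
      have : 0 ≤ v ^ γ - w ^ γ := by linarith
      gcongr; linarith
    linarith

lemma sqrt_one_add_sq_rpow_le {γ s : ℝ} (hγ : 0 ≤ γ) (hγ2 : γ ≤ 2) :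
    Real.sqrt (1 + s ^ 2) ^ γ ≤ 1 + |s| ^ γ := by
  rw [Real.sqrt_eq_rpow, ← Real.rpow_mul (by positivity)]
  have h := NNReal.rpow_add_le_add_rpow 1 (⟨s ^ 2, sq_nonneg s⟩) (p := 1 / 2 * γ)
    (by linarith) (by linarith)
  have h' : ((1 : ℝ) + s ^ 2) ^ (1 / 2 * γ) ≤ (1 : ℝ) ^ (1 / 2 * γ) + (s ^ 2) ^ (1 / 2 * γ) := by
    exact_mod_cast h
  rw [Real.one_rpow, ← sq_abs, ← Real.rpow_natCast, ← Real.rpow_mul (abs_nonneg s)] at h'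
  rw [← sq_abs, ← Real.rpow_natCast]
  convert h' using 3
  push_cast; ring

/-- The weight in the flux bound is controlled by the multiplier weights. -/
lemma flux_weight_le {γ c t r τ : ℝ} (hγ : 1 < γ) (hγ2 : γ ≤ 2) (hc : 0 < c) (hc1 : c ≤ 1)
    (ht : 0 ≤ t) (hr : 0 ≤ r) (hτ : |τ| ≤ 1) :
    (1 + τ) * vplus t r ^ γ + uplus t r ^ γ ≤ (1 + (2 * c)⁻¹) *
      (outWeight γ ((t + r) / 2) * (1 + τ) + inWeight γ c ((t - r) / 2) * (1 - τ)) := by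
  obtain ⟨h1, h2⟩ := abs_le.1 hτ
  have hv : vplus t r ^ γ ≤ outWeight γ ((t + r) / 2) := by
    have h := sqrt_one_add_sq_rpow_le (s := (t + r) / 2) (by linarith : 0 ≤ γ) hγ2
    rw [abs_of_nonneg (by positivity)] at h
    rw [outWeight, posPow_of_nonneg (by positivity)]
    exact h
  have hu : c * uplus t r ^ γ ≤ inWeight γ c ((t - r) / 2) := by
    have h := sqrt_one_add_sq_rpow_le (s := (t - r) / 2) (by linarith : 0 ≤ γ) hγ2
    rw [inWeight]
    have h' : c * uplus t r ^ γ ≤ c * (1 + |(t - r) / 2| ^ γ) := by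
      unfold uplus; gcongr
    refine h'.trans ?_
    rcases le_total 0 ((t - r) / 2) with hs | hs
    · rw [posPow_of_nonneg hs, abs_of_nonneg hs]
      have := posPow_nonneg γ (-((t - r) / 2))
      linarith
    · rw [posPow_of_nonneg (by linarith : 0 ≤ -((t - r) / 2)), abs_of_nonpos hs]
      have := posPow_nonneg γ ((t - r) / 2)
      have h3 : 0 ≤ (-((t - r) / 2)) ^ γ := Real.rpow_nonneg (by linarith) _
      nlinarith
  have hgf : inWeight γ c ((t - r) / 2) ≤ outWeight γ ((t + r) / 2) :=
    inWeight_le_outWeight hγ hc1 (by rw [abs_le]; constructor <;> linarith)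
  have hf0 := inWeight_nonneg hc.le (γ := γ) ((t - r) / 2)
  set g := outWeight γ ((t + r) / 2)
  set f := inWeight γ c ((t - r) / 2)
  have e1 : (1 + τ) * vplus t r ^ γ ≤ g * (1 + τ) + f * (1 - τ) := by
    have : (1 + τ) * vplus t r ^ γ ≤ (1 + τ) * g := by gcongr; linarith
    have : 0 ≤ f * (1 - τ) := mul_nonneg hf0 (by linarith)
    linarith
  have e2 : uplus t r ^ γ ≤ (2 * c)⁻¹ * (g * (1 + τ) + f * (1 - τ)) := by
    have : f * (1 + τ) ≤ g * (1 + τ) := by gcongr; linarith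
    rw [mul_inv, mul_assoc, mul_comm c⁻¹, ← mul_assoc, ← div_eq_mul_inv, le_div_iff₀ hc]
    linarith
  linarith

/-- At `t = 0` the two weights coincide. -/
lemma inWeight_zero {γ c r : ℝ} (hγ : 1 < γ) (hr : 0 ≤ r) :
    inWeight γ c ((0 - r) / 2) = outWeight γ ((0 + r) / 2) := by
  rw [inWeight, outWeight, posPow_of_nonpos (by linarith) (by linarith : (0 - r) / 2 ≤ 0)]
  ring_nf

/-- The time direction in space-time. -/
def timeDir : ℝ × E3 := (1, 0)

/-- The `i`-th spatial coordinate direction in space-time. -/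
def spaceDir (i : Fin 3) : ℝ × E3 := (0, EuclideanSpace.single i 1)

/-- The time derivative of a function on space-time. -/
def dTime (Φ : ℝ × E3 → ℝ) (z : ℝ × E3) : ℝ := fderiv ℝ Φ z timeDir

/-- The `i`-th spatial derivative of a function on space-time. -/
def dSpace (Φ : ℝ × E3 → ℝ) (i : Fin 3) (z : ℝ × E3) : ℝ := fderiv ℝ Φ z (spaceDir i)

/-- The outgoing weight as a function on space-time. -/
def outW (γ : ℝ) (z : ℝ × E3) : ℝ := outWeight γ ((z.1 + ‖z.2‖) / 2)

/-- The incoming weight as a function on space-time. -/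
def inW (γ c : ℝ) (z : ℝ × E3) : ℝ := inWeight γ c ((z.1 - ‖z.2‖) / 2)

/-- The potential energy. -/
def potential (p s : ℝ) : ℝ := |s| ^ (p + 1) / (p + 1)

/-- The weighted energy density of `Φ`. -/
def energyField (p γ c : ℝ) (Φ : ℝ × E3 → ℝ) (z : ℝ × E3) : ℝ :=
  energyDensity (outW γ z + inW γ c z) (outW γ z - inW γ c z) ‖z.2‖⁻¹ (Φ z) (dTime Φ z)
    (∑ i, z.2 i * dSpace Φ i z) (∑ i, dSpace Φ i z ^ 2) (potential p (Φ z))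

/-- The weighted energy current of `Φ`. -/
def currentField (p γ c : ℝ) (Φ : ℝ × E3 → ℝ) (i : Fin 3) (z : ℝ × E3) : ℝ :=
  currentComponent (outW γ z + inW γ c z) (outW γ z - inW γ c z) ‖z.2‖⁻¹ (Φ z) (dTime Φ z)
    (∑ j, z.2 j * dSpace Φ j z) (∑ j, dSpace Φ j z ^ 2) (potential p (Φ z)) (dSpace Φ i z) (z.2 i)

lemma potential_nonneg {p : ℝ} (hp : 0 ≤ p) (s : ℝ) : 0 ≤ potential p s := by
  unfold potential; positivity

lemma hasDerivAt_potential {p : ℝ} (hp : 0 < p) (s : ℝ) :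
    HasDerivAt (potential p) (|s| ^ (p - 1) * s) s := by
  have h := (hasDerivAt_abs_rpow s (by linarith : 1 < p + 1)).div_const (p + 1)
  refine h.congr_deriv ?_
  have : p + 1 ≠ 0 := by linarith
  rw [show p + 1 - 2 = p - 1 by ring]
  field_simp

lemma contDiff_potential {p : ℝ} (hp : 1 < p) : ContDiff ℝ 1 (potential p) := by
  rw [contDiff_one_iff_deriv]
  refine ⟨fun s => (hasDerivAt_potential (by linarith) s).differentiableAt, ?_⟩
  rw [show deriv (potential p) = fun s => |s| ^ (p - 1) * s from
    funext fun s => (hasDerivAt_potential (by linarith) s).deriv]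
  exact (continuous_abs.rpow_const fun _ => Or.inr (by linarith)).mul continuous_id

lemma contDiff_dTime {Φ : ℝ × E3 → ℝ} (hΦ : ContDiff ℝ 2 Φ) : ContDiff ℝ 1 (dTime Φ) :=
  (hΦ.fderiv_right (by norm_num)).clm_apply contDiff_const

lemma contDiff_dSpace {Φ : ℝ × E3 → ℝ} (hΦ : ContDiff ℝ 2 Φ) (i : Fin 3) :
    ContDiff ℝ 1 (dSpace Φ i) :=
  (hΦ.fderiv_right (by norm_num)).clm_apply contDiff_const

lemma contDiff_coord (i : Fin 3) {n : WithTop ℕ∞} : ContDiff ℝ n fun z : ℝ × E3 => z.2 i :=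
  (EuclideanSpace.proj (𝕜 := ℝ) i).contDiff.comp contDiff_snd

lemma contDiffAt_norm_snd {z : ℝ × E3} (hz : z.2 ≠ 0) :
    ContDiffAt ℝ 1 (fun z : ℝ × E3 => ‖z.2‖) z :=
  contDiffAt_snd.norm ℝ hz

lemma contDiffAt_outW {γ : ℝ} (hγ : 1 < γ) {z : ℝ × E3} (hz : z.2 ≠ 0) :
    ContDiffAt ℝ 1 (outW γ) z :=
  (contDiff_outWeight hγ).contDiffAt.comp z
    ((contDiffAt_fst.add (contDiffAt_norm_snd hz)).div_const 2)

lemma contDiffAt_inW {γ : ℝ} (c : ℝ) (hγ : 1 < γ) {z : ℝ × E3} (hz : z.2 ≠ 0) :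
    ContDiffAt ℝ 1 (inW γ c) z :=
  (contDiff_inWeight c hγ).contDiffAt.comp z
    ((contDiffAt_fst.sub (contDiffAt_norm_snd hz)).div_const 2)

lemma contDiffAt_energyField {p γ c : ℝ} (hp : 1 < p) (hγ : 1 < γ) {Φ : ℝ × E3 → ℝ}
    (hΦ : ContDiff ℝ 2 Φ) {z : ℝ × E3} (hz : z.2 ≠ 0) :
    ContDiffAt ℝ 1 (energyField p γ c Φ) z := by
  have h1 := contDiffAt_outW hγ hz
  have h2 := contDiffAt_inW c hγ hz
  have h3 := (contDiffAt_norm_snd hz).inv (norm_ne_zero_iff.2 hz)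
  have h4 : ContDiffAt ℝ 1 Φ z := (hΦ.of_le (by norm_num)).contDiffAt
  have h5 := (contDiff_dTime hΦ).contDiffAt (x := z)
  have h6 := fun i => (contDiff_dSpace hΦ i).contDiffAt (x := z)
  have h7 := fun i => (contDiff_coord (n := 1) i).contDiffAt (x := z)
  have h8 : ContDiffAt ℝ 1 (fun z => potential p (Φ z)) z :=
    (contDiff_potential hp).contDiffAt.comp z h4
  have h9 : ContDiffAt ℝ 1 (fun z => ∑ i, z.2 i * dSpace Φ i z) z :=
    ContDiffAt.sum fun i _ => (h7 i).mul (h6 i)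
  have h10 : ContDiffAt ℝ 1 (fun z => ∑ i, dSpace Φ i z ^ 2) z :=
    ContDiffAt.sum fun i _ => (h6 i).pow 2
  have key : ∀ wf : ℝ × E3 → ℝ, ContDiffAt ℝ 1 wf z → ContDiffAt ℝ 1 (fun z =>
      energyDensity (outW γ z + inW γ c z) (outW γ z - inW γ c z) (wf z) (Φ z) (dTime Φ z)
        (∑ i, z.2 i * dSpace Φ i z) (∑ i, dSpace Φ i z ^ 2) (potential p (Φ z))) z := by
    intro wf hwf
    unfold energyDensity
    fun_prop
  exact key _ h3

lemma contDiffAt_currentField {p γ c : ℝ} (hp : 1 < p) (hγ : 1 < γ) {Φ : ℝ × E3 → ℝ}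
    (hΦ : ContDiff ℝ 2 Φ) (i : Fin 3) {z : ℝ × E3} (hz : z.2 ≠ 0) :
    ContDiffAt ℝ 1 (currentField p γ c Φ i) z := by
  have h1 := contDiffAt_outW hγ hz
  have h2 := contDiffAt_inW c hγ hz
  have h3 := (contDiffAt_norm_snd hz).inv (norm_ne_zero_iff.2 hz)
  have h4 : ContDiffAt ℝ 1 Φ z := (hΦ.of_le (by norm_num)).contDiffAt
  have h5 := (contDiff_dTime hΦ).contDiffAt (x := z)
  have h6 := fun i => (contDiff_dSpace hΦ i).contDiffAt (x := z)
  have h7 := fun i => (contDiff_coord (n := 1) i).contDiffAt (x := z)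
  have h8 : ContDiffAt ℝ 1 (fun z => potential p (Φ z)) z :=
    (contDiff_potential hp).contDiffAt.comp z h4
  have h9 : ContDiffAt ℝ 1 (fun z => ∑ i, z.2 i * dSpace Φ i z) z :=
    ContDiffAt.sum fun i _ => (h7 i).mul (h6 i)
  have h10 : ContDiffAt ℝ 1 (fun z => ∑ i, dSpace Φ i z ^ 2) z :=
    ContDiffAt.sum fun i _ => (h6 i).pow 2
  have h11 := h6 i
  have h12 := h7 i
  have key : ∀ wf : ℝ × E3 → ℝ, ContDiffAt ℝ 1 wf z → ContDiffAt ℝ 1 (fun z =>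
      currentComponent (outW γ z + inW γ c z) (outW γ z - inW γ c z) (wf z) (Φ z) (dTime Φ z)
        (∑ j, z.2 j * dSpace Φ j z) (∑ j, dSpace Φ j z ^ 2) (potential p (Φ z)) (dSpace Φ i z)
        (z.2 i)) z := by
    intro wf hwf
    unfold currentComponent
    fun_prop
  exact key _ h3

lemma hasDerivAt_line {G : ℝ × E3 → ℝ} {z : ℝ × E3} (hG : DifferentiableAt ℝ G z) (d : ℝ × E3) :
    HasDerivAt (fun s : ℝ => G (z + s • d)) (fderiv ℝ G z d) 0 :=
  hG.hasFDerivAt.hasLineDerivAt d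

lemma hasDerivAt_norm_line (z d : ℝ × E3) (hz : z.2 ≠ 0) :
    HasDerivAt (fun s : ℝ => ‖(z + s • d).2‖) (‖z.2‖⁻¹ * ⟪z.2, d.2⟫_ℝ) 0 := by
  have h0 : HasDerivAt (fun s : ℝ => (z + s • d).2) d.2 0 := by
    have := ((hasDerivAt_id (0 : ℝ)).smul_const d.2).const_add z.2
    simpa using this
  have h1 := h0.norm_sq
  have h2 := h1.sqrt (by simpa using hz)
  simp only [Real.sqrt_sq (norm_nonneg _), zero_smul, add_zero] at h2
  refine h2.congr_deriv ?_
  have : ‖z.2‖ ≠ 0 := norm_ne_zero_iff.2 hz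
  field_simp

/-- Half the sum of the derivatives of the weights. -/
def weightSumDeriv (γ c : ℝ) (z : ℝ × E3) : ℝ :=
  (outWeightDeriv γ ((z.1 + ‖z.2‖) / 2) + inWeightDeriv γ c ((z.1 - ‖z.2‖) / 2)) / 2

/-- Half the difference of the derivatives of the weights. -/
def weightDiffDeriv (γ c : ℝ) (z : ℝ × E3) : ℝ :=
  (outWeightDeriv γ ((z.1 + ‖z.2‖) / 2) - inWeightDeriv γ c ((z.1 - ‖z.2‖) / 2)) / 2

lemma hasDerivAt_weights_line {γ : ℝ} (c : ℝ) (hγ : 1 < γ) (z d : ℝ × E3) (hz : z.2 ≠ 0) :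
    HasDerivAt (fun s : ℝ => outW γ (z + s • d) + inW γ c (z + s • d))
      (weightSumDeriv γ c z * d.1 + weightDiffDeriv γ c z * (‖z.2‖⁻¹ * ⟪z.2, d.2⟫_ℝ)) 0 ∧
    HasDerivAt (fun s : ℝ => outW γ (z + s • d) - inW γ c (z + s • d))
      (weightDiffDeriv γ c z * d.1 + weightSumDeriv γ c z * (‖z.2‖⁻¹ * ⟪z.2, d.2⟫_ℝ)) 0 := by
  have hr := hasDerivAt_norm_line z d hz
  have ht : HasDerivAt (fun s : ℝ => (z + s • d).1) d.1 0 := by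
    have := ((hasDerivAt_id (0 : ℝ)).mul_const d.1).const_add z.1
    simpa using this
  have h1 : HasDerivAt (fun s : ℝ => outW γ (z + s • d))
      (outWeightDeriv γ ((z.1 + ‖z.2‖) / 2) * ((d.1 + ‖z.2‖⁻¹ * ⟪z.2, d.2⟫_ℝ) / 2)) 0 := by
    have h := (hasDerivAt_outWeight hγ _).comp (0 : ℝ) ((ht.fun_add hr).div_const 2)
    simpa using! h
  have h2 : HasDerivAt (fun s : ℝ => inW γ c (z + s • d))
      (inWeightDeriv γ c ((z.1 - ‖z.2‖) / 2) * ((d.1 - ‖z.2‖⁻¹ * ⟪z.2, d.2⟫_ℝ) / 2)) 0 := by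
    have h := (hasDerivAt_inWeight c hγ _).comp (0 : ℝ) ((ht.fun_sub hr).div_const 2)
    simpa using! h
  constructor
  · refine (h1.fun_add h2).congr_deriv ?_
    simp only [weightSumDeriv, weightDiffDeriv]; ring
  · refine (h1.fun_sub h2).congr_deriv ?_
    simp only [weightSumDeriv, weightDiffDeriv]; ring

/-- Mixed second derivatives commute. -/
lemma fderiv_fderiv_apply_comm {Φ : ℝ × E3 → ℝ} (hΦ : ContDiff ℝ 2 Φ) (z d₁ d₂ : ℝ × E3) :
    fderiv ℝ (fun z => fderiv ℝ Φ z d₁) z d₂ = fderiv ℝ (fun z => fderiv ℝ Φ z d₂) z d₁ := by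
  have hd : DifferentiableAt ℝ (fderiv ℝ Φ) z :=
    ((hΦ.fderiv_right (m := 1) (by norm_num)).differentiable one_ne_zero) z
  have hs : IsSymmSndFDerivAt ℝ Φ z := hΦ.contDiffAt.isSymmSndFDerivAt (by simp)
  rw [fderiv_clm_apply hd (differentiableAt_const _), fderiv_clm_apply hd (differentiableAt_const _)]
  simpa using! hs d₂ d₁

lemma sum_sq_eq_norm_sq (x : E3) : ∑ i, x i ^ 2 = ‖x‖ ^ 2 := by
  rw [EuclideanSpace.norm_sq_eq]; simp

lemma inv_norm_sq_mul_sum {x : E3} (hx : x ≠ 0) : (‖x‖⁻¹) ^ 2 * ∑ i, x i ^ 2 = 1 := by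
  rw [sum_sq_eq_norm_sq, ← mul_pow, inv_mul_cancel₀ (norm_ne_zero_iff.2 hx), one_pow]

/-- The directional derivatives of all the quantities entering the energy density and current. -/
lemma hasDerivAt_fields_line {p : ℝ} (hp : 1 < p) {Φ : ℝ × E3 → ℝ} (hΦ : ContDiff ℝ 2 Φ)
    {z : ℝ × E3} (hz : z.2 ≠ 0) (d : ℝ × E3) :
    HasDerivAt (fun s : ℝ => ‖(z + s • d).2‖⁻¹)
      (-(‖z.2‖⁻¹) ^ 2 * (‖z.2‖⁻¹ * ⟪z.2, d.2⟫_ℝ)) 0 ∧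
    HasDerivAt (fun s : ℝ => Φ (z + s • d)) (fderiv ℝ Φ z d) 0 ∧
    HasDerivAt (fun s : ℝ => dTime Φ (z + s • d)) (fderiv ℝ (dTime Φ) z d) 0 ∧
    HasDerivAt (fun s : ℝ => ∑ i, (z + s • d).2 i * dSpace Φ i (z + s • d))
      (∑ i, (d.2 i * dSpace Φ i z + z.2 i * fderiv ℝ (dSpace Φ i) z d)) 0 ∧
    HasDerivAt (fun s : ℝ => ∑ i, dSpace Φ i (z + s • d) ^ 2)
      (∑ i, 2 * dSpace Φ i z * fderiv ℝ (dSpace Φ i) z d) 0 ∧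
    HasDerivAt (fun s : ℝ => potential p (Φ (z + s • d)))
      (|Φ z| ^ (p - 1) * Φ z * fderiv ℝ Φ z d) 0 ∧
    (∀ i, HasDerivAt (fun s : ℝ => dSpace Φ i (z + s • d)) (fderiv ℝ (dSpace Φ i) z d) 0) ∧
    ∀ i, HasDerivAt (fun s : ℝ => (z + s • d).2 i) (d.2 i) 0 := by
  have hφ := hasDerivAt_line ((hΦ.differentiable (by norm_num)) z) d
  have hP₀ := hasDerivAt_line (((contDiff_dTime hΦ).differentiable one_ne_zero) z) d
  have hP := fun i => hasDerivAt_line (((contDiff_dSpace hΦ i).differentiable one_ne_zero) z) d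
  have hx : ∀ i, HasDerivAt (fun s : ℝ => (z + s • d).2 i) (d.2 i) 0 := by
    intro i
    have := ((hasDerivAt_id (0 : ℝ)).mul_const (d.2 i)).const_add (z.2 i)
    simpa using this
  refine ⟨?_, hφ, hP₀, ?_, ?_, ?_, hP, hx⟩
  · have := (hasDerivAt_norm_line z d hz).fun_inv (by simpa using hz)
    refine this.congr_deriv ?_
    simp only [zero_smul, add_zero]
    have : ‖z.2‖ ≠ 0 := norm_ne_zero_iff.2 hz
    field_simp
  · have := HasDerivAt.fun_sum (u := Finset.univ) fun i _ => (hx i).fun_mul (hP i)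
    simpa using this
  · have := HasDerivAt.fun_sum (u := Finset.univ) fun i _ => (hP i).fun_pow 2
    simpa using this
  · have := (hasDerivAt_potential (by linarith : 0 < p) (Φ (z + (0 : ℝ) • d))).comp (0 : ℝ) hφ
    simpa using! this

lemma fderiv_energyField_apply {p γ c : ℝ} (hp : 1 < p) (hγ : 1 < γ) {Φ : ℝ × E3 → ℝ}
    (hΦ : ContDiff ℝ 2 Φ) {z : ℝ × E3} (hz : z.2 ≠ 0) (d : ℝ × E3) :
    fderiv ℝ (energyField p γ c Φ) z d =
      energyDensityDiff (outW γ z + inW γ c z) (outW γ z - inW γ c z) ‖z.2‖⁻¹ (Φ z) (dTime Φ z)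
        (∑ i, z.2 i * dSpace Φ i z) (∑ i, dSpace Φ i z ^ 2) (potential p (Φ z))
        (weightSumDeriv γ c z * d.1 + weightDiffDeriv γ c z * (‖z.2‖⁻¹ * ⟪z.2, d.2⟫_ℝ))
        (weightDiffDeriv γ c z * d.1 + weightSumDeriv γ c z * (‖z.2‖⁻¹ * ⟪z.2, d.2⟫_ℝ))
        (-(‖z.2‖⁻¹) ^ 2 * (‖z.2‖⁻¹ * ⟪z.2, d.2⟫_ℝ)) (fderiv ℝ Φ z d) (fderiv ℝ (dTime Φ) z d)
        (∑ i, (d.2 i * dSpace Φ i z + z.2 i * fderiv ℝ (dSpace Φ i) z d))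
        (∑ i, 2 * dSpace Φ i z * fderiv ℝ (dSpace Φ i) z d)
        (|Φ z| ^ (p - 1) * Φ z * fderiv ℝ Φ z d) := by
  obtain ⟨hw, hφ, hP₀, hS, hq, hV, -, -⟩ := hasDerivAt_fields_line hp hΦ hz d
  obtain ⟨ha, hb⟩ := hasDerivAt_weights_line c hγ z d hz
  have h1 := hasDerivAt_line ((contDiffAt_energyField (p := p) (c := c) hp hγ hΦ hz).differentiableAt
    one_ne_zero) d
  have h2 := hasDerivAt_energyDensity ha hb hw hφ hP₀ hS hq hV
  simp only [zero_smul, add_zero] at h2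
  exact h1.unique h2

lemma fderiv_currentField_apply {p γ c : ℝ} (hp : 1 < p) (hγ : 1 < γ) {Φ : ℝ × E3 → ℝ}
    (hΦ : ContDiff ℝ 2 Φ) (i : Fin 3) {z : ℝ × E3} (hz : z.2 ≠ 0) (d : ℝ × E3) :
    fderiv ℝ (currentField p γ c Φ i) z d =
      currentComponentDiff (outW γ z + inW γ c z) (outW γ z - inW γ c z) ‖z.2‖⁻¹ (Φ z)
        (dTime Φ z) (∑ i, z.2 i * dSpace Φ i z) (∑ i, dSpace Φ i z ^ 2) (potential p (Φ z))
        (dSpace Φ i z) (z.2 i)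
        (weightSumDeriv γ c z * d.1 + weightDiffDeriv γ c z * (‖z.2‖⁻¹ * ⟪z.2, d.2⟫_ℝ))
        (weightDiffDeriv γ c z * d.1 + weightSumDeriv γ c z * (‖z.2‖⁻¹ * ⟪z.2, d.2⟫_ℝ))
        (-(‖z.2‖⁻¹) ^ 2 * (‖z.2‖⁻¹ * ⟪z.2, d.2⟫_ℝ)) (fderiv ℝ Φ z d) (fderiv ℝ (dTime Φ) z d)
        (∑ i, (d.2 i * dSpace Φ i z + z.2 i * fderiv ℝ (dSpace Φ i) z d))
        (∑ i, 2 * dSpace Φ i z * fderiv ℝ (dSpace Φ i) z d)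
        (|Φ z| ^ (p - 1) * Φ z * fderiv ℝ Φ z d) (fderiv ℝ (dSpace Φ i) z d) (d.2 i) := by
  obtain ⟨hw, hφ, hP₀, hS, hq, hV, hP, hx⟩ := hasDerivAt_fields_line hp hΦ hz d
  obtain ⟨ha, hb⟩ := hasDerivAt_weights_line c hγ z d hz
  have h1 := hasDerivAt_line ((contDiffAt_currentField (p := p) (c := c) hp hγ hΦ i
    hz).differentiableAt one_ne_zero) d
  have h2 := hasDerivAt_currentComponent ha hb hw hφ hP₀ hS hq hV (hP i) (hx i)
  simp only [zero_smul, add_zero] at h2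
  exact h1.unique h2

/-- The energy current of a solution has nonpositive divergence away from the axis. -/
lemma divergence_nonpos {p γ γ₀ c : ℝ} (hp : 2 < p) (hγ : 1 < γ) (hγγ₀ : γ < γ₀) (hγ₀2 : γ₀ ≤ 2)
    (hγ₀p : γ₀ ≤ p - 1) (hc : c = (γ₀ - γ) / (γ₀ + γ)) {Φ : ℝ × E3 → ℝ} (hΦ : ContDiff ℝ 2 Φ)
    {z : ℝ × E3} (hz : z.2 ≠ 0) (ht : 0 ≤ z.1)
    (heq : fderiv ℝ (dTime Φ) z timeDir - ∑ i, fderiv ℝ (dSpace Φ i) z (spaceDir i)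
      + |Φ z| ^ (p - 1) * Φ z = 0) :
    fderiv ℝ (energyField p γ c Φ) z timeDir
      + ∑ i, fderiv ℝ (currentField p γ c Φ i) z (spaceDir i) ≤ 0 := by
  have hr : 0 < ‖z.2‖ := norm_pos_iff.2 hz
  have hw := inv_norm_sq_mul_sum hz
  have hV : |Φ z| ^ (p - 1) * Φ z * Φ z = (p + 1) * potential p (Φ z) := by
    rw [potential, mul_div_cancel₀ _ (by linarith : p + 1 ≠ 0), mul_assoc, ← sq, ← sq_abs,
      ← Real.rpow_natCast, ← Real.rpow_add' (abs_nonneg _) (by push_cast; linarith)]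
    congr 1; push_cast; ring
  have key := divergence_identity p (outW γ z + inW γ c z) (outW γ z - inW γ c z)
    (weightSumDeriv γ c z) (weightDiffDeriv γ c z) ‖z.2‖⁻¹ (Φ z) (dTime Φ z)
    (|Φ z| ^ (p - 1) * Φ z) (potential p (Φ z)) (fderiv ℝ (dTime Φ) z timeDir) z.2
    (fun i => dSpace Φ i z) (fun i => fderiv ℝ (dTime Φ) z (spaceDir i))
    (fun i j => fderiv ℝ (dSpace Φ j) z (spaceDir i)) _ _ rfl rfl hw
    (fun i j => fderiv_fderiv_apply_comm hΦ z _ _) heq hV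
  refine le_of_eq_of_le (Eq.trans ?_ key) ?_
  · rw [fderiv_energyField_apply (by linarith) hγ hΦ hz]
    have hcomm : ∀ j, fderiv ℝ (dSpace Φ j) z timeDir = fderiv ℝ (dTime Φ) z (spaceDir j) :=
      fun j => fderiv_fderiv_apply_comm hΦ z _ _
    have hin : ∀ i, ⟪z.2, EuclideanSpace.single i (1 : ℝ)⟫_ℝ = z.2 i := by
      intro i; simp [EuclideanSpace.inner_single_right]
    congr 1
    · simp only [hcomm]
      simp [timeDir, dTime]
    · refine Finset.sum_congr rfl fun i _ => ?_
      rw [fderiv_currentField_apply (by linarith) hγ hΦ i hz]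
      have h1 : fderiv ℝ Φ z (spaceDir i) = dSpace Φ i z := rfl
      have h2 : (spaceDir i).1 = 0 := rfl
      have h3 : (spaceDir i).2 = EuclideanSpace.single i (1 : ℝ) := rfl
      rw [h1, h2, h3, hin]
      have h4 : ∑ j, ((EuclideanSpace.single i (1 : ℝ)) j * dSpace Φ j z
            + z.2 j * fderiv ℝ (dSpace Φ j) z (spaceDir i))
          = dSpace Φ i z + ∑ j, z.2 j * fderiv ℝ (dSpace Φ j) z (spaceDir i) := by
        rw [Finset.sum_add_distrib]
        congr 1
        simp
      have h5 : (EuclideanSpace.single i (1 : ℝ)) i = 1 := by simp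
      rw [h4, h5]
      congr 1 <;> ring
  have hrad := sq_radial_le ‖z.2‖⁻¹ z.2 (fun i => dSpace Φ i z) hw
  have hVn := potential_nonneg (by linarith : 0 ≤ p) (Φ z)
  have huv : |(z.1 - ‖z.2‖) / 2| ≤ (z.1 + ‖z.2‖) / 2 := by
    rw [abs_le]; constructor <;> linarith
  have hk : ∀ m, γ₀ ≤ m →
      0 ≤ m * (outW γ z - inW γ c z) * ‖z.2‖⁻¹ - 2 * weightSumDeriv γ c z := by
    intro m hm
    have h := mul_weightDeriv_le hγ hγγ₀ (hγγ₀.le.trans hγ₀2) hm hc huv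
    have h' : ‖z.2‖ * (2 * weightSumDeriv γ c z) ≤ m * (outW γ z - inW γ c z) := by
      refine le_trans (le_of_eq ?_) h
      rw [weightSumDeriv]; ring
    rw [sub_nonneg, ← div_eq_mul_inv, le_div_iff₀ hr, mul_comm]
    exact h'
  have h2 := hk 2 hγ₀2
  have h3 := hk (p - 1) hγ₀p
  have := mul_nonneg (sub_nonneg.2 hrad) h2
  have := mul_nonneg hVn h3
  linarith

/-- The integral over space of a directional derivative of a compactly supported `C¹` function
vanishes. -/
lemma integral_fderiv_apply_eq_zero {h : E3 → ℝ} (hh : ContDiff ℝ 1 h) {K : Set E3}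
    (hK : IsCompact K) (h0 : ∀ x ∉ K, h x = 0) (v : E3) : ∫ x, fderiv ℝ h x v = 0 := by
  have hsupp : HasCompactSupport h := HasCompactSupport.intro hK h0
  have hc : Continuous fun x => fderiv ℝ h x v :=
    (hh.continuous_fderiv one_ne_zero).clm_apply continuous_const
  have hi : Integrable (fun x => fderiv ℝ h x v) :=
    hc.integrable_of_hasCompactSupport (hsupp.fderiv_apply ℝ v)
  have key := integral_mul_fderiv_eq_neg_fderiv_mul_of_integrable (μ := (volume : Measure E3))
    (f := fun _ : E3 => (1 : ℝ)) (g := h) (v := v) (by simp) (by simpa using hi)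
    (by simpa using hh.continuous.integrable_of_hasCompactSupport hsupp)
    (fun x _ => differentiableAt_const _) (fun x _ => hh.differentiable one_ne_zero x)
  simpa using key

/-- A continuous function on space-time with compact spatial support is integrable on a slab. -/
lemma integrable_slab {F : ℝ × E3 → ℝ} (hF : Continuous F) {T : ℝ} {K : Set E3}
    (hK : IsCompact K) (h0 : ∀ t ∈ Set.Ioo 0 T, ∀ x ∉ K, F (t, x) = 0) :
    Integrable F ((volume.restrict (Set.Ioo 0 T)).prod volume) := by
  rw [← Measure.restrict_univ (μ := (volume : Measure E3)), Measure.prod_restrict]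
  have h1 : IntegrableOn F (Set.Ioo 0 T ×ˢ K) (volume.prod volume) :=
    (hF.continuousOn.integrableOn_compact (isCompact_Icc.prod hK)).mono_set
      (Set.prod_mono Set.Ioo_subset_Icc_self le_rfl)
  refine h1.of_forall_sdiff_eq_zero (measurableSet_Ioo.prod MeasurableSet.univ) ?_
  rintro ⟨t, x⟩ ⟨⟨ht, -⟩, hx⟩
  exact h0 t ht x fun hxK => hx ⟨ht, hxK⟩

lemma fderiv_timeDir_eq_zero {G : ℝ × E3 → ℝ} (hG : ContDiff ℝ 1 G) {T : ℝ} {K : Set E3}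
    (h0 : ∀ t ∈ Set.Ioo 0 T, ∀ x ∉ K, G (t, x) = 0) :
    ∀ t ∈ Set.Ioo 0 T, ∀ x ∉ K, fderiv ℝ G (t, x) timeDir = 0 := by
  intro t ht x hx
  have h1 : HasDerivAt (fun s : ℝ => G ((t, x) + s • timeDir)) (fderiv ℝ G (t, x) timeDir) 0 :=
    hasDerivAt_line (hG.differentiable one_ne_zero _) _
  refine h1.unique ((hasDerivAt_const (0 : ℝ) (0 : ℝ)).congr_of_eventuallyEq ?_)
  have : Filter.Tendsto (fun s : ℝ => t + s) (nhds 0) (nhds t) := by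
    have : Continuous fun s : ℝ => t + s := by fun_prop
    simpa using this.tendsto 0
  filter_upwards [this (isOpen_Ioo.mem_nhds ht)] with s hs
  have : (t, x) + s • timeDir = (t + s, x) := by simp [timeDir]
  rw [this]
  exact h0 _ hs x hx

lemma fderiv_slice_apply {H : ℝ × E3 → ℝ} (hH : ContDiff ℝ 1 H) (t : ℝ) (x v : E3) :
    fderiv ℝ (fun y => H (t, y)) x v = fderiv ℝ H (t, x) (0, v) := by
  have h1 : HasFDerivAt (fun y : E3 => (t, y)) (ContinuousLinearMap.inr ℝ ℝ E3) x :=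
    hasFDerivAt_prodMk_right t x
  have h2 := (hH.differentiable one_ne_zero (t, x)).hasFDerivAt.comp x h1
  have h3 : fderiv ℝ (fun y => H (t, y)) x = _ := h2.fderiv
  rw [h3]
  simp

lemma fderiv_spaceDir_eq_zero {H : ℝ × E3 → ℝ} (hH : ContDiff ℝ 1 H) {T : ℝ} {K : Set E3}
    (hK : IsCompact K) (h0 : ∀ t ∈ Set.Ioo 0 T, ∀ x ∉ K, H (t, x) = 0) (i : Fin 3) :
    ∀ t ∈ Set.Ioo 0 T, ∀ x ∉ K, fderiv ℝ H (t, x) (spaceDir i) = 0 := by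
  intro t ht x hx
  rw [spaceDir, ← fderiv_slice_apply hH]
  have : (fun y => H (t, y)) =ᶠ[nhds x] fun _ => 0 := by
    filter_upwards [hK.isClosed.isOpen_compl.mem_nhds hx] with y hy
    exact h0 t ht y hy
  rw [this.fderiv_eq]
  simp

/-- The divergence theorem on a space-time slab. -/
lemma integral_divergence_slab {G : ℝ × E3 → ℝ} {H : Fin 3 → ℝ × E3 → ℝ} (hG : ContDiff ℝ 1 G)
    (hH : ∀ i, ContDiff ℝ 1 (H i)) {T : ℝ} (hT : 0 ≤ T) {K : Set E3} (hK : IsCompact K)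
    (hG0 : ∀ t ∈ Set.Ioo 0 T, ∀ x ∉ K, G (t, x) = 0)
    (hH0 : ∀ i, ∀ t ∈ Set.Ioo 0 T, ∀ x ∉ K, H i (t, x) = 0) (hGT : ∀ x, G (T, x) = 0) :
    Integrable (fun z => -(fderiv ℝ G z timeDir + ∑ i, fderiv ℝ (H i) z (spaceDir i)))
      ((volume.restrict (Set.Ioo 0 T)).prod volume) ∧
    ∫ z, -(fderiv ℝ G z timeDir + ∑ i, fderiv ℝ (H i) z (spaceDir i))
      ∂((volume.restrict (Set.Ioo 0 T)).prod volume) = ∫ x, G (0, x) := by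
  have hcG : Continuous fun z => fderiv ℝ G z timeDir :=
    (hG.continuous_fderiv one_ne_zero).clm_apply continuous_const
  have hcH : ∀ i, Continuous fun z => fderiv ℝ (H i) z (spaceDir i) := fun i =>
    ((hH i).continuous_fderiv one_ne_zero).clm_apply continuous_const
  have hiG := integrable_slab hcG hK (fderiv_timeDir_eq_zero hG hG0)
  have hiH := fun i => integrable_slab (hcH i) hK (fderiv_spaceDir_eq_zero (hH i) hK (hH0 i) i)
  have hiS : Integrable (fun z => ∑ i, fderiv ℝ (H i) z (spaceDir i))
      ((volume.restrict (Set.Ioo 0 T)).prod volume) := integrable_finsetSum _ fun i _ => hiH i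
  refine ⟨(hiG.add hiS).neg, ?_⟩
  have eH : ∀ i, ∫ z, fderiv ℝ (H i) z (spaceDir i)
      ∂((volume.restrict (Set.Ioo 0 T)).prod volume) = 0 := by
    intro i
    rw [integral_prod _ (hiH i)]
    refine (setIntegral_congr_fun measurableSet_Ioo fun t ht => ?_).trans
      (integral_zero _ _)
    have h1 : ContDiff ℝ 1 fun y : E3 => H i (t, y) := (hH i).comp (contDiff_prodMk_right t)
    have h2 := integral_fderiv_apply_eq_zero h1 hK (fun x hx => hH0 i t ht x hx)
      (EuclideanSpace.single i 1)
    simp only [fderiv_slice_apply (hH i)] at h2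
    exact h2
  have eG : ∫ z, fderiv ℝ G z timeDir ∂((volume.restrict (Set.Ioo 0 T)).prod volume)
      = - ∫ x, G (0, x) := by
    rw [integral_prod_symm _ hiG, ← integral_neg]
    refine integral_congr_ae (Filter.Eventually.of_forall fun x => ?_)
    have hd : ∀ t, HasDerivAt (fun s => G (s, x)) (fderiv ℝ G (t, x) timeDir) t := by
      intro t
      have h1 : HasDerivAt (fun s : ℝ => (s, x)) timeDir t :=
        (hasDerivAt_id t).prodMk (hasDerivAt_const t x)
      exact (hG.differentiable one_ne_zero (t, x)).hasFDerivAt.comp_hasDerivAt t h1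
    have h3 := intervalIntegral.integral_eq_sub_of_hasDerivAt (a := 0) (b := T)
      (fun t _ => hd t)
      ((hcG.comp (Continuous.prodMk_left x)).intervalIntegrable _ _)
    simp only [hGT, zero_sub] at h3
    rw [intervalIntegral.integral_of_le hT, integral_Ioc_eq_integral_Ioo] at h3
    exact h3
  rw [integral_neg, integral_add hiG hiS, integral_finsetSum _ fun i _ => hiH i, eG]
  simp [eH]

/-- Derivative of the smooth step function. -/
def stepDeriv (s : ℝ) : ℝ := deriv smoothTransition s

lemma hasDerivAt_smoothTransition (s : ℝ) : HasDerivAt smoothTransition (stepDeriv s) s :=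
  ((smoothTransition.contDiff (n := 1)).differentiable one_ne_zero s).hasDerivAt

lemma continuous_stepDeriv : Continuous stepDeriv :=
  (smoothTransition.contDiff (n := 1)).continuous_deriv le_rfl

lemma stepDeriv_nonneg (s : ℝ) : 0 ≤ stepDeriv s := smoothTransition.monotone.deriv_nonneg

lemma stepDeriv_of_nonpos {s : ℝ} (hs : s ≤ 0) : stepDeriv s = 0 := by
  refine IsLocalMin.deriv_eq_zero (Filter.Eventually.of_forall fun y => ?_)
  rw [smoothTransition.zero_of_nonpos hs]
  exact smoothTransition.nonneg y

lemma stepDeriv_of_one_le {s : ℝ} (hs : 1 ≤ s) : stepDeriv s = 0 := by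
  refine IsLocalMax.deriv_eq_zero (Filter.Eventually.of_forall fun y => ?_)
  rw [smoothTransition.one_of_one_le hs]
  exact smoothTransition.le_one y

lemma exists_stepDeriv_le : ∃ M : ℝ, 0 ≤ M ∧ ∀ s, stepDeriv s ≤ M := by
  obtain ⟨M, hM⟩ := (isCompact_Icc (a := (0 : ℝ)) (b := 1)).exists_bound_of_continuousOn
    continuous_stepDeriv.continuousOn
  have hM0 : 0 ≤ M := (norm_nonneg _).trans (hM 0 (by simp))
  refine ⟨M, hM0, fun s => ?_⟩
  rcases le_total s 0 with h | h
  · rwa [stepDeriv_of_nonpos h]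
  rcases le_total 1 s with h' | h'
  · rwa [stepDeriv_of_one_le h']
  exact (le_abs_self _).trans (hM s ⟨h, h'⟩)

/-- A smooth cutoff to the interior of the light cone with vertex `(t₀, x₀)`. -/
def coneCut (N t₀ : ℝ) (x₀ : E3) (z : ℝ × E3) : ℝ :=
  smoothTransition (N * ((t₀ - z.1) ^ 2 - ‖z.2 - x₀‖ ^ 2))

/-- A smooth cutoff away from the axis `x = 0`. -/
def axisCut (ε : ℝ) (z : ℝ × E3) : ℝ := smoothTransition (‖z.2‖ ^ 2 / ε ^ 2 - 1)

lemma contDiff_coneCut (N t₀ : ℝ) (x₀ : E3) : ContDiff ℝ 1 (coneCut N t₀ x₀) := by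
  have h : ContDiff ℝ 1 fun z : ℝ × E3 => N * ((t₀ - z.1) ^ 2 - ‖z.2 - x₀‖ ^ 2) :=
    contDiff_const.mul (((contDiff_const.sub contDiff_fst).pow 2).sub
      ((contDiff_snd.sub contDiff_const).norm_sq ℝ))
  exact smoothTransition.contDiff.comp h

lemma contDiff_axisCut (ε : ℝ) : ContDiff ℝ 1 (axisCut ε) := by
  have h : ContDiff ℝ 1 fun z : ℝ × E3 => ‖z.2‖ ^ 2 / ε ^ 2 - 1 :=
    ((contDiff_snd.norm_sq ℝ).div_const _).sub contDiff_const
  exact smoothTransition.contDiff.comp h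

lemma hasDerivAt_norm_sq_line (z d : ℝ × E3) (x₀ : E3) :
    HasDerivAt (fun s : ℝ => ‖(z + s • d).2 - x₀‖ ^ 2) (2 * ⟪z.2 - x₀, d.2⟫_ℝ) 0 := by
  have h0 : HasDerivAt (fun s : ℝ => (z + s • d).2 - x₀) d.2 0 := by
    have := (((hasDerivAt_id (0 : ℝ)).smul_const d.2).const_add z.2).sub_const x₀
    simpa using this
  simpa using h0.norm_sq

lemma fderiv_coneCut_apply (N t₀ : ℝ) (x₀ : E3) (z d : ℝ × E3) :
    fderiv ℝ (coneCut N t₀ x₀) z d = stepDeriv (N * ((t₀ - z.1) ^ 2 - ‖z.2 - x₀‖ ^ 2)) *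
      (N * (-2 * (t₀ - z.1) * d.1 - 2 * ⟪z.2 - x₀, d.2⟫_ℝ)) := by
  have h1 := hasDerivAt_line ((contDiff_coneCut N t₀ x₀).differentiable one_ne_zero z) d
  have ht : HasDerivAt (fun s : ℝ => t₀ - (z + s • d).1) (-d.1) 0 := by
    have := (((hasDerivAt_id (0 : ℝ)).mul_const d.1).const_add z.1).const_sub t₀
    simpa using this
  have h2 := ((ht.fun_pow 2).fun_sub (hasDerivAt_norm_sq_line z d x₀)).const_mul N
  have h3 := (hasDerivAt_smoothTransition _).comp (0 : ℝ) h2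
  simp only [zero_smul, add_zero] at h3
  refine (h1.unique h3).trans ?_
  push_cast
  ring

lemma fderiv_axisCut_apply (ε : ℝ) (z d : ℝ × E3) :
    fderiv ℝ (axisCut ε) z d =
      stepDeriv (‖z.2‖ ^ 2 / ε ^ 2 - 1) * (2 / ε ^ 2 * ⟪z.2, d.2⟫_ℝ) := by
  have h1 := hasDerivAt_line ((contDiff_axisCut ε).differentiable one_ne_zero z) d
  have h0 := hasDerivAt_norm_sq_line z d 0
  simp only [sub_zero] at h0
  have h3 := (hasDerivAt_smoothTransition _).comp (0 : ℝ) ((h0.div_const (ε ^ 2)).sub_const 1)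
  simp only [zero_smul, add_zero] at h3
  refine (h1.unique h3).trans ?_
  ring

lemma axisCut_eq_zero {ε : ℝ} (hε : 0 < ε) {z : ℝ × E3} (hz : ‖z.2‖ ≤ ε) : axisCut ε z = 0 := by
  refine smoothTransition.zero_of_nonpos ?_
  rw [sub_nonpos, div_le_one (by positivity)]
  exact pow_le_pow_left₀ (norm_nonneg _) hz 2

lemma axisCut_eventually_eq_zero {ε : ℝ} (hε : 0 < ε) {z : ℝ × E3} (hz : z.2 = 0) :
    ∀ᶠ y in nhds z, axisCut ε y = 0 := by
  have hc : Continuous fun y : ℝ × E3 => ‖y.2‖ := continuous_snd.norm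
  have : {y : ℝ × E3 | ‖y.2‖ < ε} ∈ nhds z :=
    (isOpen_lt hc continuous_const).mem_nhds (by simpa [hz] using hε)
  filter_upwards [this] with y hy
  exact axisCut_eq_zero hε (le_of_lt hy)

lemma contDiff_cut_mul {N t₀ ε : ℝ} (hε : 0 < ε) (x₀ : E3) {F : ℝ × E3 → ℝ}
    (hF : ∀ z : ℝ × E3, z.2 ≠ 0 → ContDiffAt ℝ 1 F z) :
    ContDiff ℝ 1 fun z => coneCut N t₀ x₀ z * axisCut ε z * F z := by
  rw [contDiff_iff_contDiffAt]
  intro z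
  by_cases hz : z.2 = 0
  · refine (contDiffAt_const (c := (0 : ℝ))).congr_of_eventuallyEq ?_
    filter_upwards [axisCut_eventually_eq_zero hε hz] with y hy
    rw [hy]; ring
  · exact ((contDiff_coneCut N t₀ x₀).contDiffAt.mul (contDiff_axisCut ε).contDiffAt).mul (hF z hz)

lemma fderiv_cut_mul_apply {N t₀ ε : ℝ} (x₀ : E3) {F : ℝ × E3 → ℝ} {z : ℝ × E3}
    (hF : DifferentiableAt ℝ F z) (d : ℝ × E3) :
    fderiv ℝ (fun z => coneCut N t₀ x₀ z * axisCut ε z * F z) z d =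
      (stepDeriv (N * ((t₀ - z.1) ^ 2 - ‖z.2 - x₀‖ ^ 2)) *
          (N * (-2 * (t₀ - z.1) * d.1 - 2 * ⟪z.2 - x₀, d.2⟫_ℝ)) * axisCut ε z
        + coneCut N t₀ x₀ z *
          (stepDeriv (‖z.2‖ ^ 2 / ε ^ 2 - 1) * (2 / ε ^ 2 * ⟪z.2, d.2⟫_ℝ))) * F z
      + coneCut N t₀ x₀ z * axisCut ε z * fderiv ℝ F z d := by
  have h1 := hasDerivAt_line ((contDiff_coneCut N t₀ x₀).differentiable one_ne_zero z) d
  have h2 := hasDerivAt_line ((contDiff_axisCut ε).differentiable one_ne_zero z) d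
  have h3 := hasDerivAt_line hF d
  have h4 : HasDerivAt (fun s : ℝ => coneCut N t₀ x₀ (z + s • d) * axisCut ε (z + s • d)
    * F (z + s • d)) _ 0 := (h1.fun_mul h2).fun_mul h3
  have h5 := hasDerivAt_line (((((contDiff_coneCut N t₀ x₀).differentiable one_ne_zero z).mul
    ((contDiff_axisCut ε).differentiable one_ne_zero z)).mul hF)) d
  have h6 := h5.unique h4
  simp only [zero_smul, add_zero, fderiv_coneCut_apply, fderiv_axisCut_apply] at h6
  refine Eq.trans ?_ h6
  rfl

/-- The potential part of the energy flux density through the approximate cone. -/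
def fluxDensity (p γ c : ℝ) (Φ : ℝ × E3 → ℝ) (N ε t₀ : ℝ) (x₀ : E3) (z : ℝ × E3) : ℝ :=
  axisCut ε z * (stepDeriv (N * ((t₀ - z.1) ^ 2 - ‖z.2 - x₀‖ ^ 2)) * (2 * N) *
    (potential p (Φ z) * (outW γ z * (t₀ - z.1 + ‖z.2‖⁻¹ * ⟪z.2, z.2 - x₀⟫_ℝ)
      + inW γ c z * (t₀ - z.1 - ‖z.2‖⁻¹ * ⟪z.2, z.2 - x₀⟫_ℝ))))

lemma inner_eq_sum (x y : E3) : ⟪x, y⟫_ℝ = ∑ i, x i * y i := by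
  rw [PiLp.inner_apply]
  simp [mul_comm]

lemma inW_nonneg {γ c : ℝ} (hc : 0 ≤ c) (z : ℝ × E3) : 0 ≤ inW γ c z := inWeight_nonneg hc _

lemma inW_le_outW {γ c : ℝ} (hγ : 1 < γ) (hc1 : c ≤ 1) {z : ℝ × E3} (ht : 0 ≤ z.1) :
    inW γ c z ≤ outW γ z := by
  refine inWeight_le_outWeight hγ hc1 ?_
  rw [abs_le]
  have := norm_nonneg z.2
  constructor <;> linarith

/-- The flux through the approximate cone is controlled by the divergence of the cut off current,
up to an error supported near the axis. -/
lemma fluxDensity_le {p γ γ₀ c : ℝ} (hp : 2 < p) (hγ : 1 < γ) (hγγ₀ : γ < γ₀) (hγ₀2 : γ₀ ≤ 2)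
    (hγ₀p : γ₀ ≤ p - 1) (hc : c = (γ₀ - γ) / (γ₀ + γ)) {Φ : ℝ × E3 → ℝ} (hΦ : ContDiff ℝ 2 Φ)
    {N ε t₀ M B : ℝ} (hN : 0 ≤ N) (hε : 0 < ε) (x₀ : E3)
    (hM : 0 ≤ M) (hMs : ∀ s, stepDeriv s ≤ M) (hB : 0 ≤ B) {z : ℝ × E3} (ht : 0 ≤ z.1)
    (htt : z.1 ≤ t₀)
    (hBz : ‖z.2‖ ≤ 2 * ε → z.2 ≠ 0 → ∑ i, z.2 i * currentField p γ c Φ i z ≤ B)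
    (heq : fderiv ℝ (dTime Φ) z timeDir - ∑ i, fderiv ℝ (dSpace Φ i) z (spaceDir i)
      + |Φ z| ^ (p - 1) * Φ z = 0) :
    fluxDensity p γ c Φ N ε t₀ x₀ z ≤
      -(fderiv ℝ (fun z => coneCut N t₀ x₀ z * axisCut ε z * energyField p γ c Φ z) z timeDir
        + ∑ i, fderiv ℝ (fun z => coneCut N t₀ x₀ z * axisCut ε z * currentField p γ c Φ i z) z
            (spaceDir i))
      + (Metric.closedBall (0 : E3) (2 * ε)).indicator (fun _ => 2 / ε ^ 2 * M * B) z.2 := by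
  have hind : 0 ≤ (Metric.closedBall (0 : E3) (2 * ε)).indicator
      (fun _ => 2 / ε ^ 2 * M * B) z.2 := Set.indicator_nonneg (fun _ _ => by positivity) _
  by_cases hz : z.2 = 0
  · have h0 := axisCut_eventually_eq_zero hε hz
    have h1 : ∀ F : ℝ × E3 → ℝ, fderiv ℝ (fun z => coneCut N t₀ x₀ z * axisCut ε z * F z) z = 0 := by
      intro F
      have : (fun z => coneCut N t₀ x₀ z * axisCut ε z * F z) =ᶠ[nhds z] fun _ => 0 := by
        filter_upwards [h0] with y hy
        rw [hy]; ring
      rw [this.fderiv_eq]; simp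
    rw [fluxDensity, h0.self_of_nhds, h1]
    simp only [h1]
    simpa using hind
  have hc0 : 0 ≤ c := by rw [hc]; exact div_nonneg (by linarith) (by linarith)
  have hc1 : c ≤ 1 := by rw [hc, div_le_one (by linarith)]; linarith
  have hf := inW_nonneg (γ := γ) hc0 z
  have hfg := inW_le_outW hγ hc1 ht
  have hw := inv_norm_sq_mul_sum hz
  have hin : ∀ (x : E3) i, ⟪x, (spaceDir i).2⟫_ℝ = x i := by
    intro x i; simp [spaceDir, EuclideanSpace.inner_single_right]
  have h2 : ∀ i, (spaceDir i).1 = 0 := fun i => rfl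
  have hdiv := divergence_nonpos hp hγ hγγ₀ hγ₀2 hγ₀p hc hΦ hz ht heq
  rw [fderiv_cut_mul_apply x₀ ((contDiffAt_energyField (by linarith) hγ hΦ hz).differentiableAt
    one_ne_zero)]
  simp only [fun i => fderiv_cut_mul_apply (N := N) (t₀ := t₀) (ε := ε) x₀
    ((contDiffAt_currentField (p := p) (c := c) (by linarith) hγ hΦ i hz).differentiableAt
    one_ne_zero), hin, h2]
  simp only [timeDir, inner_zero_right]
  set χ' := stepDeriv (N * ((t₀ - z.1) ^ 2 - ‖z.2 - x₀‖ ^ 2)) with hχ'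
  set ζ' := stepDeriv (‖z.2‖ ^ 2 / ε ^ 2 - 1) with hζ'
  have hχ'0 : 0 ≤ χ' := stepDeriv_nonneg _
  have hζ'0 : 0 ≤ ζ' := stepDeriv_nonneg _
  have hχ0 : 0 ≤ coneCut N t₀ x₀ z := smoothTransition.nonneg _
  have hχ1 : coneCut N t₀ x₀ z ≤ 1 := smoothTransition.le_one _
  have hζ0 : 0 ≤ axisCut ε z := smoothTransition.nonneg _
  have k1 : fluxDensity p γ c Φ N ε t₀ x₀ z ≤ axisCut ε z * (χ' * (2 * N) *
      ((t₀ - z.1) * energyField p γ c Φ z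
        + ∑ i, (z.2 - x₀) i * currentField p γ c Φ i z)) := by
    by_cases hs : (t₀ - z.1) ^ 2 - ‖z.2 - x₀‖ ^ 2 ≤ 0
    · have : χ' = 0 := stepDeriv_of_nonpos (mul_nonpos_of_nonneg_of_nonpos hN hs)
      rw [fluxDensity, ← hχ', this]
      simp
    · have h := potential_le_flux (inW γ c z) (outW γ z) ‖z.2‖⁻¹ (Φ z) (dTime Φ z)
        (potential p (Φ z)) (t₀ - z.1) z.2 (z.2 - x₀).ofLp (fun i => dSpace Φ i z) hf (hf.trans hfg)
        hw (by linarith) (by rw [sum_sq_eq_norm_sq]; linarith)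
      rw [fluxDensity, ← hχ', inner_eq_sum]
      exact mul_le_mul_of_nonneg_left (mul_le_mul_of_nonneg_left h (by positivity)) hζ0
  have k2 : coneCut N t₀ x₀ z * (ζ' * (2 / ε ^ 2) * ∑ i, z.2 i * currentField p γ c Φ i z)
      ≤ (Metric.closedBall (0 : E3) (2 * ε)).indicator (fun _ => 2 / ε ^ 2 * M * B) z.2 := by
    by_cases hzε : ‖z.2‖ ≤ 2 * ε
    · rw [Set.indicator_of_mem (by simpa using hzε)]
      calc coneCut N t₀ x₀ z * (ζ' * (2 / ε ^ 2) * ∑ i, z.2 i * currentField p γ c Φ i z)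
          ≤ coneCut N t₀ x₀ z * (ζ' * (2 / ε ^ 2) * B) := by
            gcongr
            exact hBz hzε hz
        _ ≤ 1 * (M * (2 / ε ^ 2) * B) := by
            gcongr
            exact hMs _
        _ = _ := by ring
    · have : ζ' = 0 := by
        refine stepDeriv_of_one_le ?_
        rw [le_sub_iff_add_le, le_div_iff₀ (by positivity)]
        nlinarith
      rw [this]
      simpa using hind
  have k3 := mul_nonneg (mul_nonneg hχ0 hζ0) (neg_nonneg.2 hdiv)
  have e : -(((χ' * (N * (-2 * (t₀ - z.1) * 1 - 2 * 0)) * axisCut ε z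
        + coneCut N t₀ x₀ z * (ζ' * (2 / ε ^ 2 * 0))) * energyField p γ c Φ z
        + coneCut N t₀ x₀ z * axisCut ε z * fderiv ℝ (energyField p γ c Φ) z timeDir)
      + ∑ i, ((χ' * (N * (-2 * (t₀ - z.1) * 0 - 2 * (z.2 - x₀) i)) * axisCut ε z
        + coneCut N t₀ x₀ z * (ζ' * (2 / ε ^ 2 * z.2 i))) * currentField p γ c Φ i z
        + coneCut N t₀ x₀ z * axisCut ε z * fderiv ℝ (currentField p γ c Φ i) z (spaceDir i)))
      = axisCut ε z * (χ' * (2 * N) * ((t₀ - z.1) * energyField p γ c Φ z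
        + ∑ i, (z.2 - x₀) i * currentField p γ c Φ i z))
      - coneCut N t₀ x₀ z * (ζ' * (2 / ε ^ 2) * ∑ i, z.2 i * currentField p γ c Φ i z)
      + coneCut N t₀ x₀ z * axisCut ε z * -(fderiv ℝ (energyField p γ c Φ) z timeDir
        + ∑ i, fderiv ℝ (currentField p γ c Φ i) z (spaceDir i)) := by
    simp only [Fin.sum_univ_three]
    ring
  have e' := e.symm
  simp only [timeDir] at e' k3
  linarith

lemma continuous_outW {γ : ℝ} (hγ : 1 < γ) : Continuous (outW γ) :=
  (contDiff_outWeight hγ).continuous.comp (by fun_prop)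

lemma continuous_inW {γ : ℝ} (c : ℝ) (hγ : 1 < γ) : Continuous (inW γ c) :=
  (contDiff_inWeight c hγ).continuous.comp (by fun_prop)

lemma abs_radial_inner_le (x y : E3) : |‖x‖⁻¹ * ⟪x, y⟫_ℝ| ≤ ‖y‖ := by
  rcases eq_or_ne x 0 with rfl | hx
  · simp
  have hx' : 0 < ‖x‖ := norm_pos_iff.2 hx
  rw [abs_mul, abs_of_nonneg (inv_nonneg.2 hx'.le), inv_mul_le_iff₀ hx']
  exact abs_real_inner_le_norm x y

lemma fluxDensity_nonneg {p γ c : ℝ} (hp : 2 < p) (hγ : 1 < γ) (hc0 : 0 ≤ c) (hc1 : c ≤ 1)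
    {Φ : ℝ × E3 → ℝ} {N ε t₀ : ℝ} (hN : 0 ≤ N) (x₀ : E3) {z : ℝ × E3} (ht : 0 ≤ z.1)
    (htt : z.1 ≤ t₀) : 0 ≤ fluxDensity p γ c Φ N ε t₀ x₀ z := by
  unfold fluxDensity
  refine mul_nonneg (smoothTransition.nonneg _) ?_
  by_cases hs : (t₀ - z.1) ^ 2 - ‖z.2 - x₀‖ ^ 2 ≤ 0
  · rw [stepDeriv_of_nonpos (mul_nonpos_of_nonneg_of_nonpos hN hs)]
    simp
  have hT : ‖z.2 - x₀‖ ≤ t₀ - z.1 :=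
    abs_le_of_sq_le_sq' (by linarith) (by linarith) |>.2
  obtain ⟨h1, h2⟩ := abs_le.1 (abs_radial_inner_le z.2 (z.2 - x₀))
  have hf := inW_nonneg (γ := γ) hc0 z
  have hfg := inW_le_outW hγ hc1 ht
  refine mul_nonneg (mul_nonneg (stepDeriv_nonneg _) (by positivity))
    (mul_nonneg (potential_nonneg (by linarith) _) (add_nonneg ?_ ?_))
  · exact mul_nonneg (hf.trans hfg) (by linarith)
  · exact mul_nonneg hf (by linarith)

lemma energyField_nonneg {p γ c : ℝ} (hp : 2 < p) (hγ : 1 < γ) (hc0 : 0 ≤ c) (hc1 : c ≤ 1)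
    (Φ : ℝ × E3 → ℝ) {z : ℝ × E3} (ht : 0 ≤ z.1) (hz : z.2 ≠ 0) :
    0 ≤ energyField p γ c Φ z := by
  have hf := inW_nonneg (γ := γ) hc0 z
  exact energyDensity_nonneg _ _ _ _ _ _ z.2.ofLp (fun i => dSpace Φ i z) hf
    (hf.trans (inW_le_outW hγ hc1 ht)) (inv_norm_sq_mul_sum hz) (potential_nonneg (by linarith) _)

/-- The radial component of the energy current is bounded from above near the axis. -/
lemma exists_radial_current_le {p γ c : ℝ} (hp : 2 < p) (hγ : 1 < γ) (hc0 : 0 ≤ c) (hc1 : c ≤ 1)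
    {Φ : ℝ × E3 → ℝ} (hΦ : ContDiff ℝ 2 Φ) (t₀ : ℝ) :
    ∃ B : ℝ, 0 ≤ B ∧ ∀ z : ℝ × E3, 0 ≤ z.1 → z.1 ≤ t₀ → ‖z.2‖ ≤ 1 → z.2 ≠ 0 →
      ∑ i, z.2 i * currentField p γ c Φ i z ≤ B := by
  have h1 := continuous_outW hγ
  have h2 := continuous_inW c hγ
  have h4 : Continuous Φ := hΦ.continuous
  have h5 := (contDiff_dTime hΦ).continuous
  have h6 := fun i => (contDiff_dSpace hΦ i).continuous
  have h8 : Continuous fun z => potential p (Φ z) :=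
    (contDiff_potential (by linarith)).continuous.comp h4
  have hcont : Continuous fun z : ℝ × E3 =>
      2 * inW γ c z * |dTime Φ z| * |∑ i, z.2 i * dSpace Φ i z + Φ z|
        + ‖z.2‖ * outW γ z * (∑ i, dSpace Φ i z ^ 2 / 2 + potential p (Φ z)) := by
    have h9 : Continuous fun z : ℝ × E3 => ∑ i, z.2 i * dSpace Φ i z :=
      continuous_finsetSum _ fun i _ => (contDiff_coord (n := 1) i).continuous.mul (h6 i)
    have h10 : Continuous fun z : ℝ × E3 => ∑ i, dSpace Φ i z ^ 2 / 2 :=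
      continuous_finsetSum _ fun i _ => ((h6 i).pow 2).div_const 2
    fun_prop
  obtain ⟨B, hB⟩ := ((isCompact_Icc (a := (0 : ℝ)) (b := t₀)).prod
    (isCompact_closedBall (0 : E3) 1)).exists_bound_of_continuousOn hcont.continuousOn
  refine ⟨max B 0, le_max_right _ _, fun z hz0 hzt hz1 hz => le_trans ?_ (le_max_left _ _)⟩
  have hf := inW_nonneg (γ := γ) hc0 z
  have hr : ‖z.2‖⁻¹ * ‖z.2‖ = 1 := inv_mul_cancel₀ (norm_ne_zero_iff.2 hz)
  refine (radial_flux_le (inW γ c z) (outW γ z) ‖z.2‖⁻¹ (Φ z) (dTime Φ z)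
    (potential p (Φ z)) z.2.ofLp (fun i => dSpace Φ i z) hf (inW_le_outW hγ hc1 hz0)
    (inv_norm_sq_mul_sum hz) (inv_nonneg.2 (norm_nonneg _)) ‖z.2‖ hr
    (potential_nonneg (by linarith) _)).trans ?_
  exact (le_abs_self _).trans (hB z ⟨⟨hz0, hzt⟩, by simpa using hz1⟩)

/-- Integrated form: the flux through the approximate cone is bounded by the initial energy. -/
lemma lintegral_fluxDensity_le {p γ γ₀ c : ℝ} (hp : 2 < p) (hγ : 1 < γ) (hγγ₀ : γ < γ₀)
    (hγ₀2 : γ₀ ≤ 2) (hγ₀p : γ₀ ≤ p - 1) (hc : c = (γ₀ - γ) / (γ₀ + γ)) {Φ : ℝ × E3 → ℝ}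
    (hΦ : ContDiff ℝ 2 Φ)
    (heq : ∀ z : ℝ × E3, 0 ≤ z.1 →
      fderiv ℝ (dTime Φ) z timeDir - ∑ i, fderiv ℝ (dSpace Φ i) z (spaceDir i)
        + |Φ z| ^ (p - 1) * Φ z = 0) {t₀ : ℝ} (ht₀ : 0 ≤ t₀) (x₀ : E3) :
    ∃ C : ℝ, 0 ≤ C ∧ ∀ N ε : ℝ, 0 ≤ N → 0 < ε → ε ≤ 1 / 2 →
      ∫⁻ z, ENNReal.ofReal (fluxDensity p γ c Φ N ε t₀ x₀ z)
          ∂((volume.restrict (Set.Ioo 0 t₀)).prod volume)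
        ≤ (∫⁻ x in Metric.closedBall x₀ t₀ \ {0}, ENNReal.ofReal (energyField p γ c Φ (0, x)))
          + ENNReal.ofReal (C * ε) := by
  have hc0 : 0 ≤ c := by rw [hc]; exact div_nonneg (by linarith) (by linarith)
  have hc1 : c ≤ 1 := by rw [hc, div_le_one (by linarith)]; linarith
  obtain ⟨M, hM0, hM⟩ := exists_stepDeriv_le
  obtain ⟨B, hB0, hB⟩ := exists_radial_current_le hp hγ hc0 hc1 hΦ t₀
  refine ⟨t₀ * (16 * M * B * volume.real (Metric.ball (0 : E3) 1)), by positivity, ?_⟩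
  intro N ε hN hε hε1
  set G : ℝ × E3 → ℝ := fun z => coneCut N t₀ x₀ z * axisCut ε z * energyField p γ c Φ z with hG
  set H : Fin 3 → ℝ × E3 → ℝ := fun i z =>
    coneCut N t₀ x₀ z * axisCut ε z * currentField p γ c Φ i z with hH
  set J : E3 → ℝ := (Metric.closedBall (0 : E3) (2 * ε)).indicator
    (fun _ => 2 / ε ^ 2 * M * B) with hJ
  have hcut : ∀ t ∈ Set.Icc 0 t₀, ∀ x ∉ Metric.closedBall x₀ t₀, coneCut N t₀ x₀ (t, x) = 0 := by
    intro t ht x hx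
    rw [Metric.mem_closedBall, dist_eq_norm, not_le] at hx
    refine smoothTransition.zero_of_nonpos (mul_nonpos_of_nonneg_of_nonpos hN ?_)
    have h1 : 0 ≤ t₀ - t := by linarith [ht.2]
    have h2 : t₀ - t ≤ ‖x - x₀‖ := by linarith [ht.1]
    have := pow_le_pow_left₀ h1 h2 2
    simpa using this
  have hGc : ContDiff ℝ 1 G :=
    contDiff_cut_mul hε x₀ fun z hz => contDiffAt_energyField (by linarith) hγ hΦ hz
  have hHc : ∀ i, ContDiff ℝ 1 (H i) := fun i =>
    contDiff_cut_mul hε x₀ fun z hz => contDiffAt_currentField (by linarith) hγ hΦ i hz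
  obtain ⟨hintg, hval⟩ := integral_divergence_slab hGc hHc ht₀ (isCompact_closedBall x₀ t₀)
    (fun t ht x hx => by simp [hG, hcut t (Set.Ioo_subset_Icc_self ht) x hx])
    (fun i t ht x hx => by simp [hH, hcut t (Set.Ioo_subset_Icc_self ht) x hx])
    (fun x => by
      have : coneCut N t₀ x₀ (t₀, x) = 0 := by
        refine smoothTransition.zero_of_nonpos (mul_nonpos_of_nonneg_of_nonpos hN ?_)
        simp
      simp [hG, this])
  set R : ℝ × E3 → ℝ := fun z =>
    -(fderiv ℝ G z timeDir + ∑ i, fderiv ℝ (H i) z (spaceDir i)) with hR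
  have hJi : Integrable J := by
    rw [hJ, integrable_indicator_iff Metric.isClosed_closedBall.measurableSet]
    exact (continuous_const.continuousOn).integrableOn_compact (isCompact_closedBall _ _)
  have hJi2 : Integrable (fun z : ℝ × E3 => J z.2)
      ((volume.restrict (Set.Ioo 0 t₀)).prod volume) := hJi.comp_snd _
  have hae : ∀ᵐ z : ℝ × E3 ∂((volume.restrict (Set.Ioo 0 t₀)).prod volume),
      z.1 ∈ Set.Ioo 0 t₀ :=
    Measure.quasiMeasurePreserving_fst.ae (ae_restrict_mem measurableSet_Ioo)
  have hle : ∀ᵐ z : ℝ × E3 ∂((volume.restrict (Set.Ioo 0 t₀)).prod volume),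
      fluxDensity p γ c Φ N ε t₀ x₀ z ≤ R z + J z.2 := by
    filter_upwards [hae] with z hz
    exact fluxDensity_le hp hγ hγγ₀ hγ₀2 hγ₀p hc hΦ hN hε x₀ hM0 hM hB0 hz.1.le hz.2.le
      (fun h1 h2 => hB z hz.1.le hz.2.le (by linarith) h2) (heq z hz.1.le)
  have hpos : ∀ᵐ z : ℝ × E3 ∂((volume.restrict (Set.Ioo 0 t₀)).prod volume),
      0 ≤ R z + J z.2 := by
    filter_upwards [hae, hle] with z hz hz'
    exact (fluxDensity_nonneg hp hγ hc0 hc1 hN x₀ hz.1.le hz.2.le).trans hz'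
  have hJval : ∫ z : ℝ × E3, J z.2 ∂((volume.restrict (Set.Ioo 0 t₀)).prod volume)
      = t₀ * (16 * M * B * volume.real (Metric.ball (0 : E3) 1)) * ε := by
    rw [integral_fun_snd, measureReal_restrict_apply_univ, Real.volume_real_Ioo_of_le ht₀, hJ,
      integral_indicator Metric.isClosed_closedBall.measurableSet, setIntegral_const,
      Measure.addHaar_real_closedBall _ _ (by positivity)]
    simp only [finrank_euclideanSpace, Fintype.card_fin, smul_eq_mul]
    field_simp
    ring
  have hG0 : ∀ x : E3, 0 ≤ G (0, x) := by
    intro x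
    by_cases hx : x = 0
    · have : axisCut ε (0, x) = 0 := axisCut_eq_zero hε (by simpa [hx] using hε.le)
      simp [hG, this]
    · exact mul_nonneg (mul_nonneg (smoothTransition.nonneg _) (smoothTransition.nonneg _))
        (energyField_nonneg hp hγ hc0 hc1 Φ le_rfl hx)
  have hGi : Integrable fun x : E3 => G (0, x) := by
    have h1 : Continuous fun x : E3 => G (0, x) := hGc.continuous.comp (Continuous.prodMk_right 0)
    refine h1.integrable_of_hasCompactSupport
      (HasCompactSupport.intro (isCompact_closedBall x₀ t₀) fun x hx => ?_)
    simp [hG, hcut 0 ⟨le_rfl, ht₀⟩ x hx]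
  calc ∫⁻ z, ENNReal.ofReal (fluxDensity p γ c Φ N ε t₀ x₀ z)
          ∂((volume.restrict (Set.Ioo 0 t₀)).prod volume)
      ≤ ∫⁻ z : ℝ × E3, ENNReal.ofReal (R z + J z.2)
          ∂((volume.restrict (Set.Ioo 0 t₀)).prod volume) :=
        lintegral_mono_ae (hle.mono fun z hz => ENNReal.ofReal_le_ofReal hz)
    _ = ENNReal.ofReal (∫ z : ℝ × E3, (R z + J z.2)
          ∂((volume.restrict (Set.Ioo 0 t₀)).prod volume)) :=
        (ofReal_integral_eq_lintegral_ofReal (hintg.add hJi2) hpos).symm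
    _ = ENNReal.ofReal ((∫ x, G (0, x))
          + t₀ * (16 * M * B * volume.real (Metric.ball (0 : E3) 1)) * ε) := by
        rw [integral_add hintg hJi2, hval, hJval]
    _ ≤ ENNReal.ofReal (∫ x, G (0, x))
          + ENNReal.ofReal (t₀ * (16 * M * B * volume.real (Metric.ball (0 : E3) 1)) * ε) :=
        ENNReal.ofReal_add_le
    _ ≤ (∫⁻ x in Metric.closedBall x₀ t₀ \ {0}, ENNReal.ofReal (energyField p γ c Φ (0, x)))
          + ENNReal.ofReal (t₀ * (16 * M * B * volume.real (Metric.ball (0 : E3) 1)) * ε) := by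
        refine add_le_add ?_ le_rfl
        rw [ofReal_integral_eq_lintegral_ofReal hGi (Filter.Eventually.of_forall hG0),
          ← lintegral_indicator (Metric.isClosed_closedBall.measurableSet.diff
            (measurableSet_singleton 0))]
        refine lintegral_mono fun x => ?_
        by_cases hx : x ∈ Metric.closedBall x₀ t₀ \ {0}
        · rw [Set.indicator_of_mem hx]
          refine ENNReal.ofReal_le_ofReal ?_
          have h1 : coneCut N t₀ x₀ (0, x) * axisCut ε (0, x) ≤ 1 :=
            mul_le_one₀ (smoothTransition.le_one _) (smoothTransition.nonneg _)
              (smoothTransition.le_one _)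
          exact mul_le_of_le_one_left (energyField_nonneg hp hγ hc0 hc1 Φ le_rfl hx.2) h1
        · rw [Set.indicator_of_notMem hx]
          by_cases hx0 : x = 0
          · have : axisCut ε (0, x) = 0 := axisCut_eq_zero hε (by simpa [hx0] using hε.le)
            simp [hG, this]
          · have : x ∉ Metric.closedBall x₀ t₀ := fun h => hx ⟨h, hx0⟩
            simp [hG, hcut 0 ⟨le_rfl, ht₀⟩ x this]

/-- Integration in polar coordinates on `ℝ³`. -/
theorem lintegral_polar {f : E3 → ℝ≥0∞} (hf : Measurable f) :
    ∫⁻ x, f x = ∫⁻ ω : Metric.sphere (0 : E3) 1, ∫⁻ r in Set.Ioi (0 : ℝ),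
      ENNReal.ofReal (r ^ 2) * f (r • (ω : E3)) ∂volume ∂sphereMeasure := by
  set g : Metric.sphere (0 : E3) 1 × Set.Ioi (0 : ℝ) → ℝ≥0∞ := fun y => f (y.2.1 • (y.1 : E3))
    with hg_def
  have hg : Measurable g := hf.comp (by fun_prop)
  calc ∫⁻ x, f x = ∫⁻ x : ({(0 : E3)}ᶜ : Set E3), f x.1 ∂((volume : Measure E3).comap (↑)) := by
        rw [lintegral_subtype_comap (measurableSet_singleton _).compl f,
          restrict_compl_singleton]
    _ = ∫⁻ y, g y ∂((volume : Measure E3).toSphere.prod (.volumeIoiPow 2)) := by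
        have h := (volume : Measure E3).measurePreserving_homeomorphUnitSphereProd.lintegral_comp_emb
          (Homeomorph.measurableEmbedding _) g
        have hd : Module.finrank ℝ E3 - 1 = 2 := by simp
        rw [hd] at h
        rw [← h]
        refine lintegral_congr fun x => ?_
        have hx : ‖(x : E3)‖ ≠ 0 := norm_ne_zero_iff.2 x.2
        simp [hg_def, smul_smul, hx]
    _ = _ := by
        rw [lintegral_prod _ hg.aemeasurable]
        refine lintegral_congr fun ω => ?_
        rw [Measure.volumeIoiPow, lintegral_withDensity_eq_lintegral_mul _ (by fun_prop)
          (g := fun r => g (ω, r)) (hg.comp (by fun_prop))]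
        exact lintegral_subtype_comap measurableSet_Ioi
          (fun r : ℝ => ENNReal.ofReal (r ^ 2) * f (r • (ω : E3)))

instance : SFinite sphereMeasure := by
  unfold sphereMeasure; infer_instance

/-- Integration in polar coordinates centred at `x₀`, radial variable outside. -/
theorem lintegral_polar_swap {f : E3 → ℝ≥0∞} (hf : Measurable f) (x₀ : E3) :
    ∫⁻ x, f x = ∫⁻ r in Set.Ioi (0 : ℝ), ∫⁻ ω : Metric.sphere (0 : E3) 1,
      ENNReal.ofReal (r ^ 2) * f (x₀ + r • (ω : E3)) ∂sphereMeasure := by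
  rw [← lintegral_add_left_eq_self f x₀,
    lintegral_polar (f := fun x => f (x₀ + x)) (hf.comp (by fun_prop)), lintegral_lintegral_swap]
  refine Measurable.aemeasurable ?_
  have : Measurable fun q : Metric.sphere (0 : E3) 1 × ℝ => f (x₀ + q.2 • (q.1 : E3)) :=
    hf.comp (by fun_prop)
  simp only [Function.uncurry_def]
  fun_prop

lemma sq_le_mul_of_forall_le {a k b : ℝ} (hk : 0 ≤ k) (hb : 0 ≤ b)
    (h : ∀ l : ℝ, 0 < l → 2 * a ≤ l * k + l⁻¹ * b) (ha : 0 ≤ a) : a ^ 2 ≤ k * b := by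
  have h0 : ∀ l : ℝ, 0 ≤ k * (l * l) + (-(2 * a)) * l + b := by
    intro l
    rcases le_or_gt l 0 with hl | hl
    · nlinarith [mul_nonneg hk (mul_self_nonneg l), mul_nonneg ha (neg_nonneg.2 hl)]
    · have h1 := mul_le_mul_of_nonneg_left (h l hl) hl.le
      have h2 : l * (l * k + l⁻¹ * b) = k * (l * l) + b := by field_simp
      nlinarith
  have := discrim_le_zero h0
  rw [discrim] at this
  nlinarith

/-- A function with finite weighted potential energy along a ray gets arbitrarily small. -/
lemma exists_abs_lt_of_lintegral_ne_top {p γ₀ : ℝ} (hγ₀ : 0 ≤ γ₀) (hp : 0 ≤ p) {y : ℝ → ℝ}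
    (hP : ∫⁻ r in Set.Ioi (0 : ℝ), ENNReal.ofReal ((1 + r) ^ γ₀ * |y r| ^ (p + 1) * r ^ 2) ≠ ⊤)
    {R δ : ℝ} (hR : 1 ≤ R) (hδ : 0 < δ) : ∃ S, R < S ∧ |y S| < δ := by
  by_contra! hcon
  apply hP
  rw [eq_top_iff]
  calc (⊤ : ℝ≥0∞) = ENNReal.ofReal (δ ^ (p + 1)) * volume (Set.Ioi R) := by
        rw [Real.volume_Ioi, ENNReal.mul_top]
        simpa using Real.rpow_pos_of_pos hδ _
    _ = ∫⁻ _ in Set.Ioi R, ENNReal.ofReal (δ ^ (p + 1)) := by simp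
    _ ≤ ∫⁻ r in Set.Ioi R, ENNReal.ofReal ((1 + r) ^ γ₀ * |y r| ^ (p + 1) * r ^ 2) := by
        refine setLIntegral_mono' measurableSet_Ioi fun r hr => ENNReal.ofReal_le_ofReal ?_
        have hr1 : 1 ≤ r := hR.trans (le_of_lt hr)
        have h1 : 1 ≤ (1 + r) ^ γ₀ := Real.one_le_rpow (by linarith) hγ₀
        have h2 : δ ^ (p + 1) ≤ |y r| ^ (p + 1) :=
          Real.rpow_le_rpow hδ.le (hcon r hr) (by linarith)
        have h3 : 0 ≤ δ ^ (p + 1) := Real.rpow_nonneg hδ.le _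
        have h4 : 1 ≤ r ^ 2 := one_le_pow₀ hr1
        calc δ ^ (p + 1) ≤ |y r| ^ (p + 1) := h2
          _ ≤ (1 + r) ^ γ₀ * |y r| ^ (p + 1) := le_mul_of_one_le_left (h3.trans h2) h1
          _ ≤ _ := le_mul_of_one_le_right (by positivity) h4
    _ ≤ _ := lintegral_mono_set (Set.Ioi_subset_Ioi (by linarith))

/-- Pointwise decay along a ray from the weighted radial energy. -/
lemma sq_le_of_radial_energy {γ₀ k : ℝ} (hγ₀ : 0 ≤ γ₀) {y y' : ℝ → ℝ}
    (hy : ∀ r, HasDerivAt y (y' r) r) (hy' : Continuous y')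
    (hW : IntegrableOn (fun r => (1 + r) ^ γ₀ * (r ^ 2 * y' r ^ 2)) (Set.Ioi 0))
    (hk : ∫ r in Set.Ioi (0 : ℝ), (1 + r) ^ γ₀ * (r ^ 2 * y' r ^ 2) ≤ k)
    {r : ℝ} (hr : 1 ≤ r) (hsmall : ∀ δ, 0 < δ → ∃ S, r < S ∧ |y S| < δ) :
    y r ^ 2 ≤ k * r ^ (-(1 + γ₀)) := by
  have hr0 : 0 < r := by linarith
  have hWnn : ∀ s, 0 < s → 0 ≤ (1 + s) ^ γ₀ * (s ^ 2 * y' s ^ 2) := fun s hs =>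
    mul_nonneg (Real.rpow_nonneg (by linarith) _) (by positivity)
  have hk0 : 0 ≤ k := (setIntegral_nonneg measurableSet_Ioi fun s hs => hWnn s hs).trans hk
  have key : ∀ S, r < S → ∀ l : ℝ, 0 < l →
      2 * |y S - y r| ≤ l * k + l⁻¹ * r ^ (-(1 + γ₀)) := by
    intro S hS l hl
    have hintg : IntervalIntegrable (fun s => (1 + s) ^ γ₀ * (s ^ 2 * y' s ^ 2)) volume r S := by
      rw [intervalIntegrable_iff_integrableOn_Ioc_of_le hS.le]
      exact hW.mono_set fun s hs => hr0.trans hs.1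
    have hnot : (0 : ℝ) ∉ Set.uIcc r S := by
      rw [Set.uIcc_of_le hS.le]; intro h; linarith [h.1]
    have hpow : IntervalIntegrable (fun s : ℝ => s ^ (-(2 + γ₀))) volume r S :=
      intervalIntegral.intervalIntegrable_rpow (Or.inr hnot)
    have h1 : y S - y r = ∫ s in r..S, y' s :=
      (intervalIntegral.integral_eq_sub_of_hasDerivAt (fun s _ => hy s)
        (hy'.intervalIntegrable _ _)).symm
    have h2 : |y S - y r| ≤ ∫ s in r..S, |y' s| := by
      rw [h1]; exact intervalIntegral.abs_integral_le_integral_abs hS.le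
    have h3 : 2 * ∫ s in r..S, |y' s| ≤
        ∫ s in r..S, (l * ((1 + s) ^ γ₀ * (s ^ 2 * y' s ^ 2)) + l⁻¹ * s ^ (-(2 + γ₀))) := by
      rw [← intervalIntegral.integral_const_mul]
      refine intervalIntegral.integral_mono_on hS.le
        ((hy'.abs.const_mul 2).intervalIntegrable _ _)
        ((hintg.const_mul _).add (hpow.const_mul _)) fun s hs => ?_
      have hs0 : 0 < s := hr0.trans_le hs.1
      have hsg : 0 < s ^ γ₀ := Real.rpow_pos_of_pos hs0 _
      have h4 : s ^ (-(2 + γ₀)) = (s ^ 2 * s ^ γ₀)⁻¹ := by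
        rw [Real.rpow_neg hs0.le, Real.rpow_add hs0, Real.rpow_two]
      have h5 : s ^ γ₀ ≤ (1 + s) ^ γ₀ := Real.rpow_le_rpow hs0.le (by linarith) hγ₀
      have h6 : 2 * |y' s| ≤ l * (s ^ γ₀ * (s ^ 2 * y' s ^ 2)) + l⁻¹ * (s ^ 2 * s ^ γ₀)⁻¹ := by
        have hB : 0 < l * (s ^ 2 * s ^ γ₀) := by positivity
        have h7 : l * (s ^ γ₀ * (s ^ 2 * y' s ^ 2)) + l⁻¹ * (s ^ 2 * s ^ γ₀)⁻¹ - 2 * |y' s|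
            = (l * (s ^ 2 * s ^ γ₀))⁻¹ * (l * (s ^ 2 * s ^ γ₀) * |y' s| - 1) ^ 2 := by
          rw [← sq_abs (y' s)]
          field_simp
          ring
        have : 0 ≤ (l * (s ^ 2 * s ^ γ₀))⁻¹ * (l * (s ^ 2 * s ^ γ₀) * |y' s| - 1) ^ 2 := by
          positivity
        linarith
      rw [h4]
      have h8 : l * (s ^ γ₀ * (s ^ 2 * y' s ^ 2)) ≤ l * ((1 + s) ^ γ₀ * (s ^ 2 * y' s ^ 2)) := by
        gcongr
      linarith
    rw [intervalIntegral.integral_add (hintg.const_mul _) (hpow.const_mul _),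
      intervalIntegral.integral_const_mul, intervalIntegral.integral_const_mul,
      integral_rpow (Or.inr ⟨by linarith, hnot⟩)] at h3
    have h9 : ∫ s in r..S, (1 + s) ^ γ₀ * (s ^ 2 * y' s ^ 2) ≤ k := by
      rw [intervalIntegral.integral_of_le hS.le]
      refine le_trans (setIntegral_mono_set hW ?_ ?_) hk
      · exact (ae_restrict_mem measurableSet_Ioi).mono fun s hs => hWnn s hs
      · exact Filter.Eventually.of_forall fun s hs => hr0.trans hs.1
    have h10 : (S ^ (-(2 + γ₀) + 1) - r ^ (-(2 + γ₀) + 1)) / (-(2 + γ₀) + 1) ≤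
        r ^ (-(1 + γ₀)) := by
      have e1 : -(2 + γ₀) + 1 = -(1 + γ₀) := by ring
      rw [e1, div_neg, ← neg_div, div_le_iff₀ (by linarith)]
      have e2 : 0 ≤ S ^ (-(1 + γ₀)) := Real.rpow_nonneg (by linarith) _
      have e3 : 0 ≤ r ^ (-(1 + γ₀)) := Real.rpow_nonneg (by linarith) _
      nlinarith [mul_nonneg e3 hγ₀]
    have h11 := mul_le_mul_of_nonneg_left h9 hl.le
    have h12 := mul_le_mul_of_nonneg_left h10 (inv_pos.2 hl).le
    linarith
  have hb : 0 ≤ r ^ (-(1 + γ₀)) := Real.rpow_nonneg hr0.le _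
  rw [← sq_abs]
  refine sq_le_mul_of_forall_le hk0 hb (fun l hl => ?_) (abs_nonneg _)
  refine le_of_forall_pos_le_add fun δ hδ => ?_
  obtain ⟨S, hS, hyS⟩ := hsmall (δ / 2) (by linarith)
  have := key S hS l hl
  have h1 : |y r| ≤ |y S - y r| + |y S| := by
    have := abs_sub (y S) (y S - y r)
    simp only [sub_sub_cancel] at this
    linarith
  linarith

/-- Hardy-type bound along a ray, with a loss of weight. -/
lemma lintegral_ray_le {p γ γ₀ : ℝ} (hp : 0 ≤ p) (hγ : 0 ≤ γ) (hγγ₀ : γ < γ₀) {y y' : ℝ → ℝ}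
    (hy : ∀ r, HasDerivAt y (y' r) r) (hy' : Continuous y')
    (hP : ∫⁻ r in Set.Ioi (0 : ℝ), ENNReal.ofReal ((1 + r) ^ γ₀ * |y r| ^ (p + 1) * r ^ 2) ≠ ⊤) :
    ∫⁻ r in Set.Ioi (0 : ℝ), ENNReal.ofReal ((1 + r) ^ γ * (y r + r * y' r) ^ 2) ≤
      ENNReal.ofReal (2 * 2 ^ γ + 2 + 2 * 2 ^ γ * (γ₀ - γ)⁻¹) *
        ∫⁻ r in Set.Ioi (0 : ℝ), ENNReal.ofReal ((1 + r) ^ γ₀ * (r ^ 2 * y' r ^ 2)) := by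
  have hγ₀ : 0 ≤ γ₀ := by linarith
  have h2γ : 0 < (2 : ℝ) ^ γ := by positivity
  have hgap : 0 < γ₀ - γ := by linarith
  by_cases htop : ∫⁻ r in Set.Ioi (0 : ℝ), ENNReal.ofReal ((1 + r) ^ γ₀ * (r ^ 2 * y' r ^ 2)) = ⊤
  · rw [htop, ENNReal.mul_top]
    · exact le_top
    · simp only [ne_eq, ENNReal.ofReal_eq_zero, not_le]; positivity
  have hWnn : ∀ s, 0 < s → 0 ≤ (1 + s) ^ γ₀ * (s ^ 2 * y' s ^ 2) := fun s hs =>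
    mul_nonneg (Real.rpow_nonneg (by linarith) _) (by positivity)
  have hcy : Continuous y := continuous_iff_continuousAt.2 fun r => (hy r).continuousAt
  have hWc : ContinuousOn (fun r => (1 + r) ^ γ₀ * (r ^ 2 * y' r ^ 2)) (Set.Ioi (0 : ℝ)) := by
    refine ContinuousOn.mul ?_ (by fun_prop)
    exact (continuousOn_const.add continuousOn_id).rpow_const fun r hr => Or.inr hγ₀
  have hWae : 0 ≤ᵐ[volume.restrict (Set.Ioi (0 : ℝ))]
      fun r => (1 + r) ^ γ₀ * (r ^ 2 * y' r ^ 2) :=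
    (ae_restrict_mem measurableSet_Ioi).mono fun s hs => hWnn s hs
  have hW : IntegrableOn (fun r => (1 + r) ^ γ₀ * (r ^ 2 * y' r ^ 2)) (Set.Ioi 0) := by
    refine ⟨hWc.aestronglyMeasurable measurableSet_Ioi, ?_⟩
    rw [hasFiniteIntegral_iff_ofReal hWae]
    exact lt_top_iff_ne_top.2 htop
  set k := ∫ r in Set.Ioi (0 : ℝ), (1 + r) ^ γ₀ * (r ^ 2 * y' r ^ 2) with hk
  have hk0 : 0 ≤ k := setIntegral_nonneg measurableSet_Ioi fun s hs => hWnn s hs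
  have hdecay : ∀ r, 1 ≤ r → y r ^ 2 ≤ k * r ^ (-(1 + γ₀)) := fun r hr =>
    sq_le_of_radial_energy hγ₀ hy hy' hW hk.ge hr
      fun δ hδ => exists_abs_lt_of_lintegral_ne_top hγ₀ hp hP hr hδ
  rw [← ofReal_integral_eq_lintegral_ofReal hW hWae, ← hk, ← ENNReal.ofReal_mul (by positivity)]
  have hinner : ∫⁻ r in Set.Ioc (0 : ℝ) 1, ENNReal.ofReal ((1 + r) ^ γ * (y r + r * y' r) ^ 2) ≤
      ENNReal.ofReal (2 * 2 ^ γ * k) := by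
    have hcont : Continuous fun r => (y r + r * y' r) ^ 2 := by fun_prop
    have hval : ∫ r in Set.Ioc (0 : ℝ) 1, (y r + r * y' r) ^ 2 ≤ 2 * k := by
      have hd : ∀ r ∈ Set.uIcc (0 : ℝ) 1, HasDerivAt (fun s => s * y s ^ 2)
          ((y r + r * y' r) ^ 2 - r ^ 2 * y' r ^ 2) r := by
        intro r _
        have h : HasDerivAt (fun s => s * y s ^ 2) _ r := (hasDerivAt_id r).mul ((hy r).pow 2)
        refine h.congr_deriv ?_
        simp only [id_eq, one_mul, Nat.cast_ofNat]
        ring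
      have hftc := intervalIntegral.integral_eq_sub_of_hasDerivAt hd
        (Continuous.intervalIntegrable (by fun_prop) _ _)
      rw [intervalIntegral.integral_sub (hcont.intervalIntegrable _ _)
        (Continuous.intervalIntegrable (by fun_prop) _ _),
        intervalIntegral.integral_of_le zero_le_one,
        intervalIntegral.integral_of_le zero_le_one] at hftc
      have h1 : ∫ r in Set.Ioc (0 : ℝ) 1, r ^ 2 * y' r ^ 2 ≤ k := by
        calc ∫ r in Set.Ioc (0 : ℝ) 1, r ^ 2 * y' r ^ 2
            ≤ ∫ r in Set.Ioc (0 : ℝ) 1, (1 + r) ^ γ₀ * (r ^ 2 * y' r ^ 2) := by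
              refine setIntegral_mono_on ?_ (hW.mono_set Set.Ioc_subset_Ioi_self)
                measurableSet_Ioc fun r hr => ?_
              · exact ((Continuous.integrableOn_Icc (by fun_prop)).mono_set Set.Ioc_subset_Icc_self)
              · exact le_mul_of_one_le_left (by positivity)
                  (Real.one_le_rpow (by linarith [hr.1]) hγ₀)
          _ ≤ k := setIntegral_mono_set hW hWae
              (Filter.Eventually.of_forall Set.Ioc_subset_Ioi_self)
      have h2 := hdecay 1 le_rfl
      simp only [Real.one_rpow, mul_one] at h2
      simp only [one_mul, zero_mul, sub_zero] at hftc
      linarith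
    calc ∫⁻ r in Set.Ioc (0 : ℝ) 1, ENNReal.ofReal ((1 + r) ^ γ * (y r + r * y' r) ^ 2)
        ≤ ∫⁻ r in Set.Ioc (0 : ℝ) 1, ENNReal.ofReal (2 ^ γ * (y r + r * y' r) ^ 2) := by
          refine setLIntegral_mono' measurableSet_Ioc fun r hr => ENNReal.ofReal_le_ofReal ?_
          have := Real.rpow_le_rpow (by linarith [hr.1]) (by linarith [hr.2] : 1 + r ≤ 2) hγ
          gcongr
      _ = ENNReal.ofReal (∫ r in Set.Ioc (0 : ℝ) 1, 2 ^ γ * (y r + r * y' r) ^ 2) := by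
          rw [ofReal_integral_eq_lintegral_ofReal]
          · exact (Continuous.integrableOn_Icc (by fun_prop)).mono_set Set.Ioc_subset_Icc_self
          · exact Filter.Eventually.of_forall fun r => by positivity
      _ ≤ _ := by
          refine ENNReal.ofReal_le_ofReal ?_
          rw [integral_const_mul]
          nlinarith
  have houter : ∫⁻ r in Set.Ioi (1 : ℝ), ENNReal.ofReal ((1 + r) ^ γ * (y r + r * y' r) ^ 2) ≤
      ENNReal.ofReal (2 * k + 2 * 2 ^ γ * (γ₀ - γ)⁻¹ * k) := by
    have hWi : IntegrableOn (fun r => 2 * ((1 + r) ^ γ₀ * (r ^ 2 * y' r ^ 2))) (Set.Ioi (1 : ℝ)) :=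
      (hW.mono_set (Set.Ioi_subset_Ioi zero_le_one)).const_mul 2
    have hpi : IntegrableOn (fun r : ℝ => 2 * 2 ^ γ * k * r ^ (γ - (1 + γ₀))) (Set.Ioi (1 : ℝ)) :=
      (integrableOn_Ioi_rpow_of_lt (by linarith) zero_lt_one).const_mul _
    have hpt : ∀ r ∈ Set.Ioi (1 : ℝ), (1 + r) ^ γ * (y r + r * y' r) ^ 2 ≤
        2 * ((1 + r) ^ γ₀ * (r ^ 2 * y' r ^ 2)) + 2 * 2 ^ γ * k * r ^ (γ - (1 + γ₀)) := by
      intro r hr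
      have hr1 : 1 < r := hr
      have hr0 : 0 < r := by linarith
      have h1 := hdecay r hr1.le
      have h2 : (1 + r) ^ γ ≤ 2 ^ γ * r ^ γ := by
        rw [← Real.mul_rpow (by norm_num) hr0.le]
        exact Real.rpow_le_rpow (by linarith) (by linarith) hγ
      have h3 : (1 + r) ^ γ ≤ (1 + r) ^ γ₀ :=
        Real.rpow_le_rpow_of_exponent_le (by linarith) hγγ₀.le
      have h4 : (y r + r * y' r) ^ 2 ≤ 2 * y r ^ 2 + 2 * (r ^ 2 * y' r ^ 2) := by
        nlinarith [sq_nonneg (y r - r * y' r)]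
      have h5 : r ^ (γ - (1 + γ₀)) = r ^ γ * r ^ (-(1 + γ₀)) := by
        rw [← Real.rpow_add hr0]; ring_nf
      have hg : 0 ≤ (1 + r) ^ γ := Real.rpow_nonneg (by linarith) _
      calc (1 + r) ^ γ * (y r + r * y' r) ^ 2
          ≤ (1 + r) ^ γ * (2 * y r ^ 2 + 2 * (r ^ 2 * y' r ^ 2)) := by gcongr
        _ = 2 * ((1 + r) ^ γ * y r ^ 2) + 2 * ((1 + r) ^ γ * (r ^ 2 * y' r ^ 2)) := by ring
        _ ≤ 2 * (2 ^ γ * r ^ γ * (k * r ^ (-(1 + γ₀)))) +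
            2 * ((1 + r) ^ γ₀ * (r ^ 2 * y' r ^ 2)) := by gcongr
        _ = _ := by rw [h5]; ring
    calc ∫⁻ r in Set.Ioi (1 : ℝ), ENNReal.ofReal ((1 + r) ^ γ * (y r + r * y' r) ^ 2)
        ≤ ∫⁻ r in Set.Ioi (1 : ℝ), ENNReal.ofReal (2 * ((1 + r) ^ γ₀ * (r ^ 2 * y' r ^ 2)) +
            2 * 2 ^ γ * k * r ^ (γ - (1 + γ₀))) :=
          setLIntegral_mono' measurableSet_Ioi fun r hr => ENNReal.ofReal_le_ofReal (hpt r hr)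
      _ = ENNReal.ofReal (∫ r in Set.Ioi (1 : ℝ), (2 * ((1 + r) ^ γ₀ * (r ^ 2 * y' r ^ 2)) +
            2 * 2 ^ γ * k * r ^ (γ - (1 + γ₀)))) := by
          refine (ofReal_integral_eq_lintegral_ofReal (hWi.add hpi) ?_).symm
          refine (ae_restrict_mem measurableSet_Ioi).mono fun r hr => ?_
          have hr1 : (1 : ℝ) < r := hr
          have := Real.rpow_nonneg (by linarith : 0 ≤ 1 + r) γ₀
          have := Real.rpow_nonneg (by linarith : 0 ≤ r) (γ - (1 + γ₀))
          simp only [Pi.zero_apply, Pi.add_apply]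
          positivity
      _ ≤ _ := by
          refine ENNReal.ofReal_le_ofReal ?_
          rw [integral_add hWi hpi, integral_const_mul, integral_const_mul,
            integral_Ioi_rpow_of_lt (by linarith) zero_lt_one]
          have h1 : ∫ r in Set.Ioi (1 : ℝ), (1 + r) ^ γ₀ * (r ^ 2 * y' r ^ 2) ≤ k :=
            setIntegral_mono_set hW hWae
              (Filter.Eventually.of_forall (Set.Ioi_subset_Ioi zero_le_one))
          have h2 : -(1 : ℝ) ^ (γ - (1 + γ₀) + 1) / (γ - (1 + γ₀) + 1) = (γ₀ - γ)⁻¹ := by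
            rw [Real.one_rpow, show γ - (1 + γ₀) + 1 = -(γ₀ - γ) by ring, neg_div_neg_eq, one_div]
          rw [h2]
          linarith
  rw [← Set.Ioc_union_Ioi_eq_Ioi (zero_le_one (α := ℝ)),
    lintegral_union measurableSet_Ioi (Set.Ioc_disjoint_Ioi le_rfl)]
  refine (add_le_add hinner houter).trans ?_
  rw [← ENNReal.ofReal_add (by positivity) (by positivity)]
  refine ENNReal.ofReal_le_ofReal (le_of_eq (by ring))

/-- Weighted Hardy-type bound for the radial derivative of `r g` on `ℝ³`. -/
lemma lintegral_radial_hardy {p γ γ₀ : ℝ} (hp : 0 ≤ p) (hγ : 0 ≤ γ) (hγγ₀ : γ < γ₀) {g : E3 → ℝ}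
    (hg : ContDiff ℝ 1 g)
    (hP : ∫⁻ x : E3, ENNReal.ofReal ((1 + ‖x‖) ^ γ₀ * |g x| ^ (p + 1)) ≠ ⊤) :
    ∫⁻ x : E3, ENNReal.ofReal ((1 + ‖x‖) ^ γ * (‖x‖⁻¹ * (g x + fderiv ℝ g x x)) ^ 2) ≤
      ENNReal.ofReal (2 * 2 ^ γ + 2 + 2 * 2 ^ γ * (γ₀ - γ)⁻¹) *
        ∫⁻ x : E3, ENNReal.ofReal ((1 + ‖x‖) ^ γ₀ * ‖fderiv ℝ g x‖ ^ 2) := by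
  have hgc : Continuous g := hg.continuous
  have hdc : Continuous (fderiv ℝ g) := hg.continuous_fderiv one_ne_zero
  have hdxc : Continuous fun x => fderiv ℝ g x x := hdc.clm_apply continuous_id
  have hm1 : Measurable fun x : E3 => ENNReal.ofReal ((1 + ‖x‖) ^ γ₀ * |g x| ^ (p + 1)) := by
    have := hgc.measurable
    fun_prop
  have hm2 : Measurable fun x : E3 =>
      ENNReal.ofReal ((1 + ‖x‖) ^ γ * (‖x‖⁻¹ * (g x + fderiv ℝ g x x)) ^ 2) := by
    have := hgc.measurable
    have := hdxc.measurable
    fun_prop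
  have hm3 : Measurable fun x : E3 => ENNReal.ofReal ((1 + ‖x‖) ^ γ₀ * ‖fderiv ℝ g x‖ ^ 2) := by
    have := hdc.norm.measurable
    fun_prop
  have hprod : ∀ {f : E3 → ℝ≥0∞}, Measurable f →
      Measurable fun ω : Metric.sphere (0 : E3) 1 => ∫⁻ r in Set.Ioi (0 : ℝ),
        ENNReal.ofReal (r ^ 2) * f (r • (ω : E3)) := by
    intro f hf
    have h : Measurable fun q : Metric.sphere (0 : E3) 1 × ℝ => f (q.2 • (q.1 : E3)) :=
      hf.comp (by fun_prop)
    refine Measurable.lintegral_prod_right (ν := volume.restrict (Set.Ioi (0 : ℝ)))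
      (f := fun (ω : Metric.sphere (0 : E3) 1) r => ENNReal.ofReal (r ^ 2) * f (r • (ω : E3))) ?_
    simp only [Function.uncurry_def]
    fun_prop
  have hnorm : ∀ (ω : Metric.sphere (0 : E3) 1) {r : ℝ}, 0 < r → ‖r • (ω : E3)‖ = r := by
    intro ω r hr
    rw [norm_smul, Real.norm_of_nonneg hr.le, norm_eq_of_mem_sphere, mul_one]
  rw [lintegral_polar hm1] at hP
  rw [lintegral_polar hm2, lintegral_polar hm3, ← lintegral_const_mul _ (hprod hm3)]
  refine lintegral_mono_ae ?_
  filter_upwards [ae_lt_top (hprod hm1) hP] with ω hω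
  have hy : ∀ r : ℝ, HasDerivAt (fun r : ℝ => g (r • (ω : E3))) (fderiv ℝ g (r • (ω : E3)) ω) r := by
    intro r
    have h1 : HasDerivAt (fun r : ℝ => r • (ω : E3)) ω r := by
      simpa using (hasDerivAt_id r).smul_const (ω : E3)
    exact ((hg.differentiable one_ne_zero) _).hasFDerivAt.comp_hasDerivAt r h1
  have hy' : Continuous fun r : ℝ => fderiv ℝ g (r • (ω : E3)) (ω : E3) :=
    (hdc.comp (by fun_prop)).clm_apply continuous_const
  have hray := lintegral_ray_le (p := p) (γ₀ := γ₀) hp hγ hγγ₀ hy hy' (by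
    convert hω.ne using 1
    refine setLIntegral_congr_fun measurableSet_Ioi fun r hr => ?_
    have hr0 : 0 < r := hr
    simp only [hnorm ω hr0]
    rw [← ENNReal.ofReal_mul (by positivity), mul_comm])
  calc ∫⁻ r in Set.Ioi (0 : ℝ), ENNReal.ofReal (r ^ 2) * ENNReal.ofReal ((1 + ‖r • (ω : E3)‖) ^ γ *
          (‖r • (ω : E3)‖⁻¹ * (g (r • (ω : E3)) + fderiv ℝ g (r • (ω : E3)) (r • (ω : E3)))) ^ 2)
      = ∫⁻ r in Set.Ioi (0 : ℝ), ENNReal.ofReal ((1 + r) ^ γ *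
          (g (r • (ω : E3)) + r * fderiv ℝ g (r • (ω : E3)) ω) ^ 2) := by
        refine setLIntegral_congr_fun measurableSet_Ioi fun r hr => ?_
        have hr0 : 0 < r := hr
        simp only [hnorm ω hr0]
        rw [← ENNReal.ofReal_mul (by positivity), map_smul, smul_eq_mul]
        congr 1
        field_simp
    _ ≤ _ := hray
    _ ≤ _ := by
        refine mul_le_mul' le_rfl (setLIntegral_mono' measurableSet_Ioi fun r hr => ?_)
        have hr0 : 0 < r := hr
        simp only [hnorm ω hr0]
        rw [← ENNReal.ofReal_mul (by positivity)]
        refine ENNReal.ofReal_le_ofReal ?_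
        have h1 : |fderiv ℝ g (r • (ω : E3)) ω| ≤ ‖fderiv ℝ g (r • (ω : E3))‖ := by
          simpa using (fderiv ℝ g (r • (ω : E3))).le_opNorm (ω : E3)
        have h2 : fderiv ℝ g (r • (ω : E3)) ω ^ 2 ≤ ‖fderiv ℝ g (r • (ω : E3))‖ ^ 2 := by
          rw [← sq_abs]; gcongr
        have h3 : 0 ≤ (1 + r) ^ γ₀ := Real.rpow_nonneg (by linarith) _
        calc _ = r ^ 2 * ((1 + r) ^ γ₀ * fderiv ℝ g (r • (ω : E3)) ω ^ 2) := by ring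
          _ ≤ _ := by gcongr

lemma sum_sq_apply_single_le (L : E3 →L[ℝ] ℝ) :
    ∑ i, L (EuclideanSpace.single i 1) ^ 2 ≤ ‖L‖ ^ 2 := by
  have h := (EuclideanSpace.basisFun (Fin 3) ℝ).sum_sq_inner_left
    ((InnerProductSpace.toDual ℝ E3).symm L)
  simp only [InnerProductSpace.toDual_symm_apply, EuclideanSpace.basisFun_apply,
    LinearIsometryEquiv.norm_map] at h
  exact h.le

lemma outWeight_half_le {γ r : ℝ} (hγ : 1 < γ) (hr : 0 ≤ r) :
    outWeight γ ((0 + r) / 2) ≤ 2 * (1 + r) ^ γ := by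
  rw [outWeight, posPow_of_nonneg (by linarith)]
  have h1 : ((0 + r) / 2) ^ γ ≤ (1 + r) ^ γ :=
    Real.rpow_le_rpow (by linarith) (by linarith) (by linarith)
  have h3 : 1 ≤ (1 + r) ^ γ := Real.one_le_rpow (by linarith) (by linarith)
  linarith

/-- The energy density on the initial slice in terms of the weighted initial data. -/
lemma energyField_zero_le {p γ γ₀ c : ℝ} (hp : 0 ≤ p) (hγ : 1 < γ) (hγγ₀ : γ < γ₀)
    {Φ : ℝ × E3 → ℝ} (hΦ : ContDiff ℝ 2 Φ) (x : E3) :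
    energyField p γ c Φ (0, x) ≤
      2 * ((1 + ‖x‖) ^ γ *
        (‖x‖⁻¹ * (Φ (0, x) + fderiv ℝ (fun y => Φ (0, y)) x x)) ^ 2) +
      2 * ((1 + ‖x‖) ^ γ₀ * (‖fderiv ℝ (fun y => Φ (0, y)) x‖ ^ 2 + dTime Φ (0, x) ^ 2)) +
      4 * ((1 + ‖x‖) ^ γ₀ * |Φ (0, x)| ^ (p + 1)) := by
  set L := fderiv ℝ (fun y => Φ (0, y)) x with hL
  have hsp : ∀ i, dSpace Φ i (0, x) = L (EuclideanSpace.single i 1) := fun i =>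
    (fderiv_slice_apply (hΦ.of_le one_le_two) _ _ _).symm
  have hsum : ∑ i, x i * dSpace Φ i (0, x) = L x := by
    conv_rhs => rw [← (EuclideanSpace.basisFun (Fin 3) ℝ).sum_repr x]
    simp [hsp]
  have hq := sum_sq_apply_single_le L
  have hh := outWeight_half_le (r := ‖x‖) hγ (norm_nonneg x)
  have hW : outW γ (0, x) = outWeight γ ((0 + ‖x‖) / 2) := rfl
  have hI : inW γ c (0, x) = outWeight γ ((0 + ‖x‖) / 2) := inWeight_zero hγ (norm_nonneg x)
  have hpos : 0 ≤ outWeight γ ((0 + ‖x‖) / 2) := by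
    rw [outWeight]; linarith [posPow_nonneg γ ((0 + ‖x‖) / 2)]
  have hmono : (1 + ‖x‖) ^ γ ≤ (1 + ‖x‖) ^ γ₀ :=
    Real.rpow_le_rpow_of_exponent_le (by linarith [norm_nonneg x]) hγγ₀.le
  have hpot : potential p (Φ (0, x)) ≤ |Φ (0, x)| ^ (p + 1) :=
    div_le_self (Real.rpow_nonneg (abs_nonneg _) _) (by linarith)
  have hpot0 := potential_nonneg hp (Φ (0, x))
  simp only [energyField, energyDensity, hW, hI, hsum]
  simp only [hsp]
  set h := outWeight γ ((0 + ‖x‖) / 2)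
  set q := ∑ i, L (EuclideanSpace.single i 1) ^ 2
  have hq0 : 0 ≤ q := Finset.sum_nonneg fun i _ => sq_nonneg _
  have e1 : h * (‖x‖⁻¹ * (Φ (0, x) + L x)) ^ 2 ≤
      2 * (1 + ‖x‖) ^ γ * (‖x‖⁻¹ * (Φ (0, x) + L x)) ^ 2 := by gcongr
  have hh' : h ≤ 2 * (1 + ‖x‖) ^ γ₀ := by linarith
  have e2 : h * (q + dTime Φ (0, x) ^ 2) ≤
      2 * (1 + ‖x‖) ^ γ₀ * (‖L‖ ^ 2 + dTime Φ (0, x) ^ 2) := by gcongr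
  have e3 : h * potential p (Φ (0, x)) ≤ 2 * (1 + ‖x‖) ^ γ₀ * |Φ (0, x)| ^ (p + 1) := by gcongr
  have e4 : 0 ≤ h * (‖x‖⁻¹ * L x) ^ 2 := by positivity
  nlinarith

/-- The initial energy of the multiplier is controlled by the weighted initial energy. -/
lemma lintegral_energyField_zero_le {p γ γ₀ c : ℝ} (hp : 0 ≤ p) (hγ : 1 < γ) (hγγ₀ : γ < γ₀)
    {Φ : ℝ × E3 → ℝ} (hΦ : ContDiff ℝ 2 Φ)
    (hP : ∫⁻ x : E3, ENNReal.ofReal ((1 + ‖x‖) ^ γ₀ * |Φ (0, x)| ^ (p + 1)) ≠ ⊤) :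
    ∫⁻ x, ENNReal.ofReal (energyField p γ c Φ (0, x)) ≤
      ENNReal.ofReal (2 * (2 * 2 ^ γ + 2 + 2 * 2 ^ γ * (γ₀ - γ)⁻¹) + 4) *
        ((∫⁻ x : E3, ENNReal.ofReal ((1 + ‖x‖) ^ γ₀ *
            (‖fderiv ℝ (fun y => Φ (0, y)) x‖ ^ 2 + dTime Φ (0, x) ^ 2))) +
          ∫⁻ x : E3, ENNReal.ofReal ((1 + ‖x‖) ^ γ₀ * |Φ (0, x)| ^ (p + 1))) := by
  have hg : ContDiff ℝ 2 fun y : E3 => Φ (0, y) := hΦ.comp (by fun_prop)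
  have hhardy := lintegral_radial_hardy hp (by linarith : 0 ≤ γ) hγγ₀ (hg.of_le one_le_two) hP
  set M := 2 * 2 ^ γ + 2 + 2 * 2 ^ γ * (γ₀ - γ)⁻¹ with hM
  have hM0 : 0 ≤ M := by
    have : 0 < γ₀ - γ := by linarith
    positivity
  have hgm := hg.continuous.measurable
  have hdm : Continuous fun x => fderiv ℝ (fun y => Φ (0, y)) x :=
    hg.continuous_fderiv two_ne_zero
  have hdnm := hdm.norm.measurable
  have htm : Measurable fun x : E3 => dTime Φ (0, x) :=
    ((contDiff_dTime hΦ).continuous.comp (by fun_prop)).measurable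
  set A := ∫⁻ x : E3, ENNReal.ofReal ((1 + ‖x‖) ^ γ₀ *
    (‖fderiv ℝ (fun y => Φ (0, y)) x‖ ^ 2 + dTime Φ (0, x) ^ 2)) with hA
  set P := ∫⁻ x : E3, ENNReal.ofReal ((1 + ‖x‖) ^ γ₀ * |Φ (0, x)| ^ (p + 1)) with hPdef
  have hPm : Measurable fun x : E3 => ENNReal.ofReal ((1 + ‖x‖) ^ γ₀ * |Φ (0, x)| ^ (p + 1)) :=
    (((measurable_norm.const_add 1).pow_const γ₀).mul
      ((continuous_abs.measurable.comp hgm).pow_const (p + 1))).ennreal_ofReal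
  have hbase : ∀ x : E3, 0 ≤ 1 + ‖x‖ := fun x => by positivity
  have hle : ∫⁻ x : E3, ENNReal.ofReal ((1 + ‖x‖) ^ γ₀ * ‖fderiv ℝ (fun y => Φ (0, y)) x‖ ^ 2)
      ≤ A := by
    refine lintegral_mono fun x => ENNReal.ofReal_le_ofReal ?_
    have := Real.rpow_nonneg (hbase x) γ₀
    gcongr
    exact le_add_of_nonneg_right (sq_nonneg _)
  calc ∫⁻ x, ENNReal.ofReal (energyField p γ c Φ (0, x))
      ≤ ∫⁻ x : E3, (ENNReal.ofReal 2 * ENNReal.ofReal ((1 + ‖x‖) ^ γ *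
            (‖x‖⁻¹ * (Φ (0, x) + fderiv ℝ (fun y => Φ (0, y)) x x)) ^ 2) +
          ENNReal.ofReal 2 * ENNReal.ofReal ((1 + ‖x‖) ^ γ₀ *
            (‖fderiv ℝ (fun y => Φ (0, y)) x‖ ^ 2 + dTime Φ (0, x) ^ 2)) +
          ENNReal.ofReal 4 * ENNReal.ofReal ((1 + ‖x‖) ^ γ₀ * |Φ (0, x)| ^ (p + 1))) := by
        refine lintegral_mono fun x => ?_
        have := Real.rpow_nonneg (hbase x) γ₀
        have := Real.rpow_nonneg (hbase x) γ
        rw [← ENNReal.ofReal_mul (by norm_num), ← ENNReal.ofReal_mul (by norm_num),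
          ← ENNReal.ofReal_mul (by norm_num), ← ENNReal.ofReal_add (by positivity) (by positivity),
          ← ENNReal.ofReal_add (by positivity) (by positivity)]
        exact ENNReal.ofReal_le_ofReal (energyField_zero_le hp hγ hγγ₀ hΦ x)
    _ ≤ ENNReal.ofReal 2 * (ENNReal.ofReal M * A) + ENNReal.ofReal 2 * A +
          ENNReal.ofReal 4 * P := by
        rw [lintegral_add_right _ (hPm.const_mul _), lintegral_add_right _ (by fun_prop),
          lintegral_const_mul' _ _ ENNReal.ofReal_ne_top,
          lintegral_const_mul' _ _ ENNReal.ofReal_ne_top,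
          lintegral_const_mul' _ _ ENNReal.ofReal_ne_top]
        gcongr
        exact hhardy.trans (by gcongr)
    _ = ENNReal.ofReal (2 * M + 2) * A + ENNReal.ofReal 4 * P := by
        rw [← mul_assoc, ← ENNReal.ofReal_mul (by norm_num),
          ENNReal.ofReal_add (by positivity) (by norm_num), add_mul]
    _ ≤ _ := by
        rw [mul_add (ENNReal.ofReal _)]
        refine add_le_add (mul_le_mul' (ENNReal.ofReal_le_ofReal ?_) le_rfl)
          (mul_le_mul' (ENNReal.ofReal_le_ofReal ?_) le_rfl) <;> linarith

/-- The flux density without its cutoffs. -/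
def coneFlux (p γ c : ℝ) (Φ : ℝ × E3 → ℝ) (t₀ : ℝ) (x₀ : E3) (z : ℝ × E3) : ℝ :=
  potential p (Φ z) * (outW γ z * (t₀ - z.1 + ‖z.2‖⁻¹ * ⟪z.2, z.2 - x₀⟫_ℝ) +
    inW γ c z * (t₀ - z.1 - ‖z.2‖⁻¹ * ⟪z.2, z.2 - x₀⟫_ℝ))

/-- Concentration of the derivative of the cone cutoff on the cone. -/
lemma ofReal_div_le_liminf {k : ℝ → ℝ} {t₀ ρ : ℝ} (hρ : 0 < ρ) (hρt : ρ < t₀)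
    (hk : ContinuousAt k (t₀ - ρ)) :
    ENNReal.ofReal (k (t₀ - ρ) / ρ) ≤ Filter.liminf (fun n : ℕ => ∫⁻ t in Set.Ioo 0 t₀,
      ENNReal.ofReal (stepDeriv (n * ((t₀ - t) ^ 2 - ρ ^ 2)) * (2 * n) * k t)) Filter.atTop := by
  refine le_of_forall_lt fun b hb => ?_
  have hbt : b ≠ ⊤ := ne_top_of_lt hb
  lift b to NNReal using hbt
  obtain ⟨c, hbc, hcJ⟩ : ∃ c : ℝ, (b : ℝ) < c ∧ c < k (t₀ - ρ) / ρ := by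
    refine exists_between ?_
    rw [← ENNReal.ofReal_coe_nnreal] at hb
    exact (ENNReal.ofReal_lt_ofReal_iff_of_nonneg b.2).1 hb
  have hc0 : 0 ≤ c := b.2.trans hbc.le
  have hev : ∀ᶠ t in nhds (t₀ - ρ), c * (t₀ - t) < k t := by
    have h1 : ContinuousAt (fun t => k t - c * (t₀ - t)) (t₀ - ρ) :=
      hk.sub (by fun_prop)
    have h2 : 0 < k (t₀ - ρ) - c * (t₀ - (t₀ - ρ)) := by
      rw [lt_div_iff₀ hρ] at hcJ
      rw [sub_sub_cancel]; linarith
    filter_upwards [h1.eventually (lt_mem_nhds h2)] with t ht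
    linarith
  obtain ⟨η, hη, hball⟩ := Metric.eventually_nhds_iff.1 hev
  set δ := min (η / 2) (t₀ - ρ) with hδdef
  have hδ : 0 < δ := lt_min (by linarith) (by linarith)
  have hδη : δ < η := (min_le_left _ _).trans_lt (by linarith)
  have hδt : δ ≤ t₀ - ρ := min_le_right _ _
  have hlarge : ∀ᶠ n : ℕ in Filter.atTop, 1 ≤ (n : ℝ) * ((ρ + δ) ^ 2 - ρ ^ 2) := by
    have : 0 < (ρ + δ) ^ 2 - ρ ^ 2 := by nlinarith
    exact (tendsto_natCast_atTop_atTop.atTop_mul_const this).eventually_ge_atTop 1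
  refine lt_of_lt_of_le (b := ENNReal.ofReal c) ?_ (Filter.le_liminf_of_le (by isBoundedDefault) ?_)
  · rw [← ENNReal.ofReal_coe_nnreal]
    exact (ENNReal.ofReal_lt_ofReal_iff_of_nonneg b.2).2 hbc
  filter_upwards [hlarge] with n hn
  have hcont : Continuous fun t : ℝ =>
      c * (stepDeriv (n * ((t₀ - t) ^ 2 - ρ ^ 2)) * (n * (2 * (t₀ - t)))) := by
    have := continuous_stepDeriv
    fun_prop
  have hval : ∫ t in (t₀ - ρ - δ)..(t₀ - ρ),
      c * (stepDeriv (n * ((t₀ - t) ^ 2 - ρ ^ 2)) * (n * (2 * (t₀ - t)))) = c := by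
    have hd : ∀ t ∈ Set.uIcc (t₀ - ρ - δ) (t₀ - ρ),
        HasDerivAt (fun t => -smoothTransition (n * ((t₀ - t) ^ 2 - ρ ^ 2)))
          (stepDeriv (n * ((t₀ - t) ^ 2 - ρ ^ 2)) * (n * (2 * (t₀ - t)))) t := by
      intro t _
      have h1 : HasDerivAt (fun t : ℝ => n * ((t₀ - t) ^ 2 - ρ ^ 2)) (-(n * (2 * (t₀ - t)))) t := by
        refine ((((hasDerivAt_id t).const_sub t₀).pow 2).sub_const _ |>.const_mul _).congr_deriv ?_
        simp
      exact ((hasDerivAt_smoothTransition _).comp t h1).neg.congr_deriv (by ring)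
    rw [intervalIntegral.integral_const_mul, intervalIntegral.integral_eq_sub_of_hasDerivAt hd
      (Continuous.intervalIntegrable (by have := continuous_stepDeriv; fun_prop) _ _)]
    have e1 : t₀ - (t₀ - ρ - δ) = ρ + δ := by ring
    have e2 : t₀ - (t₀ - ρ) = ρ := by ring
    rw [e1, e2, smoothTransition.one_of_one_le hn, sub_self, mul_zero, smoothTransition.zero]
    ring
  have hdom : ∀ t ∈ Set.Ioc (t₀ - ρ - δ) (t₀ - ρ),
      0 ≤ stepDeriv (n * ((t₀ - t) ^ 2 - ρ ^ 2)) * (2 * n) ∧ 0 < t₀ - t ∧ c * (t₀ - t) ≤ k t := by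
    intro t ht
    refine ⟨mul_nonneg (stepDeriv_nonneg _) (by positivity), by linarith [ht.2], (hball ?_).le⟩
    rw [Real.dist_eq, abs_lt]
    exact ⟨by linarith [ht.1], by linarith [ht.2]⟩
  calc ENNReal.ofReal c = ∫⁻ t in Set.Ioc (t₀ - ρ - δ) (t₀ - ρ), ENNReal.ofReal
        (c * (stepDeriv (n * ((t₀ - t) ^ 2 - ρ ^ 2)) * (n * (2 * (t₀ - t))))) := by
        rw [← ofReal_integral_eq_lintegral_ofReal]
        · rw [← intervalIntegral.integral_of_le (by linarith), hval]
        · exact (hcont.integrableOn_Icc).mono_set Set.Ioc_subset_Icc_self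
        · refine (ae_restrict_mem measurableSet_Ioc).mono fun t ht => ?_
          obtain ⟨h1, h2, -⟩ := hdom t ht
          have h3 := mul_nonneg hc0 (mul_nonneg h1 h2.le)
          simp only [Pi.zero_apply]
          linarith
    _ ≤ ∫⁻ t in Set.Ioc (t₀ - ρ - δ) (t₀ - ρ),
          ENNReal.ofReal (stepDeriv (n * ((t₀ - t) ^ 2 - ρ ^ 2)) * (2 * n) * k t) := by
        refine setLIntegral_mono' measurableSet_Ioc fun t ht => ENNReal.ofReal_le_ofReal ?_
        obtain ⟨h1, -, h3⟩ := hdom t ht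
        calc _ = stepDeriv (n * ((t₀ - t) ^ 2 - ρ ^ 2)) * (2 * n) * (c * (t₀ - t)) := by ring
          _ ≤ _ := by gcongr
    _ ≤ _ := by
        refine lintegral_mono_set ?_
        rintro t ⟨h1, h2⟩
        exact ⟨by linarith, by linarith⟩

lemma measurable_coneFlux {p γ c : ℝ} (hp : 1 < p) (hγ : 1 < γ) {Φ : ℝ × E3 → ℝ}
    (hΦ : Continuous Φ) (t₀ : ℝ) (x₀ : E3) : Measurable (coneFlux p γ c Φ t₀ x₀) := by
  have h1 := ((contDiff_potential hp).continuous.comp hΦ).measurable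
  have h2 := (continuous_outW hγ).measurable
  have h3 := (continuous_inW c hγ).measurable
  have h4 : Measurable fun z : ℝ × E3 => ⟪z.2, z.2 - x₀⟫_ℝ :=
    Continuous.measurable (by fun_prop)
  exact h1.mul ((h2.mul (by fun_prop)).add (h3.mul (by fun_prop)))

lemma measurable_fluxDensity {p γ c : ℝ} (hp : 1 < p) (hγ : 1 < γ) {Φ : ℝ × E3 → ℝ}
    (hΦ : Continuous Φ) (N ε t₀ : ℝ) (x₀ : E3) : Measurable (fluxDensity p γ c Φ N ε t₀ x₀) := by
  have h1 := (contDiff_axisCut ε).continuous.measurable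
  have h2 : Measurable fun z : ℝ × E3 =>
      stepDeriv (N * ((t₀ - z.1) ^ 2 - ‖z.2 - x₀‖ ^ 2)) * (2 * N) :=
    Continuous.measurable (by have := continuous_stepDeriv; fun_prop)
  exact h1.mul (h2.mul (measurable_coneFlux hp hγ hΦ t₀ x₀))

lemma continuous_coneFlux_line {p γ c : ℝ} (hp : 1 < p) (hγ : 1 < γ) {Φ : ℝ × E3 → ℝ}
    (hΦ : Continuous Φ) (t₀ : ℝ) (x₀ x : E3) :
    Continuous fun t => coneFlux p γ c Φ t₀ x₀ (t, x) := by
  have h1 : Continuous fun t => potential p (Φ (t, x)) :=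
    (contDiff_potential hp).continuous.comp (hΦ.comp (by fun_prop))
  have h2 : Continuous fun t => outW γ (t, x) := (continuous_outW hγ).comp (by fun_prop)
  have h3 : Continuous fun t => inW γ c (t, x) := (continuous_inW c hγ).comp (by fun_prop)
  simp only [coneFlux]
  generalize ‖x‖⁻¹ * ⟪x, x - x₀⟫_ℝ = m
  fun_prop

/-- The truncated fluxes recover the flux through the cone. -/
lemma ofReal_coneFlux_le_liminf {p γ c : ℝ} (hp : 1 < p) (hγ : 1 < γ) {Φ : ℝ × E3 → ℝ}
    (hΦ : Continuous Φ) {t₀ : ℝ} {x₀ x : E3} (hx : x ≠ 0) (hxx₀ : x ≠ x₀)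
    (hxt : ‖x - x₀‖ < t₀) :
    ENNReal.ofReal (coneFlux p γ c Φ t₀ x₀ (t₀ - ‖x - x₀‖, x) / ‖x - x₀‖) ≤
      Filter.liminf (fun n : ℕ => ∫⁻ t in Set.Ioo 0 t₀,
        ENNReal.ofReal (fluxDensity p γ c Φ n ((n : ℝ) + 2)⁻¹ t₀ x₀ (t, x))) Filter.atTop := by
  refine (ofReal_div_le_liminf (k := fun t => coneFlux p γ c Φ t₀ x₀ (t, x))
    (norm_pos_iff.2 (sub_ne_zero.2 hxx₀)) hxt
    (continuous_coneFlux_line hp hγ hΦ t₀ x₀ x).continuousAt).trans_eq ?_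
  refine Filter.liminf_congr ?_
  have hx0 : 0 < ‖x‖ ^ 2 := by positivity
  have hlarge : ∀ᶠ n : ℕ in Filter.atTop, 2 ≤ (n : ℝ) * ‖x‖ ^ 2 :=
    (tendsto_natCast_atTop_atTop.atTop_mul_const hx0).eventually_ge_atTop 2
  filter_upwards [hlarge] with n hn
  refine lintegral_congr fun t => ?_
  have hcut : axisCut ((n : ℝ) + 2)⁻¹ (t, x) = 1 := by
    refine smoothTransition.one_of_one_le ?_
    rw [inv_pow, div_inv_eq_mul]
    have hn0 : (0 : ℝ) ≤ n := n.cast_nonneg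
    simp only
    nlinarith [mul_nonneg hn0 hx0.le, mul_nonneg (mul_nonneg hn0 hx0.le) hn0]
  rw [fluxDensity, hcut, one_mul]
  rfl

/-- Flux bound for the multiplier through the backward cone. -/
lemma lintegral_coneFlux_le {p γ γ₀ c : ℝ} (hp : 2 < p) (hγ : 1 < γ) (hγγ₀ : γ < γ₀)
    (hγ₀2 : γ₀ ≤ 2) (hγ₀p : γ₀ ≤ p - 1) (hc : c = (γ₀ - γ) / (γ₀ + γ)) {Φ : ℝ × E3 → ℝ}
    (hΦ : ContDiff ℝ 2 Φ)
    (heq : ∀ z : ℝ × E3, 0 ≤ z.1 → fderiv ℝ (dTime Φ) z timeDir -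
      ∑ i, fderiv ℝ (dSpace Φ i) z (spaceDir i) + |Φ z| ^ (p - 1) * Φ z = 0)
    {t₀ : ℝ} (ht₀ : 0 ≤ t₀) (x₀ : E3) :
    ∫⁻ x in Metric.ball x₀ t₀,
        ENNReal.ofReal (coneFlux p γ c Φ t₀ x₀ (t₀ - ‖x - x₀‖, x) / ‖x - x₀‖) ≤
      ∫⁻ x, ENNReal.ofReal (energyField p γ c Φ (0, x)) := by
  obtain ⟨C, hC, hbound⟩ := lintegral_fluxDensity_le hp hγ hγγ₀ hγ₀2 hγ₀p hc hΦ heq ht₀ x₀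
  have hp1 : 1 < p := by linarith
  have hmeas : ∀ n : ℕ, Measurable fun z =>
      ENNReal.ofReal (fluxDensity p γ c Φ n ((n : ℝ) + 2)⁻¹ t₀ x₀ z) := fun n =>
    (measurable_fluxDensity hp1 hγ hΦ.continuous _ _ _ _).ennreal_ofReal
  have hne : ∀ y : E3, ∀ᵐ x : E3, x ≠ y := fun y => by
    rw [ae_iff]; simp
  calc ∫⁻ x in Metric.ball x₀ t₀,
        ENNReal.ofReal (coneFlux p γ c Φ t₀ x₀ (t₀ - ‖x - x₀‖, x) / ‖x - x₀‖)
      ≤ ∫⁻ x in Metric.ball x₀ t₀, Filter.liminf (fun n : ℕ => ∫⁻ t in Set.Ioo 0 t₀,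
          ENNReal.ofReal (fluxDensity p γ c Φ n ((n : ℝ) + 2)⁻¹ t₀ x₀ (t, x))) Filter.atTop := by
        refine setLIntegral_mono_ae' measurableSet_ball ?_
        filter_upwards [hne 0, hne x₀] with x h1 h2 h3
        exact ofReal_coneFlux_le_liminf hp1 hγ hΦ.continuous h1 h2 (mem_ball_iff_norm.1 h3)
    _ ≤ ∫⁻ x, Filter.liminf (fun n : ℕ => ∫⁻ t in Set.Ioo 0 t₀,
          ENNReal.ofReal (fluxDensity p γ c Φ n ((n : ℝ) + 2)⁻¹ t₀ x₀ (t, x))) Filter.atTop :=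
        setLIntegral_le_lintegral _ _
    _ ≤ Filter.liminf (fun n : ℕ => ∫⁻ x, ∫⁻ t in Set.Ioo 0 t₀,
          ENNReal.ofReal (fluxDensity p γ c Φ n ((n : ℝ) + 2)⁻¹ t₀ x₀ (t, x))) Filter.atTop :=
        lintegral_liminf_le fun n => (hmeas n).lintegral_prod_left'
    _ ≤ Filter.liminf (fun n : ℕ => (∫⁻ x, ENNReal.ofReal (energyField p γ c Φ (0, x))) +
          ENNReal.ofReal (C * ((n : ℝ) + 2)⁻¹)) Filter.atTop := by
        refine Filter.liminf_le_liminf (Filter.Eventually.of_forall fun n => ?_)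
        have hn0 : (0 : ℝ) ≤ n := n.cast_nonneg
        have h := hbound n ((n : ℝ) + 2)⁻¹ hn0 (by positivity) (by
          rw [one_div]; exact inv_anti₀ two_pos (by linarith))
        rw [lintegral_prod_symm _ (hmeas n).aemeasurable] at h
        exact h.trans (add_le_add (setLIntegral_le_lintegral _ _) le_rfl)
    _ = _ := by
        refine Filter.Tendsto.liminf_eq ?_
        have h1 : Filter.Tendsto (fun n : ℕ => C * ((n : ℝ) + 2)⁻¹) Filter.atTop (nhds 0) := by
          have := (tendsto_inv_atTop_zero.comp (Filter.tendsto_atTop_add_const_right _ (2 : ℝ)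
            (tendsto_natCast_atTop_atTop (R := ℝ)))).const_mul C
          simpa using this
        have h2 := ENNReal.tendsto_ofReal h1
        rw [ENNReal.ofReal_zero] at h2
        simpa using tendsto_const_nhds.add h2

lemma deriv_time_eq {H : ℝ × E3 → ℝ} (hH : ContDiff ℝ 1 H) (t : ℝ) (x : E3) :
    deriv (fun s => H (s, x)) t = fderiv ℝ H (t, x) timeDir := by
  have h1 : HasDerivAt (fun s : ℝ => (s, x)) timeDir t :=
    (hasDerivAt_id t).prodMk (hasDerivAt_const t x)
  exact ((hH.differentiable one_ne_zero (t, x)).hasFDerivAt.comp_hasDerivAt t h1).deriv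

/-- A solution of the wave equation, in the notation of directional derivatives. -/
lemma IsNLWSolution.equation {p : ℝ} {φ : ℝ → E3 → ℝ} (h : IsNLWSolution p φ) (z : ℝ × E3)
    (hz : 0 ≤ z.1) : fderiv ℝ (dTime fun q => φ q.1 q.2) z timeDir -
      ∑ i, fderiv ℝ (dSpace (fun q => φ q.1 q.2) i) z (spaceDir i) +
      |φ z.1 z.2| ^ (p - 1) * φ z.1 z.2 = 0 := by
  obtain ⟨t, x⟩ := z
  have hΦ : ContDiff ℝ 2 fun q : ℝ × E3 => φ q.1 q.2 := contDiff_infty.1 h.1 2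
  have hdtt : dtt φ t x = fderiv ℝ (dTime fun q => φ q.1 q.2) (t, x) timeDir := by
    rw [← deriv_time_eq (contDiff_dTime hΦ) t x]
    exact congrArg (fun f => deriv f t)
      (funext fun s => deriv_time_eq (hΦ.of_le one_le_two) s x)
  have hlap : lap3 (φ t) x =
      ∑ i, fderiv ℝ (dSpace (fun q => φ q.1 q.2) i) (t, x) (spaceDir i) := by
    refine Finset.sum_congr rfl fun i _ => ?_
    have h1 : (fun y => fderiv ℝ (φ t) y (EuclideanSpace.single i 1)) =
        fun y => dSpace (fun q => φ q.1 q.2) i (t, y) := by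
      ext y
      exact fderiv_slice_apply (hΦ.of_le one_le_two) t y _
    rw [der2, h1]
    exact fderiv_slice_apply (contDiff_dSpace hΦ i) t x _
  have := h.2 t hz x
  rwa [hdtt, hlap] at this

lemma wEnergy_zero_eq {p γ₀ : ℝ} {φ : ℝ → E3 → ℝ}
    (hΦ : ContDiff ℝ 1 fun q : ℝ × E3 => φ q.1 q.2) :
    wEnergy p 0 γ₀ φ = (∫⁻ x : E3, ENNReal.ofReal ((1 + ‖x‖) ^ γ₀ *
        (‖fderiv ℝ (φ 0) x‖ ^ 2 + dTime (fun q => φ q.1 q.2) (0, x) ^ 2))) +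
      ∫⁻ x : E3, ENNReal.ofReal ((1 + ‖x‖) ^ γ₀ * |φ 0 x| ^ (p + 1)) := by
  have hdt : ∀ x, dt1 φ 0 x = dTime (fun q => φ q.1 q.2) (0, x) := deriv_time_eq hΦ 0
  simp [wEnergy, norm_iteratedFDeriv_one, hdt]

/-- The integrand of the flux estimate in terms of the multiplier flux. -/
lemma flux_integrand_le {p γ c : ℝ} (hp : 0 ≤ p) (hγ : 1 < γ) (hγ2 : γ ≤ 2) (hc : 0 < c)
    (hc1 : c ≤ 1) (Φ : ℝ × E3 → ℝ) {t₀ ρ : ℝ} (hρ : 0 < ρ) (hρt : ρ ≤ t₀) (x₀ : E3)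
    (ω : Metric.sphere (0 : E3) 1) :
    ((1 + ⟪x₀ + ρ • (ω : E3), (ω : E3)⟫_ℝ / ‖x₀ + ρ • (ω : E3)‖)
        * vplus (t₀ - ρ) ‖x₀ + ρ • (ω : E3)‖ ^ γ + uplus (t₀ - ρ) ‖x₀ + ρ • (ω : E3)‖ ^ γ)
      * |Φ (t₀ - ρ, x₀ + ρ • (ω : E3))| ^ (p + 1) * ρ ^ 2 ≤
    (1 + (2 * c)⁻¹) * (p + 1) *
      (ρ ^ 2 * (coneFlux p γ c Φ t₀ x₀ (t₀ - ρ, x₀ + ρ • (ω : E3)) / ρ)) := by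
  set x := x₀ + ρ • (ω : E3) with hx
  have hsub : x - x₀ = ρ • (ω : E3) := by rw [hx, add_sub_cancel_left]
  have hτ : |⟪x, (ω : E3)⟫_ℝ / ‖x‖| ≤ 1 := by
    have := abs_radial_inner_le x (ω : E3)
    rwa [norm_eq_of_mem_sphere, inv_mul_eq_div] at this
  have hflux : coneFlux p γ c Φ t₀ x₀ (t₀ - ρ, x) / ρ = potential p (Φ (t₀ - ρ, x)) *
      (outWeight γ ((t₀ - ρ + ‖x‖) / 2) * (1 + ⟪x, (ω : E3)⟫_ℝ / ‖x‖) +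
        inWeight γ c ((t₀ - ρ - ‖x‖) / 2) * (1 - ⟪x, (ω : E3)⟫_ℝ / ‖x‖)) := by
    simp only [coneFlux, outW, inW, hsub, inner_smul_right]
    rw [div_eq_iff hρ.ne']
    ring
  have hw := flux_weight_le (r := ‖x‖) hγ hγ2 hc hc1 (by linarith : 0 ≤ t₀ - ρ)
    (norm_nonneg x) hτ
  have hpot : |Φ (t₀ - ρ, x)| ^ (p + 1) = (p + 1) * potential p (Φ (t₀ - ρ, x)) := by
    rw [potential, mul_div_cancel₀ _ (by linarith : p + 1 ≠ 0)]
  have hpn := potential_nonneg hp (Φ (t₀ - ρ, x))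
  rw [hflux, hpot]
  have h := mul_le_mul_of_nonneg_right hw
    (by positivity : 0 ≤ (p + 1) * potential p (Φ (t₀ - ρ, x)) * ρ ^ 2)
  linarith

/-- Uniform weighted energy flux bound through backward light cones:
for `2 < p < 5` and `1 < γ < γ₀ < min{2, p−1}`, there is `C > 0` independent of the
vertex `q = (t₀, x₀)` with
`∫₀^{t₀} ∫_{S²} ((1+τ)v₊^γ + u₊^γ)|φ|^{p+1} r̃² dσ dr̃ ≤ C ⬝ E_{0,γ₀}[φ]`. -/
theorem nlw_cone_flux_bound (p γ γ₀ : ℝ) (hp2 : 2 < p) (hp5 : p < 5)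
    (hγ : 1 < γ) (hγγ₀ : γ < γ₀) (hγ₀ : γ₀ < min 2 (p - 1)) :
    ∃ C : ℝ, 0 < C ∧ ∀ φ : ℝ → E3 → ℝ, IsNLWSolution p φ → wEnergy p 0 γ₀ φ < ⊤ →
      ∀ t₀ : ℝ, 0 ≤ t₀ → ∀ x₀ : E3,
        (∫⁻ r' in Set.Ioc (0 : ℝ) t₀, ∫⁻ ω : Metric.sphere (0 : E3) 1,
          ENNReal.ofReal
            (((1 + ⟪x₀ + r' • (ω : E3), (ω : E3)⟫_ℝ / ‖x₀ + r' • (ω : E3)‖)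
                * vplus (t₀ - r') ‖x₀ + r' • (ω : E3)‖ ^ γ
              + uplus (t₀ - r') ‖x₀ + r' • (ω : E3)‖ ^ γ)
              * |φ (t₀ - r') (x₀ + r' • (ω : E3))| ^ (p + 1) * r' ^ 2) ∂sphereMeasure)
          ≤ ENNReal.ofReal C * wEnergy p 0 γ₀ φ := by
  have hγ₀2 : γ₀ ≤ 2 := (hγ₀.trans_le (min_le_left _ _)).le
  have hγ₀p : γ₀ ≤ p - 1 := (hγ₀.trans_le (min_le_right _ _)).le
  have hp0 : 0 ≤ p := by linarith
  have hgap : 0 < γ₀ - γ := by linarith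
  set c := (γ₀ - γ) / (γ₀ + γ) with hc
  have hc0 : 0 < c := div_pos hgap (by linarith)
  have hc1 : c ≤ 1 := (div_le_one (by linarith)).2 (by linarith)
  set K := (1 + (2 * c)⁻¹) * (p + 1) with hK
  have hK0 : 0 < K := by positivity
  set M := 2 * (2 * 2 ^ γ + 2 + 2 * 2 ^ γ * (γ₀ - γ)⁻¹) + 4 with hM
  have hM0 : 0 < M := by positivity
  refine ⟨K * M, mul_pos hK0 hM0, fun φ hφ hE t₀ ht₀ x₀ => ?_⟩
  have hΦ : ContDiff ℝ 2 fun q : ℝ × E3 => φ q.1 q.2 := contDiff_infty.1 hφ.1 2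
  set Φ : ℝ × E3 → ℝ := fun q => φ q.1 q.2 with hΦdef
  have hWE := wEnergy_zero_eq (p := p) (γ₀ := γ₀) (hΦ.of_le one_le_two)
  have hP : ∫⁻ x : E3, ENNReal.ofReal ((1 + ‖x‖) ^ γ₀ * |Φ (0, x)| ^ (p + 1)) ≠ ⊤ :=
    ((le_add_self.trans_eq hWE.symm).trans_lt hE).ne
  have hdata := lintegral_energyField_zero_le (c := c) hp0 hγ hγγ₀ hΦ hP
  have hcone := lintegral_coneFlux_le hp2 hγ hγγ₀ hγ₀2 hγ₀p hc hΦ hφ.equation ht₀ x₀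
  set F : E3 → ℝ := fun x => coneFlux p γ c Φ t₀ x₀ (t₀ - ‖x - x₀‖, x) / ‖x - x₀‖ with hF
  have hFm : Measurable ((Metric.ball x₀ t₀).indicator fun x => ENNReal.ofReal (F x)) := by
    refine Measurable.indicator (Measurable.ennreal_ofReal (Measurable.div ?_ (by fun_prop)))
      measurableSet_ball
    exact (measurable_coneFlux (by linarith) hγ hΦ.continuous t₀ x₀).comp (by fun_prop)
  rw [← lintegral_indicator measurableSet_ball, lintegral_polar_swap hFm x₀] at hcone
  rw [setLIntegral_congr Ioo_ae_eq_Ioc.symm]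
  calc _ ≤ ∫⁻ r in Set.Ioo (0 : ℝ) t₀, ∫⁻ ω : Metric.sphere (0 : E3) 1, ENNReal.ofReal K *
          (ENNReal.ofReal (r ^ 2) * (Metric.ball x₀ t₀).indicator
            (fun x => ENNReal.ofReal (F x)) (x₀ + r • (ω : E3))) ∂sphereMeasure := by
        refine setLIntegral_mono' measurableSet_Ioo fun r hr => lintegral_mono fun ω => ?_
        have hn : ‖x₀ + r • (ω : E3) - x₀‖ = r := by
          rw [add_sub_cancel_left, norm_smul, Real.norm_of_nonneg hr.1.le, norm_eq_of_mem_sphere,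
            mul_one]
        have hmem : x₀ + r • (ω : E3) ∈ Metric.ball x₀ t₀ := by
          rw [mem_ball_iff_norm, hn]; exact hr.2
        rw [Set.indicator_of_mem hmem, ← ENNReal.ofReal_mul (sq_nonneg r),
          ← ENNReal.ofReal_mul hK0.le]
        refine ENNReal.ofReal_le_ofReal ?_
        simp only [hF, hn]
        exact flux_integrand_le hp0 hγ (by linarith) hc0 hc1 Φ hr.1 hr.2.le x₀ ω
    _ = ENNReal.ofReal K * ∫⁻ r in Set.Ioo (0 : ℝ) t₀, ∫⁻ ω : Metric.sphere (0 : E3) 1,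
          ENNReal.ofReal (r ^ 2) * (Metric.ball x₀ t₀).indicator
            (fun x => ENNReal.ofReal (F x)) (x₀ + r • (ω : E3)) ∂sphereMeasure := by
        simp only [lintegral_const_mul' _ _ ENNReal.ofReal_ne_top]
    _ ≤ ENNReal.ofReal K * (ENNReal.ofReal M * wEnergy p 0 γ₀ φ) := by
        refine mul_le_mul' le_rfl ?_
        refine (lintegral_mono_set Set.Ioo_subset_Ioi_self).trans (hcone.trans (hdata.trans_eq ?_))
        rw [hWE]
    _ = _ := by rw [← mul_assoc, ← ENNReal.ofReal_mul hK0.le]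
end
end

section
/- Let 1 < γ < 2, let α, β ≥ 0 satisfy β + αγ > 2, and let ε > 0. There is a constant C > 0, depending only on ε, γ, α and β, with the following property: for every x₀ ∈ ℝ³ with r₀ = |x₀|, every t₀ ≥ 0 with t₀ + 2 ≤ r₀, and every r̃ with 0 ≤ r̃ ≤ t₀, one has ∫_{S²} ((1+τ) r^γ + (r₀−t₀)^γ)^{−α} r^{−β} dσ(ω̃) ≤ C (r₀−r̃)^{2−β−γ+ε} r₀^{−2} ( (r₀−r̃)^{(1−α)γ} + (r₀−t₀)^{(1−α)γ} ), where for each ω̃ ∈ S² one sets r = |x₀ + r̃ω̃| and τ = ((x₀+r̃ω̃)·ω̃)/r. -/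
open MeasureTheory Real
open scoped ENNReal InnerProductSpace

noncomputable section

open scoped Pointwise in
/-- A spherical cap of height `h` has surface measure at most a multiple of `h`. -/
lemma sphereMeasure_cap_le {e : E3} (he : ‖e‖ = 1) {h : ℝ} (hh : 0 ≤ h) :
    sphereMeasure {ω | 1 + ⟪e, (ω : E3)⟫_ℝ ≤ h} ≤ 48 * ENNReal.ofReal h := by
  obtain ⟨b, hb⟩ : ∃ b : OrthonormalBasis (Fin 3) ℝ E3, b 0 = e := by
    obtain ⟨b, hb⟩ := Orthonormal.exists_orthonormalBasis_extension_of_card_eq (𝕜 := ℝ) (E := E3)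
      (ι := Fin 3) (by simp) (v := fun _ => e) (s := {0})
      ⟨fun i => by simpa using he, fun i j hij => (hij (Subsingleton.elim i j)).elim⟩
    exact ⟨b, hb 0 rfl⟩
  have hmeas : MeasurableSet
      {ω : Metric.sphere (0 : E3) 1 | 1 + ⟪e, (ω : E3)⟫_ℝ ≤ h} :=
    measurableSet_le (by fun_prop) (by fun_prop)
  let m : Fin 3 → ℝ := ![1, √(2 * h), √(2 * h)]
  have hsub : Set.Ioo (0 : ℝ) 1 •
      (Subtype.val '' {ω : Metric.sphere (0 : E3) 1 | 1 + ⟪e, (ω : E3)⟫_ℝ ≤ h}) ⊆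
      b.repr ⁻¹' (WithLp.ofLp ⁻¹' Set.Icc (-m) m) := by
    rintro _ ⟨t, ⟨ht0, ht1⟩, _, ⟨ω, hω, rfl⟩, rfl⟩
    have hsum : (b.repr (ω : E3)) 0 ^ 2 + (b.repr (ω : E3)) 1 ^ 2 + (b.repr (ω : E3)) 2 ^ 2 = 1 := by
      have h1 : ‖b.repr (ω : E3)‖ ^ 2 = 1 := by simp
      rw [EuclideanSpace.real_norm_sq_eq, Fin.sum_univ_three] at h1
      exact h1
    have h0 : (b.repr (ω : E3)) 0 = ⟪e, (ω : E3)⟫_ℝ := by rw [b.repr_apply_apply, hb]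
    rw [Set.mem_ofPred_eq, ← h0] at hω
    set y := b.repr (ω : E3)
    have key : ∀ i, |y i| ≤ m i := by
      intro i
      fin_cases i
      · exact (sq_le_one_iff_abs_le_one (y 0)).1
          (by linarith [sq_nonneg (y 1), sq_nonneg (y 2)])
      · exact Real.abs_le_sqrt (by simp; nlinarith [sq_nonneg (y 2), sq_nonneg (1 + y 0)])
      · exact Real.abs_le_sqrt (by simp; nlinarith [sq_nonneg (y 1), sq_nonneg (1 + y 0)])
    have key2 : ∀ i, |t * y i| ≤ m i := fun i => by
      rw [abs_mul, abs_of_pos ht0]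
      exact (mul_le_of_le_one_left (abs_nonneg _) ht1.le).trans (key i)
    constructor <;> intro i
    · simpa [y] using (abs_le.1 (key2 i)).1
    · simpa [y] using (abs_le.1 (key2 i)).2
  have hvol : volume (b.repr ⁻¹' (WithLp.ofLp ⁻¹' Set.Icc (-m) m)) = 16 * ENNReal.ofReal h := by
    have hms : MeasurableSet (WithLp.ofLp ⁻¹' Set.Icc (-m) m : Set E3) :=
      measurableSet_Icc.preimage (by fun_prop)
    rw [b.measurePreserving_repr.measure_preimage hms.nullMeasurableSet,
      (PiLp.volume_preserving_ofLp (Fin 3)).measure_preimage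
        measurableSet_Icc.nullMeasurableSet, Real.volume_Icc_pi, Fin.prod_univ_three,
      ← ENNReal.ofReal_mul (by simp [m]), ← ENNReal.ofReal_mul (by simp [m])]
    have h16 : (16 : ℝ≥0∞) = ENNReal.ofReal 16 := by simp
    rw [h16, ← ENNReal.ofReal_mul (by norm_num)]
    congr 1
    simp only [m, Pi.neg_apply, Matrix.cons_val]
    nlinarith [Real.sq_sqrt (by positivity : 0 ≤ 2 * h)]
  rw [sphereMeasure, Measure.toSphere_apply' _ hmeas]
  calc _ ≤ (3 : ℝ≥0∞) * (16 * ENNReal.ofReal h) := by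
        rw [← hvol]
        simpa using mul_le_mul_right (measure_mono hsub) (3 : ℝ≥0∞)
    _ = 48 * ENNReal.ofReal h := by rw [← mul_assoc]; norm_num

/-- Integrals of a decreasing function of `s` are controlled by the distribution function of `s`
near zero. -/
lemma lintegral_comp_le_of_measure_le {X : Type*} [MeasurableSpace X] {μ : Measure X} {s : X → ℝ}
    (hs : Measurable s) {K : ℝ≥0∞} (hK : K ≠ ∞)
    (hμ : ∀ h : ℝ, 0 ≤ h → μ {x | s x ≤ h} ≤ K * ENNReal.ofReal h)
    {g : ℝ → ℝ} (hg : Measurable g) (hg0 : ∀ x, 0 ≤ x → 0 ≤ g x)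
    (hanti : AntitoneOn g (Set.Ioi 0)) :
    ∫⁻ x, ENNReal.ofReal (g (s x)) ∂μ ≤ K * ∫⁻ x in Set.Ioi 0, ENNReal.ofReal (g x) := by
  have hpos : ∀ᵐ x ∂μ, 0 < s x := by
    have := hμ 0 le_rfl
    simpa [ae_iff] using this
  rw [lintegral_eq_lintegral_meas_lt μ (hpos.mono fun x hx => hg0 _ hx.le)
      (hg.comp hs).aemeasurable,
    lintegral_eq_lintegral_meas_lt (volume.restrict (Set.Ioi 0))
      ((ae_restrict_mem measurableSet_Ioi).mono fun x hx => hg0 _ (le_of_lt hx)) hg.aemeasurable,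
    ← lintegral_const_mul' _ _ hK]
  refine lintegral_mono fun t => ?_
  rw [Measure.restrict_apply (measurableSet_lt measurable_const hg)]
  set S := {a | t < g a} ∩ Set.Ioi 0
  have hS : ∀ x ∈ S, ENNReal.ofReal x ≤ volume S := fun x hx => by
    have hx0 : 0 < x := hx.2
    calc ENNReal.ofReal x = volume (Set.Ioc 0 x) := by simp
      _ ≤ volume S := measure_mono fun y hy =>
        ⟨lt_of_lt_of_le hx.1 (hanti hy.1 hx0 hy.2), hy.1⟩
  rcases eq_or_ne (volume S) ∞ with htop | htop
  · rcases eq_or_ne K 0 with rfl | hK0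
    · have h0 : μ {a | t < g (s a)} ≤ 0 := by
        calc μ {a | t < g (s a)} ≤ μ (⋃ n : ℕ, {x | s x ≤ n}) :=
              measure_mono fun x _ => by
                obtain ⟨n, hn⟩ := exists_nat_ge (s x)
                exact Set.mem_iUnion.2 ⟨n, hn⟩
          _ ≤ 0 := by
            rw [nonpos_iff_eq_zero, measure_iUnion_null_iff]
            intro n
            simpa using hμ n n.cast_nonneg
      exact h0.trans zero_le
    · rw [htop, ENNReal.mul_top hK0]
      exact le_top
  · calc μ {a | t < g (s a)} ≤ μ {x | s x ≤ (volume S).toReal} := by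
          refine measure_mono_ae (hpos.mono fun x hx hxt => ?_)
          exact (ENNReal.ofReal_le_iff_le_toReal htop).1 (hS _ ⟨hxt, hx⟩)
      _ ≤ K * volume S := by
          simpa [ENNReal.ofReal_toReal htop] using hμ _ (volume S).toReal_nonneg

lemma lintegral_min_rpow_lt_top {p q : ℝ} (hp : -1 < p) (hq : q < -1) :
    ∫⁻ x in Set.Ioi (0 : ℝ), ENNReal.ofReal (min (x ^ p) (x ^ q)) < ∞ := by
  have hint : IntegrableOn (fun x : ℝ => min (x ^ p) (x ^ q)) (Set.Ioi 0) := by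
    rw [← Set.Ioc_union_Ioi_eq_Ioi zero_le_one]
    have hms : ∀ s : Set ℝ, AEStronglyMeasurable (fun x : ℝ => min (x ^ p) (x ^ q))
        (volume.restrict s) := fun s => by
      exact Measurable.aestronglyMeasurable (by fun_prop)
    refine IntegrableOn.union ?_ ?_
    · have h := (intervalIntegrable_iff_integrableOn_Ioc_of_le zero_le_one).1
        (intervalIntegral.intervalIntegrable_rpow' hp (a := 0) (b := 1))
      refine Integrable.mono' h (hms _) ((ae_restrict_mem measurableSet_Ioc).mono fun x hx => ?_)
      have hx0 : 0 ≤ x := hx.1.le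
      rw [Real.norm_of_nonneg (by positivity)]
      exact min_le_left _ _
    · refine Integrable.mono' (integrableOn_Ioi_rpow_of_lt hq zero_lt_one) (hms _)
        ((ae_restrict_mem measurableSet_Ioi).mono fun x hx => ?_)
      have hx0 : 0 ≤ x := zero_le_one.trans (le_of_lt hx)
      rw [Real.norm_of_nonneg (by positivity)]
      exact min_le_right _ _
  exact hint.lintegral_lt_top

lemma rpow_le_add_rpow_of_mem_Icc {x y z p : ℝ} (hx : 0 < x) (hxy : x ≤ y) (hyz : y ≤ z) :
    y ^ p ≤ x ^ p + z ^ p := by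
  have hy := hx.trans_le hxy
  rcases le_total 0 p with hp | hp
  · exact (rpow_le_rpow hy.le hyz hp).trans (le_add_of_nonneg_left (by positivity))
  · exact (rpow_le_rpow_of_nonpos hx hxy hp).trans
      (le_add_of_nonneg_right (rpow_nonneg (hy.le.trans hyz) _))

/-- The integrand where `s ≤ 1`, with `A` and `B` the `γ`-th powers of `r₀ - r'` and `r₀ - t₀`. -/
lemma rpow_neg_le_of_linear_le {α δ A B s V : ℝ} (hα : 0 ≤ α) (hδ0 : 0 ≤ δ) (hδ : δ ≤ 1)
    (hB : 1 ≤ B) (hBA : B ≤ A) (hs0 : 0 < s) (hs1 : s ≤ 1) (hV : (A * s + B) / 4 ≤ V) :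
    V ^ (-α) ≤ 2 * 4 ^ α * ((A ^ (1 - α) + B ^ (1 - α)) * A ^ (δ - 1) * s ^ (δ - 1)) := by
  have hB0 : 0 < B := by linarith
  have hA0 : 0 < A := by linarith
  have hAs : 0 < A * s := by positivity
  set W := A * s + B
  have hW1 : 1 ≤ W := by linarith
  have hW0 : 0 < W := by linarith
  have hW2 : W ≤ 2 * A := by nlinarith
  have h1 : V ^ (-α) ≤ 4 ^ α * W ^ (-α) := by
    calc V ^ (-α) ≤ (W / 4) ^ (-α) := rpow_le_rpow_of_nonpos (by positivity) hV (by linarith)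
      _ = 4 ^ α * W ^ (-α) := by
        rw [div_rpow hW0.le (by norm_num), rpow_neg (by norm_num : (0 : ℝ) ≤ 4)]
        field_simp
  have h2 : W ^ (1 - α) ≤ 2 * (A ^ (1 - α) + B ^ (1 - α)) := by
    have h2' := rpow_le_add_rpow_of_mem_Icc (p := 1 - α) hB0 (by linarith : B ≤ W) hW2
    have h3 : (2 : ℝ) ^ (1 - α) ≤ 2 := by
      simpa using rpow_le_rpow_of_exponent_le (by norm_num : (1 : ℝ) ≤ 2)
        (by linarith : 1 - α ≤ 1)
    rw [mul_rpow (by norm_num) hA0.le] at h2'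
    have := mul_le_mul_of_nonneg_right h3 (rpow_nonneg hA0.le (1 - α))
    have := rpow_nonneg hB0.le (1 - α)
    linarith
  have h3 : W ^ (-1 : ℝ) ≤ A ^ (δ - 1) * s ^ (δ - 1) := by
    calc W ^ (-1 : ℝ) ≤ W ^ (δ - 1) := rpow_le_rpow_of_exponent_le hW1 (by linarith)
      _ ≤ (A * s) ^ (δ - 1) :=
        rpow_le_rpow_of_nonpos hAs (by linarith) (by linarith)
      _ = _ := mul_rpow hA0.le hs0.le
  have h4 : W ^ (-α) = W ^ (1 - α) * W ^ (-1 : ℝ) := by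
    rw [← rpow_add hW0]; ring_nf
  calc V ^ (-α) ≤ 4 ^ α * (W ^ (1 - α) * W ^ (-1 : ℝ)) := h4 ▸ h1
    _ ≤ 4 ^ α * ((2 * (A ^ (1 - α) + B ^ (1 - α))) * (A ^ (δ - 1) * s ^ (δ - 1))) := by
      gcongr
    _ = _ := by ring

/-- Pointwise bound of the integrand in terms of the rescaled height
`s = r₀² (1 + cos θ) / a²`, where `a = r₀ - r'` and `b = r₀ - t₀`. -/
lemma integrand_le {γ α β ε δ a b s r P : ℝ} (hγ1 : 1 < γ) (hγ2 : γ < 2)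
    (hα : 0 ≤ α) (hβ : 0 ≤ β) (hβγ : 2 < β + α * γ) (hε : 0 < ε) (hδ0 : 0 < δ) (hδ : δ ≤ 1)
    (hδε : γ * δ ≤ ε) (hb : 1 ≤ b) (hba : b ≤ a) (hs : 0 < s) (har : a ≤ r)
    (hr1 : a ^ 2 * (1 + s) ≤ 9 * r ^ 2) (hr2 : r ^ 2 ≤ 2 * (a ^ 2 * (1 + s)))
    (hP : a ^ 2 * s / 2 * r ^ (γ - 2) ≤ P) :
    (P + b ^ γ) ^ (-α) * r ^ (-β) ≤
      2 * 4 ^ α * 3 ^ β * (a ^ (-β - γ + ε) * (a ^ ((1 - α) * γ) + b ^ ((1 - α) * γ))) *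
        min (s ^ (δ - 1)) (s ^ (-((β + α * γ) / 2))) := by
  have ha1 : 1 ≤ a := hb.trans hba
  have ha0 : 0 < a := by linarith
  have hb0 : 0 < b := by linarith
  have hr0 : 0 < r := by linarith
  have h3 : (1 : ℝ) ≤ 3 ^ β := one_le_rpow (by norm_num) hβ
  have hpow : ∀ {m x : ℝ}, 0 < x → x ^ ((1 - α) * m) = (x ^ m) ^ (1 - α) := fun {m x} hx => by
    rw [← rpow_mul hx.le, mul_comm]
  rcases le_or_gt s 1 with hs1 | hs1
  · rw [min_eq_left (rpow_le_rpow_of_exponent_ge hs hs1 (by linarith))]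
    have hr : r ≤ 2 * a := by
      refine abs_le_of_sq_le_sq' ?_ (by positivity) |>.2
      nlinarith [mul_le_mul_of_nonneg_left hs1 (sq_nonneg a)]
    have hV : (a ^ γ * s + b ^ γ) / 4 ≤ P + b ^ γ := by
      have h1 : (2 * a) ^ (γ - 2) ≤ r ^ (γ - 2) :=
        rpow_le_rpow_of_nonpos hr0 hr (by linarith)
      have h2 : (1 / 2 : ℝ) ≤ 2 ^ (γ - 2) := by
        calc (1 / 2 : ℝ) = 2 ^ (-1 : ℝ) := by rw [rpow_neg_one]; norm_num
          _ ≤ _ := rpow_le_rpow_of_exponent_le (by norm_num) (by linarith)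
      rw [mul_rpow (by norm_num) ha0.le] at h1
      have h4 : 1 / 2 * a ^ (γ - 2) ≤ r ^ (γ - 2) :=
        (mul_le_mul_of_nonneg_right h2 (by positivity)).trans h1
      have h5 : a ^ γ = a ^ 2 * a ^ (γ - 2) := by
        rw [← rpow_natCast a 2, ← rpow_add ha0]; norm_num
      have h6 : a ^ 2 * s / 2 * (1 / 2 * a ^ (γ - 2)) ≤ P :=
        (mul_le_mul_of_nonneg_left h4 (by positivity)).trans hP
      have h7 : 0 < b ^ γ := by positivity
      rw [h5]
      linarith
    have h1 := rpow_neg_le_of_linear_le hα hδ0.le hδ (one_le_rpow hb (by linarith))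
      (rpow_le_rpow hb0.le hba (by linarith)) hs hs1 hV
    have h2 : r ^ (-β) ≤ a ^ (-β) := rpow_le_rpow_of_nonpos ha0 har (by linarith)
    have h4 : (a ^ γ) ^ (δ - 1) * a ^ (-β) ≤ a ^ (-β - γ + ε) := by
      rw [← rpow_mul ha0.le, ← rpow_add ha0]
      exact rpow_le_rpow_of_exponent_le ha1 (by linarith)
    rw [hpow ha0, hpow hb0]
    set D := (a ^ γ) ^ (1 - α) + (b ^ γ) ^ (1 - α)
    have hD : 0 < D := by positivity
    calc (P + b ^ γ) ^ (-α) * r ^ (-β)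
        ≤ 2 * 4 ^ α * (D * (a ^ γ) ^ (δ - 1) * s ^ (δ - 1)) * a ^ (-β) := by gcongr
      _ = 2 * 4 ^ α * 1 * (((a ^ γ) ^ (δ - 1) * a ^ (-β)) * D) * s ^ (δ - 1) := by ring
      _ ≤ _ := by gcongr
  · rw [min_eq_right (rpow_le_rpow_of_exponent_le hs1.le (by linarith))]
    set q := a * √s
    have hq0 : 0 < q := by positivity
    have hq2 : q ^ 2 = a ^ 2 * s := by rw [mul_pow, sq_sqrt hs.le]
    have hq : ∀ p : ℝ, q ^ p = a ^ p * s ^ (p / 2) := fun p => by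
      rw [mul_rpow ha0.le (by positivity), sqrt_eq_rpow, ← rpow_mul hs.le]
      ring_nf
    have hrq : r ≤ 2 * q := by
      refine abs_le_of_sq_le_sq' ?_ (by positivity) |>.2
      nlinarith [mul_le_mul_of_nonneg_left hs1.le (sq_nonneg a)]
    have hqr : q / 3 ≤ r := by
      refine abs_le_of_sq_le_sq' ?_ (by positivity) |>.2
      nlinarith [sq_nonneg a]
    have hV : q ^ γ / 4 ≤ P + b ^ γ := by
      have h1 : (2 * q) ^ (γ - 2) ≤ r ^ (γ - 2) :=
        rpow_le_rpow_of_nonpos hr0 hrq (by linarith)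
      have h2 : (1 / 2 : ℝ) ≤ 2 ^ (γ - 2) := by
        calc (1 / 2 : ℝ) = 2 ^ (-1 : ℝ) := by rw [rpow_neg_one]; norm_num
          _ ≤ _ := rpow_le_rpow_of_exponent_le (by norm_num) (by linarith)
      rw [mul_rpow (by norm_num) hq0.le] at h1
      have h4 : 1 / 2 * q ^ (γ - 2) ≤ r ^ (γ - 2) :=
        (mul_le_mul_of_nonneg_right h2 (by positivity)).trans h1
      have h5 : q ^ γ = q ^ 2 * q ^ (γ - 2) := by
        rw [← rpow_natCast q 2, ← rpow_add hq0]; norm_num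
      rw [← hq2] at hP
      have h6 : q ^ 2 / 2 * (1 / 2 * q ^ (γ - 2)) ≤ P :=
        (mul_le_mul_of_nonneg_left h4 (by positivity)).trans hP
      have h7 : 0 < b ^ γ := by positivity
      rw [h5]
      linarith
    have h1 : (P + b ^ γ) ^ (-α) ≤ 4 ^ α * q ^ (-(α * γ)) := by
      calc (P + b ^ γ) ^ (-α) ≤ (q ^ γ / 4) ^ (-α) :=
            rpow_le_rpow_of_nonpos (by positivity) hV (by linarith)
        _ = 4 ^ α * q ^ (-(α * γ)) := by
          rw [div_rpow (by positivity) (by norm_num), rpow_neg (by norm_num : (0 : ℝ) ≤ 4),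
            ← rpow_mul hq0.le]
          field_simp
    have h2 : r ^ (-β) ≤ 3 ^ β * q ^ (-β) := by
      calc r ^ (-β) ≤ (q / 3) ^ (-β) :=
            rpow_le_rpow_of_nonpos (by positivity) hqr (by linarith)
        _ = 3 ^ β * q ^ (-β) := by
          rw [div_rpow hq0.le (by norm_num), rpow_neg (by norm_num : (0 : ℝ) ≤ 3)]
          field_simp
    have h4 : q ^ (-(α * γ)) * q ^ (-β) =
        a ^ (-(β + α * γ)) * s ^ (-((β + α * γ) / 2)) := by
      rw [← rpow_add hq0, hq]
      ring_nf
    have h5 : a ^ (-(β + α * γ)) ≤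
        2 * (a ^ (-β - γ + ε) * (a ^ ((1 - α) * γ) + b ^ ((1 - α) * γ))) := by
      have h6 : a ^ (-(β + α * γ)) ≤ a ^ (-β - γ + ε) * a ^ ((1 - α) * γ) := by
        rw [← rpow_add ha0]
        exact rpow_le_rpow_of_exponent_le ha1 (by linarith)
      have h7 : 0 ≤ a ^ (-β - γ + ε) * a ^ ((1 - α) * γ) := by positivity
      have h8 : 0 ≤ a ^ (-β - γ + ε) * b ^ ((1 - α) * γ) := by positivity
      linarith
    calc (P + b ^ γ) ^ (-α) * r ^ (-β)
        ≤ (4 ^ α * q ^ (-(α * γ))) * (3 ^ β * q ^ (-β)) := by gcongr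
      _ = 4 ^ α * 3 ^ β * (q ^ (-(α * γ)) * q ^ (-β)) := by ring
      _ = 4 ^ α * 3 ^ β * a ^ (-(β + α * γ)) * s ^ (-((β + α * γ) / 2)) := by rw [h4]; ring
      _ ≤ 4 ^ α * 3 ^ β *
          (2 * (a ^ (-β - γ + ε) * (a ^ ((1 - α) * γ) + b ^ ((1 - α) * γ)))) *
            s ^ (-((β + α * γ) / 2)) := by gcongr
      _ = _ := by ring

/-- Geometry of the point at distance `r'` from `x₀`, where `r₀ = ‖x₀‖`, `w = r₀² (1 + cos θ)`,
and `r` is its distance to the origin. -/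
lemma distance_bounds {r₀ r' r w : ℝ} (hr' : 0 ≤ r') (hr'r₀ : r' < r₀) (hr : 0 ≤ r) (hw : 0 ≤ w)
    (hw2 : w ≤ 2 * r₀ ^ 2) (hrw : r₀ * r ^ 2 = r₀ * (r₀ - r') ^ 2 + 2 * r' * w) :
    r₀ - r' ≤ r ∧ (r₀ - r') ^ 2 + w ≤ 9 * r ^ 2 ∧ r ^ 2 ≤ 2 * ((r₀ - r') ^ 2 + w) ∧
      r₀ * w / 2 ≤ r * (r₀ * (r - (r₀ - r')) + w) := by
  have hr₀ : 0 < r₀ := by linarith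
  have har : r₀ - r' ≤ r := by
    refine abs_le_of_sq_le_sq' ?_ hr |>.2
    nlinarith [mul_nonneg hr' hw]
  refine ⟨har, ?_, ?_, ?_⟩
  · rcases le_total (2 * r') r₀ with h | h
    · nlinarith
    · nlinarith [mul_le_mul_of_nonneg_right h hw]
  · nlinarith [mul_le_mul_of_nonneg_right hr'r₀.le hw]
  · rcases le_total (2 * r') r₀ with h | h
    · nlinarith [mul_nonneg hr (mul_nonneg hr₀.le (sub_nonneg.2 har)),
        mul_le_mul_of_nonneg_right (by linarith : r₀ / 2 ≤ r) hw]
    · have h1 : r₀ * (r ^ 2 - (r₀ - r') ^ 2) ≤ 2 * r * (r₀ * (r - (r₀ - r'))) := by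
        nlinarith [mul_nonneg hr₀.le (sq_nonneg (r - (r₀ - r')))]
      nlinarith [mul_le_mul_of_nonneg_right h hw, mul_nonneg hr hw]

/-- Sphere integration lemma in the exterior region: for `1 < γ < 2`,
`α, β ≥ 0` with `β + αγ > 2` and `ε > 0`, there is `C > 0` such that for `r₀ = |x₀|`,
`t₀ + 2 ≤ r₀` and `0 ≤ r̃ ≤ t₀`,
`∫_{S²} ((1+τ)r^γ + (r₀−t₀)^γ)^{−α} r^{−β} dσ
  ≤ C (r₀−r̃)^{2−β−γ+ε} r₀^{−2} ((r₀−r̃)^{(1−α)γ} + (r₀−t₀)^{(1−α)γ})`. -/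
theorem sphere_integration_exterior (γ α β ε : ℝ) (hγ1 : 1 < γ) (hγ2 : γ < 2)
    (hα : 0 ≤ α) (hβ : 0 ≤ β) (hβγ : 2 < β + α * γ) (hε : 0 < ε) :
    ∃ C : ℝ, 0 < C ∧ ∀ (x₀ : E3) (t₀ r' : ℝ), 0 ≤ t₀ → t₀ + 2 ≤ ‖x₀‖ →
      0 ≤ r' → r' ≤ t₀ →
      (∫⁻ ω : Metric.sphere (0 : E3) 1,
        ENNReal.ofReal
          (((1 + ⟪x₀ + r' • (ω : E3), (ω : E3)⟫_ℝ / ‖x₀ + r' • (ω : E3)‖)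
              * ‖x₀ + r' • (ω : E3)‖ ^ γ + (‖x₀‖ - t₀) ^ γ) ^ (-α)
            * ‖x₀ + r' • (ω : E3)‖ ^ (-β)) ∂sphereMeasure)
        ≤ ENNReal.ofReal (C * (‖x₀‖ - r') ^ (2 - β - γ + ε) * ‖x₀‖ ^ (-(2 : ℝ))
            * ((‖x₀‖ - r') ^ ((1 - α) * γ) + (‖x₀‖ - t₀) ^ ((1 - α) * γ))) := by
  set δ := min (ε / γ) (1 / 2)
  have hδ0 : 0 < δ := lt_min (by positivity) (by norm_num)
  have hδ1 : δ ≤ 1 := (min_le_right _ _).trans (by norm_num)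
  have hδε : γ * δ ≤ ε := by
    have h : δ ≤ ε / γ := min_le_left _ _
    rwa [le_div_iff₀' (by linarith)] at h
  set κ := (β + α * γ) / 2
  set g : ℝ → ℝ := fun s => min (s ^ (δ - 1)) (s ^ (-κ))
  set I := ∫⁻ s in Set.Ioi (0 : ℝ), ENNReal.ofReal (g s)
  have hI : I ≠ ∞ := (lintegral_min_rpow_lt_top (by linarith) (by simp only [κ]; linarith)).ne
  set C₀ : ℝ := 2 * 4 ^ α * 3 ^ β
  have hC₀ : 0 < C₀ := by positivity
  refine ⟨C₀ * (48 * (I.toReal + 1)), by positivity, fun x₀ t₀ r' ht₀ hr₀ hr' hrt => ?_⟩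
  set r₀ := ‖x₀‖
  set a := r₀ - r'
  set b := r₀ - t₀
  have hb : 1 ≤ b := by simp only [b]; linarith
  have hba : b ≤ a := by simp only [a, b]; linarith
  have ha0 : 0 < a := by linarith
  have hr₀0 : 0 < r₀ := by linarith
  set D := a ^ ((1 - α) * γ) + b ^ ((1 - α) * γ)
  have hb0 : 0 < b := by linarith
  have hD : 0 < D := by positivity
  set M := C₀ * (a ^ (-β - γ + ε) * D)
  have hM : 0 < M := by positivity
  let s : Metric.sphere (0 : E3) 1 → ℝ := fun ω => r₀ * (r₀ + ⟪x₀, (ω : E3)⟫_ℝ) / a ^ 2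
  have hcap : ∀ h : ℝ, 0 ≤ h → sphereMeasure {ω | s ω ≤ h} ≤
      ENNReal.ofReal (48 * (a ^ 2 / r₀ ^ 2)) * ENNReal.ofReal h := fun h hh => by
    have he : ‖r₀⁻¹ • x₀‖ = 1 := by
      rw [norm_smul, norm_inv, Real.norm_of_nonneg hr₀0.le]
      exact inv_mul_cancel₀ hr₀0.ne'
    have h1 := sphereMeasure_cap_le he (h := a ^ 2 / r₀ ^ 2 * h) (by positivity)
    have h2 : {ω : Metric.sphere (0 : E3) 1 | s ω ≤ h} =
        {ω : Metric.sphere (0 : E3) 1 | 1 + ⟪r₀⁻¹ • x₀, (ω : E3)⟫_ℝ ≤ a ^ 2 / r₀ ^ 2 * h} := by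
      ext ω
      simp only [Set.mem_ofPred_eq, s, real_inner_smul_left]
      rw [div_le_iff₀ (by positivity), div_mul_eq_mul_div, le_div_iff₀ (by positivity)]
      have h3 : (1 + r₀⁻¹ * ⟪x₀, (ω : E3)⟫_ℝ) * r₀ ^ 2 = r₀ * (r₀ + ⟪x₀, (ω : E3)⟫_ℝ) := by
        field_simp
      rw [h3, mul_comm h]
    rw [h2]
    refine h1.trans (le_of_eq ?_)
    have h48 : (48 : ℝ≥0∞) = ENNReal.ofReal 48 := by simp
    rw [h48, ← ENNReal.ofReal_mul (by norm_num), ← ENNReal.ofReal_mul (by positivity), mul_assoc]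
  have hs : Measurable s := by fun_prop
  have hpos : ∀ᵐ ω ∂sphereMeasure, 0 < s ω := by
    have h := hcap 0 le_rfl
    simpa [ae_iff] using h
  have hanti : AntitoneOn g (Set.Ioi 0) := fun x hx y hy hxy =>
    min_le_min (rpow_le_rpow_of_nonpos hx hxy (by linarith))
      (rpow_le_rpow_of_nonpos hx hxy (by simp only [κ]; linarith))
  have hmain := lintegral_comp_le_of_measure_le hs ENNReal.ofReal_ne_top hcap
    (by fun_prop : Measurable g) (fun x hx => by positivity) hanti
  calc _ ≤ ∫⁻ ω, ENNReal.ofReal M * ENNReal.ofReal (g (s ω)) ∂sphereMeasure := by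
        refine lintegral_mono_ae (hpos.mono fun ω hω => ?_)
        rw [← ENNReal.ofReal_mul hM.le]
        refine ENNReal.ofReal_le_ofReal ?_
        have hω1 : ‖(ω : E3)‖ = 1 := by simp
        set c := ⟪x₀, (ω : E3)⟫_ℝ
        set r := ‖x₀ + r' • (ω : E3)‖
        have hr2 : r ^ 2 = r₀ ^ 2 + 2 * r' * c + r' ^ 2 := by
          simp only [r, c, r₀]
          rw [norm_add_sq_real, real_inner_smul_right, norm_smul, hω1, mul_one,
            Real.norm_of_nonneg hr']
          ring
        have hτ : ⟪x₀ + r' • (ω : E3), (ω : E3)⟫_ℝ = c + r' := by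
          rw [inner_add_left, real_inner_smul_left, real_inner_self_eq_norm_sq, hω1]
          ring
        have hc : c ≤ r₀ := by simpa [hω1] using real_inner_le_norm x₀ (ω : E3)
        have hsw : a ^ 2 * s ω = r₀ * (r₀ + c) := by
          simp only [s]
          field_simp
          rfl
        have hw : 0 ≤ r₀ * (r₀ + c) := hsw ▸ by positivity
        obtain ⟨h1, h2, h3, h4⟩ := distance_bounds (r₀ := r₀) (r := r) hr' (by linarith) (norm_nonneg _) hw
          (by nlinarith) (by rw [hr2]; ring)
        have hr : 0 < r := ha0.trans_le h1
        refine integrand_le hγ1 hγ2 hα hβ hβγ hε hδ0 hδ1 hδε hb hba hω h1 ?_ ?_ ?_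
        · rw [mul_add, hsw, mul_one]; exact h2
        · rw [mul_add, hsw, mul_one]; exact h3
        · have h5 : r ^ γ = r ^ 2 * r ^ (γ - 2) := by
            rw [← rpow_natCast r 2, ← rpow_add hr]; norm_num
          have h6 : (1 + (c + r') / r) * r ^ 2 = r * (r + (c + r')) := by field_simp
          rw [hτ, hsw, h5, ← mul_assoc, h6]
          refine mul_le_mul_of_nonneg_right ?_ (by positivity)
          refine le_of_mul_le_mul_left ?_ hr₀0
          linarith
    _ ≤ ENNReal.ofReal M * (ENNReal.ofReal (48 * (a ^ 2 / r₀ ^ 2)) * I) := by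
        rw [lintegral_const_mul' _ _ ENNReal.ofReal_ne_top]
        gcongr
    _ ≤ ENNReal.ofReal M *
          (ENNReal.ofReal (48 * (a ^ 2 / r₀ ^ 2)) * ENNReal.ofReal (I.toReal + 1)) := by
        gcongr
        rw [← ENNReal.ofReal_toReal hI]
        exact ENNReal.ofReal_le_ofReal (by simp)
    _ = _ := by
        rw [← ENNReal.ofReal_mul (by positivity), ← ENNReal.ofReal_mul hM.le]
        congr 1
        have h1 : a ^ (2 - β - γ + ε) = a ^ 2 * a ^ (-β - γ + ε) := by
          rw [← rpow_natCast a 2, ← rpow_add ha0]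
          congr 1
          push_cast
          ring
        rw [h1, rpow_neg hr₀0.le, rpow_two]
        simp only [M]
        field_simp
end
end
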